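/- arXiv:2601.01733 — 6 statements merged into one kernel-verified Lean document; each statement's English description precedes it below -/
import Mathlib

section
/- Let φ be a bounded non-degenerate representation of a C*-algebra A on a complex Hilbert space H, i.e. a bounded unital-on-its-range algebra homomorphism φ : A → B(H) such that the closed linear span of {φ(a)ξ : a ∈ A, ξ ∈ H} equals H. Then the following are equivalent: (1) φ is completely bounded; (2) there exists an invertible operator S ∈ B(H) such that a ↦ Sφ(a)S⁻¹ is a *-representation of A on H. -/
open scoped Matrix

noncomputable section

/-- The C*-norm of a square matrix over a (possibly non-unital) C*-algebra `A`, defined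
intrinsically via the spectral radius in the unitization: `‖x‖ = √(spectralRadius ℂ (xᴴ * x))`.
This agrees with the unique C*-norm on `Mₙ(A)`. -/
def cstarMatrixNorm {A : Type*} [NonUnitalCStarAlgebra A] {n : ℕ}
    (x : Matrix (Fin n) (Fin n) A) : ℝ :=
  Real.sqrt ((spectralRadius ℂ
    ((x.map (Unitization.inr : A → Unitization ℂ A))ᴴ *
      x.map (Unitization.inr : A → Unitization ℂ A))).toReal)

/-- A map between C*-algebras is *completely bounded* if the norms of its amplifications
`φ⁽ⁿ⁾ : Mₙ(A) → Mₙ(B)`, `(aᵢⱼ) ↦ (φ(aᵢⱼ))`, are uniformly bounded. -/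
def CompletelyBounded {A B : Type*} [NonUnitalCStarAlgebra A] [NonUnitalCStarAlgebra B]
    (φ : A → B) : Prop :=
  ∃ C : ℝ, ∀ (n : ℕ) (x : Matrix (Fin n) (Fin n) A),
    cstarMatrixNorm (x.map φ) ≤ C * cstarMatrixNorm x

/-- Positivity of a square matrix over a C*-algebra: `x ≥ 0` iff `x = yᴴ * y` for some `y`. -/
def MatIsPos {B : Type*} [NonUnitalSemiring B] [StarRing B] {n : ℕ}
    (x : Matrix (Fin n) (Fin n) B) : Prop :=
  ∃ y : Matrix (Fin n) (Fin n) B, x = yᴴ * y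

/-- A map between C*-algebras is *completely positive* if all of its amplifications
`(aᵢⱼ) ↦ (φ(aᵢⱼ))` map positive matrices to positive matrices. -/
def CompletelyPositive {A B : Type*} [NonUnitalSemiring A] [StarRing A]
    [NonUnitalSemiring B] [StarRing B] (φ : A → B) : Prop :=
  ∀ (n : ℕ) (x : Matrix (Fin n) (Fin n) A), MatIsPos x → MatIsPos (x.map φ)

/-- A map between C*-algebras is a `*`-representation if it is multiplicative and
star-preserving (linearity/boundedness are imposed on the ambient data separately). -/
def IsStarRep {A B : Type*} [Mul A] [Star A] [Mul B] [Star B] (ψ : A → B) : Prop :=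
  (∀ a b, ψ (a * b) = ψ a * ψ b) ∧ ∀ a, ψ (star a) = star (ψ a)

section MatrixNorm

section NonUnital

variable {A B ι : Type*} [NonUnitalCStarAlgebra A] [PartialOrder A] [StarOrderedRing A]
  [NonUnitalCStarAlgebra B] [PartialOrder B] [StarOrderedRing B] [Fintype ι]

theorem CStarMatrix.norm_mapₙₐ_le (f : A →⋆ₙₐ[ℂ] B) (x : CStarMatrix ι ι A) :
    ‖x.map f‖ ≤ ‖x‖ :=
  NonUnitalStarAlgHom.norm_apply_le (CStarMatrix.mapₙₐ (n := ι) f) x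

theorem CStarMatrix.norm_mapₙₐ (f : A →⋆ₙₐ[ℂ] B) (hf : Function.Injective f)
    (x : CStarMatrix ι ι A) : ‖x.map f‖ = ‖x‖ :=
  NonUnitalStarAlgHom.norm_map (CStarMatrix.mapₙₐ (n := ι) f) (CStarMatrix.map_injective hf) x

theorem cstarMatrixNorm_eq {n : ℕ} (x : Matrix (Fin n) (Fin n) A) :
    cstarMatrixNorm x = ‖CStarMatrix.ofMatrix x‖ := by
  rw [← CStarMatrix.norm_mapₙₐ (Unitization.inrNonUnitalStarAlgHom ℂ A)
      Unitization.inr_injective]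
  exact CStarAlgebra.sqrt_toReal_spectralRadius_star_mul_self_eq_norm
    (CStarMatrix.ofMatrix (x.map (Unitization.inr : A → Unitization ℂ A)))

end NonUnital

/-- The defect `‖a‖² - a⋆a` of an element of a C⋆-algebra is a square. -/
theorem CStarAlgebra.exists_star_mul_self_add_eq {A : Type*} [CStarAlgebra A] (a : A) :
    ∃ b : A, star a * a + star b * b = ((‖a‖ ^ 2 : ℝ) : ℂ) • (1 : A) := by
  let _ : PartialOrder A := CStarAlgebra.spectralOrder A
  have _ : StarOrderedRing A := CStarAlgebra.spectralOrderedRing A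
  have key := CStarAlgebra.star_mul_le_algebraMap_norm_sq (a := a)
  obtain ⟨b, hb⟩ := CStarAlgebra.nonneg_iff_eq_star_mul_self.mp (sub_nonneg.mpr key)
  refine ⟨b, ?_⟩
  rw [← hb, add_sub_cancel, Algebra.algebraMap_eq_smul_one, Complex.coe_smul]

variable {H : Type*} [NormedAddCommGroup H] [InnerProductSpace ℂ H] [CompleteSpace H]

theorem CStarMatrix.sum_norm_sq_le {ι : Type*} [Fintype ι]
    (y : CStarMatrix ι ι (H →L[ℂ] H)) (h : ι → H) :
    ∑ i, ‖∑ j, y i j (h j)‖ ^ 2 ≤ ‖y‖ ^ 2 * ∑ j, ‖h j‖ ^ 2 := by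
  classical
  obtain ⟨z, hz⟩ := CStarAlgebra.exists_star_mul_self_add_eq y
  have expand (w : CStarMatrix ι ι (H →L[ℂ] H)) :
      ((∑ i, ‖∑ j, w i j (h j)‖ ^ 2 : ℝ) : ℂ) =
        ∑ i, inner ℂ (h i) (∑ j, (star w * w) i j (h j)) := by
    have h1 (k : ι) : ((‖∑ j, w k j (h j)‖ : ℂ) ^ 2) =
        ∑ i, ∑ j, inner ℂ (w k i (h i)) (w k j (h j)) := by
      have := inner_self_eq_norm_sq_to_K (𝕜 := ℂ) (∑ j, w k j (h j))
      rw [sum_inner] at this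
      simp_rw [inner_sum] at this
      exact this.symm
    push_cast
    simp_rw [h1, inner_sum, CStarMatrix.mul_apply, CStarMatrix.star_apply,
      _root_.sum_apply, inner_sum, mul_apply_eq_comp,
      ContinuousLinearMap.star_eq_adjoint, ContinuousLinearMap.adjoint_inner_right]
    rw [Finset.sum_comm]
    exact Finset.sum_congr rfl fun i _ => Finset.sum_comm
  have h2 : (∑ i, ‖∑ j, y i j (h j)‖ ^ 2 : ℝ) + (∑ i, ‖∑ j, z i j (h j)‖ ^ 2 : ℝ) =
      ‖y‖ ^ 2 * ∑ j, ‖h j‖ ^ 2 := by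
    apply Complex.ofReal_injective
    rw [Complex.ofReal_add, expand y, expand z, ← Finset.sum_add_distrib]
    simp_rw [← inner_add_right, ← Finset.sum_add_distrib, ← _root_.add_apply,
      ← CStarMatrix.add_apply, hz, CStarMatrix.smul_apply, _root_.smul_apply]
    push_cast
    rw [Finset.mul_sum]
    refine Finset.sum_congr rfl fun i _ => ?_
    rw [Finset.sum_eq_single i (fun j _ hj => by simp [CStarMatrix.one_apply_ne hj.symm])
      (by simp), CStarMatrix.one_apply_eq, one_apply_eq_self, inner_smul_right,
      inner_self_eq_norm_sq_to_K]
    simp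
  have h3 : (0 : ℝ) ≤ ∑ i, ‖∑ j, z i j (h j)‖ ^ 2 := by positivity
  linarith

end MatrixNorm

section Intertwiner

variable {A : Type*} [Star A] {H : Type*} [NormedAddCommGroup H] [InnerProductSpace ℂ H]
  [CompleteSpace H]

open ContinuousLinearMap in
/-- A positive invertible operator intertwining `a ↦ φ(a)⋆` and `a ↦ φ(a⋆)` makes `φ` similar to a
star-preserving map. -/
theorem exists_isUnit_star_conj_of_intertwining (φ : A → H →L[ℂ] H) {P : H →L[ℂ] H}
    (hP : IsStrictlyPositive P) (h : ∀ a, P * star (φ a) = φ (star a) * P) :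
    ∃ S : H →L[ℂ] H, IsUnit S ∧
      ∀ a, S * φ (star a) * Ring.inverse S = star (S * φ a * Ring.inverse S) := by
  have hunit : IsUnit (CFC.sqrt P) := (CFC.isUnit_sqrt_iff P hP.nonneg).mpr hP.isUnit
  have hsq : CFC.sqrt P * CFC.sqrt P = P := CFC.sqrt_mul_sqrt_self P hP.nonneg
  have hsa : star (CFC.sqrt P) = CFC.sqrt P := (CFC.sqrt_nonneg P).isSelfAdjoint.star_eq
  obtain ⟨p, hp⟩ := hunit
  have hstar : star p = p := Units.ext (by rw [Units.coe_star, hp, hsa])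
  have hstar' : star (↑p⁻¹ : H →L[ℂ] H) = ↑p⁻¹ := by rw [← Units.coe_star_inv, hstar]
  refine ⟨↑p⁻¹, p⁻¹.isUnit, fun a => ?_⟩
  have ha := h a
  rw [← hsq, ← hp] at ha
  rw [Ring.inverse_unit, inv_inv, star_mul, star_mul, hstar', ← Units.coe_star, hstar]
  calc ↑p⁻¹ * φ (star a) * ↑p
      = ↑p⁻¹ * (φ (star a) * (↑p * ↑p)) * ↑p⁻¹ := by simp [mul_assoc]
    _ = ↑p * (star (φ a) * ↑p⁻¹) := by rw [← ha]; simp [mul_assoc]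

open ContinuousLinearMap in
theorem exists_isUnit_star_conj_of_adjoint_bounded_below (φ : A → H →L[ℂ] H) {K : Type*}
    [NormedAddCommGroup K] [InnerProductSpace ℂ K] [CompleteSpace K] (π : A → K →L[ℂ] K)
    (hπ : ∀ a, adjoint (π a) = π (star a)) (T : K →L[ℂ] H)
    (hT : ∀ a, T ∘L π a = φ a ∘L T) {c : ℝ} (hc : 0 < c)
    (hbound : ∀ η, c * ‖η‖ ≤ ‖adjoint T η‖) :
    ∃ S : H →L[ℂ] H, IsUnit S ∧
      ∀ a, S * φ (star a) * Ring.inverse S = star (S * φ a * Ring.inverse S) := by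
  refine exists_isUnit_star_conj_of_intertwining φ (P := T ∘L adjoint T) ?_ fun a => ?_
  · refine IsUnit.isStrictlyPositive ?_ ?_
    · refine isUnit_of_forall_le_norm_inner_map _ (c := ⟨c ^ 2, by positivity⟩)
        (by exact pow_pos hc 2) fun η => ?_
      rw [comp_apply, ← adjoint_inner_right, inner_self_eq_norm_sq_to_K]
      calc ‖η‖ ^ 2 * c ^ 2 = (c * ‖η‖) ^ 2 := by ring
        _ ≤ ‖adjoint T η‖ ^ 2 := by gcongr; exact hbound η
        _ = _ := by simp
    · rw [nonneg_iff_isPositive]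
      exact isPositive_self_comp_adjoint T
  · have h1 := congrArg adjoint (hT a)
    rw [adjoint_comp, adjoint_comp, hπ] at h1
    rw [star_eq_adjoint, ContinuousLinearMap.mul_def, comp_assoc, ← h1, ← comp_assoc, hT,
      ContinuousLinearMap.mul_def, comp_assoc]

open ContinuousLinearMap UniformSpace Completion in
theorem exists_isUnit_star_conj_of_seminormed (φ : A → H →L[ℂ] H) {X : Type*}
    [SeminormedAddCommGroup X] [InnerProductSpace ℂ X] (π : A → X →L[ℂ] X)
    (hπ : ∀ a x y, inner ℂ (π (star a) x) y = inner ℂ x (π a y)) (T : X →L[ℂ] H)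
    (hT : ∀ a x, T (π a x) = φ a (T x)) {C : ℝ}
    (hC : ∀ η, ∃ x, T x = η ∧ ‖x‖ ≤ C * ‖η‖) :
    ∃ S : H →L[ℂ] H, IsUnit S ∧
      ∀ a, S * φ (star a) * Ring.inverse S = star (S * φ a * Ring.inverse S) := by
  refine exists_isUnit_star_conj_of_adjoint_bounded_below φ (K := Completion X)
    (fun a => (π a).completion) (fun a => ?_) T.fromCompletion (fun a => ?_)
    (c := (max C 1)⁻¹) (by positivity) fun η => ?_
  · refine ((eq_adjoint_iff _ _).mpr fun x y => ?_).symm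
    induction x, y using induction_on₂ with
    | hp => apply isClosed_eq <;> fun_prop
    | ih x y => simp [hπ]
  · ext x
    induction x using induction_on with
    | hp => apply isClosed_eq <;> fun_prop
    | ih x => simp [hT]
  · obtain ⟨x, rfl, hx⟩ := hC η
    set η := T x
    have h1 : ‖η‖ ^ 2 ≤ ‖x‖ * ‖adjoint T.fromCompletion η‖ := by
      have h2 := norm_inner_le_norm (𝕜 := ℂ) (x : Completion X) (adjoint T.fromCompletion η)
      rw [adjoint_inner_right, fromCompletion_apply_coe, norm_coe,
        inner_self_eq_norm_sq_to_K] at h2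
      simpa using h2
    rw [inv_mul_le_iff₀ (by positivity)]
    rcases eq_or_ne ‖η‖ 0 with h0 | h0
    · rw [h0]; positivity
    have hpos : 0 < ‖η‖ := lt_of_le_of_ne (norm_nonneg _) h0.symm
    have h3 : ‖x‖ ≤ max C 1 * ‖η‖ := hx.trans (by gcongr; exact le_max_left _ _)
    refine le_of_mul_le_mul_left ?_ hpos
    calc ‖η‖ * ‖η‖ ≤ ‖x‖ * ‖adjoint T.fromCompletion η‖ := by rw [← sq]; exact h1
      _ ≤ max C 1 * ‖η‖ * ‖adjoint T.fromCompletion η‖ := by gcongr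
      _ = _ := by ring

end Intertwiner

section Diagonalization

variable {H : Type*} [NormedAddCommGroup H] [InnerProductSpace ℂ H]

/-- A finite family of vectors has an orthonormal frame, spanning any prescribed finite set, in
which its frame operator is diagonal. -/
theorem exists_orthonormal_diagonalizing {ι : Type*} [Fintype ι] (ξ : ι → H) (s : Finset H) :
    ∃ (N : ℕ) (e : Fin N → H), Orthonormal ℂ e ∧
      (∀ v ∈ s, ∑ k, inner ℂ (e k) v • e k = v) ∧
      (∀ m, ∑ k, inner ℂ (e k) (ξ m) • e k = ξ m) ∧
      ∀ j k, j ≠ k → ∑ m, inner ℂ (ξ m) (e j) * inner ℂ (e k) (ξ m) = 0 := by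
  classical
  set E : Submodule ℂ H := Submodule.span ℂ ((s ∪ Finset.univ.image ξ : Finset H) : Set H)
  have hs : ∀ v ∈ s, v ∈ E := fun v hv => Submodule.subset_span (by simp [hv])
  have hξ : ∀ m, ξ m ∈ E := fun m => Submodule.subset_span (by simp)
  let ξ' : ι → E := fun m => ⟨ξ m, hξ m⟩
  let T : E →L[ℂ] E := ∑ m, InnerProductSpace.rankOne ℂ (ξ' m) (ξ' m)
  have hTv (v : E) : T v = ∑ m, inner ℂ (ξ' m) v • ξ' m := by
    simp [T, InnerProductSpace.rankOne_apply]
  have hT : (T : E →ₗ[ℂ] E).IsSymmetric := fun v w => by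
    simp only [ContinuousLinearMap.coe_coe, hTv, sum_inner, inner_sum, inner_smul_left,
      inner_smul_right, inner_conj_symm]
    exact Finset.sum_congr rfl fun m _ => mul_comm _ _
  let e := hT.eigenvectorBasis rfl
  have hrepr (v : H) (hv : v ∈ E) : ∑ k, inner ℂ (e k : H) v • (e k : H) = v := by
    simpa using congrArg (Subtype.val) (e.sum_repr' ⟨v, hv⟩)
  refine ⟨_, fun k => e k, ?_, fun v hv => hrepr v (hs v hv), fun m => hrepr _ (hξ m), ?_⟩
  · exact e.orthonormal.comp_linearIsometry E.subtypeₗᵢ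
  · intro j k hjk
    have h1 : inner ℂ (e k) (T (e j)) = 0 := by
      have := hT.apply_eigenvectorBasis rfl j
      rw [ContinuousLinearMap.coe_coe] at this
      rw [this, inner_smul_right, e.orthonormal.2 hjk.symm, mul_zero]
    rw [hTv, inner_sum] at h1
    simpa [inner_smul_right] using h1

theorem Orthonormal.sum_norm_sq_inner_of_sum_eq {N : ℕ} {e : Fin N → H} (he : Orthonormal ℂ e)
    {v : H} (hv : ∑ k, inner ℂ (e k) v • e k = v) : ∑ k, ‖inner ℂ (e k) v‖ ^ 2 = ‖v‖ ^ 2 := by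
  apply Complex.ofReal_injective
  have h := he.inner_sum (fun k => inner ℂ (e k) v) (fun k => inner ℂ (e k) v) Finset.univ
  rw [hv, inner_self_eq_norm_sq_to_K] at h
  push_cast
  exact (h.trans (Finset.sum_congr rfl fun k _ => RCLike.conj_mul _)).symm

end Diagonalization

section KernelSpace

variable {A : Type*} [CStarAlgebra A] {H : Type*}

/-- Left multiplication on `A ⊗ H`. -/
def tensorMul (a : A) : (H →₀ A) →ₗ[ℂ] H →₀ A :=
  Finsupp.mapRange.linearMap (LinearMap.mulLeft ℂ a)

@[simp]
theorem tensorMul_single (a b : A) (ξ : H) :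
    tensorMul a (Finsupp.single ξ b) = Finsupp.single ξ (a * b) := by
  simp [tensorMul]

variable [NormedAddCommGroup H] [InnerProductSpace ℂ H]

/-- The element `∑ a ⊗ ξ` of `A ⊗ H` regarded as the function `h ↦ ∑ ⟪h, ξ⟫ a`. -/
def tensorEval : (H →₀ A) →ₗ[ℂ] H → A :=
  Finsupp.lsum ℂ fun ξ => LinearMap.pi fun h => (inner ℂ h ξ : ℂ) • LinearMap.id

theorem tensorEval_apply (x : H →₀ A) (h : H) :
    tensorEval x h = x.sum fun ξ a => (inner ℂ h ξ : ℂ) • a := by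
  simp [tensorEval, Finsupp.sum, Finset.sum_apply]

@[simp]
theorem tensorEval_single (ξ : H) (a : A) (h : H) :
    tensorEval (Finsupp.single ξ a) h = (inner ℂ h ξ : ℂ) • a := by
  simp [tensorEval_apply]

/-- The `A`-valued inner product on `A ⊗ H`, as a kernel on `H`. -/
def tensorGram (x y : H →₀ A) : H → H → A := fun h k => star (tensorEval x h) * tensorEval y k

theorem tensorEval_tensorMul (a : A) (x : H →₀ A) (h : H) :
    tensorEval (tensorMul a x) h = a * tensorEval x h := by
  induction x using Finsupp.induction_linear with
  | zero => simp
  | add x y hx hy => simp [hx, hy, mul_add]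
  | single ξ b => simp [-Finsupp.single_mul]

theorem tensorGram_tensorMul (a : A) (x y : H →₀ A) :
    tensorGram (tensorMul (star a) x) y = tensorGram x (tensorMul a y) := by
  ext h k
  simp [tensorGram, tensorEval_tensorMul, mul_assoc]

variable (φ : A →ₐ[ℂ] H →L[ℂ] H)

/-- The linear map `a ⊗ ξ ↦ φ(a)ξ`. -/
def tensorAct : (H →₀ A) →ₗ[ℂ] H :=
  Finsupp.lsum ℂ fun ξ => (ContinuousLinearMap.apply ℂ H ξ).toLinearMap ∘ₗ φ.toLinearMap

@[simp]
theorem tensorAct_single (ξ : H) (a : A) : tensorAct φ (Finsupp.single ξ a) = φ a ξ := by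
  simp [tensorAct]

theorem tensorAct_tensorMul (a : A) (x : H →₀ A) :
    tensorAct φ (tensorMul a x) = φ a (tensorAct φ x) := by
  induction x using Finsupp.induction_linear with
  | zero => simp
  | add x y hx hy => simp [hx, hy]
  | single ξ b => simp [-Finsupp.single_mul]

theorem tensorAct_eq_sum {N : ℕ} {e : Fin N → H} (x : H →₀ A)
    (hx : ∀ v ∈ x.support, ∑ k, inner ℂ (e k) v • e k = v) :
    tensorAct φ x = ∑ k, φ (tensorEval x (e k)) (e k) := by
  have h (k : Fin N) : φ (tensorEval x (e k)) (e k) =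
      ∑ ξ ∈ x.support, (inner ℂ (e k) ξ : ℂ) • φ (x ξ) (e k) := by
    rw [tensorEval_apply, Finsupp.sum, map_sum, _root_.sum_apply]
    simp
  simp_rw [h]
  rw [Finset.sum_comm]
  simp only [tensorAct, Finsupp.lsum_apply, Finsupp.sum]
  refine Finset.sum_congr rfl fun ξ hξ => ?_
  simp_rw [← map_smul, ← map_sum, hx ξ hξ]
  simp

end KernelSpace

section KernelInequality

variable {A : Type*} [CStarAlgebra A] {H : Type*} [NormedAddCommGroup H] [InnerProductSpace ℂ H]

/-- The amplifications of `φ` to rectangular partial isometries are bounded, with squared norm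
at most `M`. -/
def BoundedOnPartialIsometries (φ : A →ₐ[ℂ] H →L[ℂ] H) (M : ℝ) : Prop :=
  ∀ (m n : ℕ) (u : Matrix (Fin m) (Fin n) A), IsStarProjection (uᴴ * u) →
    ∀ ζ : Fin n → H, ∑ l, ‖∑ k, φ (u l k) (ζ k)‖ ^ 2 ≤ M * ∑ k, ‖ζ k‖ ^ 2

theorem eq_zero_of_sum_star_mul_self_eq_zero {ι : Type*} [Fintype ι] {a : ι → A}
    (h : ∑ l, star (a l) * a l = 0) (l : ι) : a l = 0 := by
  let _ : PartialOrder A := CStarAlgebra.spectralOrder A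
  have _ : StarOrderedRing A := CStarAlgebra.spectralOrderedRing A
  have := (Finset.sum_eq_zero_iff_of_nonneg fun l _ => star_mul_self_nonneg (a l)).mp h l
    (Finset.mem_univ l)
  exact CStarRing.star_mul_self_eq_zero_iff _ |>.mp this

theorem sum_norm_sq_apply_le_of_orthogonal {φ : A →ₐ[ℂ] H →L[ℂ] H} {M : ℝ}
    (hφ : BoundedOnPartialIsometries φ M) {m n : ℕ} (a : Matrix (Fin m) (Fin n) A)
    (c : Fin n → ℝ) (hc : ∀ k, 0 ≤ c k)
    (ha : ∀ j k, ∑ l, star (a l j) * a l k = if j = k then (c k : ℂ) • (1 : A) else 0)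
    (e : Fin n → H) (he : ∀ k, ‖e k‖ = 1) :
    ∑ l, ‖∑ k, φ (a l k) (e k)‖ ^ 2 ≤ M * ∑ k, c k := by
  have hproj : IsStarProjection ((Matrix.of fun l k => ((√(c k))⁻¹ : ℂ) • a l k)ᴴ *
      (Matrix.of fun l k => ((√(c k))⁻¹ : ℂ) • a l k)) := by
    have : ((Matrix.of fun l k => ((√(c k))⁻¹ : ℂ) • a l k)ᴴ *
      (Matrix.of fun l k => ((√(c k))⁻¹ : ℂ) • a l k)) =
        Matrix.diagonal fun k => if c k = 0 then (0 : A) else 1 := by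
      ext j k
      simp only [Matrix.mul_apply, Matrix.conjTranspose_apply, Matrix.of_apply, star_smul,
        smul_mul_smul_comm, ← Finset.smul_sum, ha, Matrix.diagonal_apply]
      split_ifs with hjk h0
      · simp [h0]
      · subst hjk
        rw [smul_smul]
        convert one_smul ℂ (1 : A)
        have h1 : ((√(c j) : ℝ) : ℂ) * (√(c j) : ℝ) = c j := by
          rw [← Complex.ofReal_mul, Real.mul_self_sqrt (hc j)]
        have h2 : ((√(c j) : ℝ) : ℂ) ≠ 0 := by
          simpa [Real.sqrt_eq_zero (hc j)] using h0
        rw [← h1]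
        simp only [star_inv₀, RCLike.star_def, Complex.conj_ofReal]
        field_simp
      · simp
    rw [this]
    constructor
    · rw [IsIdempotentElem, Matrix.diagonal_mul_diagonal]
      congr 1
      ext k
      split_ifs <;> simp
    · rw [IsSelfAdjoint, Matrix.star_eq_conjTranspose, Matrix.diagonal_conjTranspose]
      congr 1
      ext k
      simp only [Pi.star_apply]
      split_ifs <;> simp
  refine le_of_eq_of_le ?_ ((hφ m n _ hproj fun k => (√(c k) : ℂ) • e k).trans_eq ?_)
  · refine Finset.sum_congr rfl fun l _ => ?_
    congr 3 with k
    rw [Matrix.of_apply, map_smul, map_smul, _root_.smul_apply, smul_smul]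
    by_cases h0 : c k = 0
    · have : a l k = 0 := eq_zero_of_sum_star_mul_self_eq_zero (a := fun l => a l k)
        (by rw [ha, if_pos rfl, h0]; simp) l
      simp [this]
    · rw [mul_inv_cancel₀, one_smul]
      simpa [Real.sqrt_eq_zero (hc k)] using h0
  · congr 2 with k
    rw [norm_smul, he, mul_one, Complex.norm_real, Real.norm_of_nonneg (Real.sqrt_nonneg _),
      Real.sq_sqrt (hc k)]

theorem sum_norm_sq_tensorAct_le {φ : A →ₐ[ℂ] H →L[ℂ] H} {M : ℝ}
    (hφ : BoundedOnPartialIsometries φ M) {m : ℕ} (ξ : Fin m → H) (x : Fin m → H →₀ A)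
    (h : ∑ i, tensorGram (Finsupp.single (ξ i) (1 : A)) (Finsupp.single (ξ i) 1) =
      ∑ i, tensorGram (x i) (x i)) :
    ∑ i, ‖tensorAct φ (x i)‖ ^ 2 ≤ M * ∑ i, ‖ξ i‖ ^ 2 := by
  classical
  obtain ⟨N, e, he, hx, hξ, hdiag⟩ :=
    exists_orthonormal_diagonalizing ξ (Finset.univ.biUnion fun i => (x i).support)
  have hx' (i : Fin m) := tensorAct_eq_sum φ (x i) fun v hv =>
    hx v (Finset.mem_biUnion.mpr ⟨i, Finset.mem_univ i, hv⟩)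
  simp_rw [hx', ← fun i => he.sum_norm_sq_inner_of_sum_eq (hξ i)]
  rw [Finset.sum_comm]
  refine sum_norm_sq_apply_le_of_orthogonal hφ (fun i k => tensorEval (x i) (e k)) _
    (fun k => Finset.sum_nonneg fun i _ => by positivity) (fun j k => ?_) e he.1
  have h1 := congrFun (congrFun h (e j)) (e k)
  simp only [Finset.sum_apply, tensorGram, tensorEval_single, star_smul, star_one,
    smul_mul_smul_comm, mul_one, ← Finset.sum_smul] at h1
  rw [← h1]
  have h2 (i : Fin m) : star (inner ℂ (e j) (ξ i) : ℂ) = inner ℂ (ξ i) (e j) :=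
    inner_conj_symm _ _
  simp_rw [h2]
  split_ifs with hjk
  · subst hjk
    congr 1
    push_cast
    refine Finset.sum_congr rfl fun i _ => ?_
    rw [← h2]
    exact RCLike.conj_mul _
  · rw [hdiag j k hjk, zero_smul]

end KernelInequality

section Separation

/-- A convex cone in `V × ℝ` that contains no negative vertical vector, and that projects onto a
superset of the subspace `W`, lies above the graph of a linear functional over `W`. -/
theorem PointedCone.exists_le_of_mem {V : Type*} [AddCommGroup V] [Module ℝ V]
    (s : PointedCone ℝ (V × ℝ)) (hs : ∀ t : ℝ, ((0 : V), t) ∈ s → 0 ≤ t) (W : Submodule ℝ V)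
    (hW : ∀ w ∈ W, ∃ t : ℝ, (w, t) ∈ s) :
    ∃ f : V →ₗ[ℝ] ℝ, ∀ w ∈ W, ∀ t : ℝ, (w, t) ∈ s → f w ≤ t := by
  let p : (W × ℝ) →ₗ.[ℝ] ℝ :=
    ⟨Submodule.prod ⊥ ⊤, LinearMap.snd ℝ W ℝ ∘ₗ Submodule.subtype _⟩
  have hp (t : ℝ) : ((0 : W), t) ∈ p.domain := ⟨rfl, trivial⟩
  have hnonneg (x : p.domain) (hx : (x : W × ℝ) ∈ s.comap (W.subtype.prodMap LinearMap.id)) :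
      0 ≤ p x := by
    obtain ⟨⟨w, t⟩, hw, _⟩ := x
    obtain rfl : w = 0 := hw
    exact hs t hx
  have hdense (y : W × ℝ) :
      ∃ x : p.domain, (x : W × ℝ) + y ∈ s.comap (W.subtype.prodMap LinearMap.id) := by
    obtain ⟨w, t⟩ := y
    obtain ⟨t', ht'⟩ := hW w w.2
    refine ⟨⟨_, hp (t' - t)⟩, ?_⟩
    simpa [PointedCone.mem_comap] using ht'
  obtain ⟨g, hg, hgs⟩ := riesz_extension _ p hnonneg hdense
  obtain ⟨f, hf⟩ := LinearMap.exists_extend (-(g ∘ₗ LinearMap.inl ℝ W ℝ))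
  refine ⟨f, fun w hw t ht => ?_⟩
  have h1 : f w = -g (⟨w, hw⟩, 0) := congrArg (· ⟨w, hw⟩) hf
  have h2 : g (0, t) = t := hg ⟨_, hp t⟩
  have h3 : 0 ≤ g (⟨w, hw⟩, t) := hgs _ ht
  have h4 : g (⟨w, hw⟩, t) = g (⟨w, hw⟩, 0) + g (0, t) := by
    rw [← map_add, Prod.mk_add_mk, add_zero, zero_add]
  linarith

variable {A : Type*} [CStarAlgebra A] {H : Type*} [NormedAddCommGroup H] [InnerProductSpace ℂ H]

theorem tensorGram_smul_self (c : ℝ) (x : H →₀ A) :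
    tensorGram ((c : ℂ) • x) ((c : ℂ) • x) = c ^ 2 • tensorGram x x := by
  ext h k
  simp [tensorGram, sq, smul_smul]

theorem tensorGram_add_self (x y : H →₀ A) :
    tensorGram (x + y) (x + y) + tensorGram (x - y) (x - y) =
      (2 : ℝ) • tensorGram x x + (2 : ℝ) • tensorGram y y := by
  ext h k
  simp only [tensorGram, map_add, map_sub, Pi.add_apply, Pi.sub_apply, star_add, star_sub,
    two_smul]
  noncomm_ring

theorem exists_tensorGram_add_eq (ξ : H) (a : A) : ∃ b : A,
    tensorGram (Finsupp.single ξ a) (Finsupp.single ξ a) +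
      tensorGram (Finsupp.single ξ b) (Finsupp.single ξ b) =
    tensorGram (Finsupp.single (‖a‖ • ξ) (1 : A)) (Finsupp.single (‖a‖ • ξ) 1) := by
  obtain ⟨b, hb⟩ := CStarAlgebra.exists_star_mul_self_add_eq a
  refine ⟨b, ?_⟩
  ext h k
  simp only [tensorGram, Pi.add_apply, tensorEval_single, star_smul, smul_mul_smul_comm,
    ← smul_add, hb, inner_smul_right_eq_smul, star_one, mul_one, smul_smul]
  congr 1
  simp
  ring

/-- The generators of the cone used to produce a dominating functional on kernels. -/
def tensorGap (φ : A →ₐ[ℂ] H →L[ℂ] H) (M : ℝ) (ξ : H) (x : H →₀ A) : (H → H → A) × ℝ :=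
  (tensorGram (Finsupp.single ξ (1 : A)) (Finsupp.single ξ 1) - tensorGram x x,
    M * ‖ξ‖ ^ 2 - ‖tensorAct φ x‖ ^ 2)

theorem tensorGap_smul (φ : A →ₐ[ℂ] H →L[ℂ] H) (M : ℝ) (ξ : H) (x : H →₀ A) (c : ℝ) :
    tensorGap φ M ((c : ℂ) • ξ) ((c : ℂ) • x) = c ^ 2 • tensorGap φ M ξ x := by
  have : tensorGram (Finsupp.single ((c : ℂ) • ξ) (1 : A)) (Finsupp.single ((c : ℂ) • ξ) 1) =
      c ^ 2 • tensorGram (Finsupp.single ξ (1 : A)) (Finsupp.single ξ 1) := by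
    rw [← tensorGram_smul_self]
    ext h k
    simp only [tensorGram, tensorEval_single, inner_smul_right, map_smul, Pi.smul_apply, smul_smul]
  rw [tensorGap, this, tensorGram_smul_self, map_smul, norm_smul, norm_smul, tensorGap,
    Prod.smul_mk, smul_sub, Complex.norm_real, mul_pow, mul_pow, Real.norm_eq_abs, sq_abs]
  congr 1
  simp only [smul_eq_mul]
  ring

theorem exists_eq_sum_tensorGap {φ : A →ₐ[ℂ] H →L[ℂ] H} {M : ℝ} {p : (H → H → A) × ℝ}
    (hp : p ∈ PointedCone.hull ℝ (Set.range fun q : H × (H →₀ A) => tensorGap φ M q.1 q.2)) :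
    ∃ (m : ℕ) (ξ : Fin m → H) (x : Fin m → H →₀ A), p = ∑ i, tensorGap φ M (ξ i) (x i) := by
  induction hp using Submodule.span_induction with
  | mem p h =>
    obtain ⟨q, rfl⟩ := h
    exact ⟨1, fun _ => q.1, fun _ => q.2, by simp⟩
  | zero => exact ⟨0, Fin.elim0, Fin.elim0, by simp⟩
  | add p q _ _ hp hq =>
    obtain ⟨m, ξ, x, rfl⟩ := hp
    obtain ⟨n, η, y, rfl⟩ := hq
    exact ⟨m + n, Fin.append ξ η, Fin.append x y, by simp [Fin.sum_univ_add]⟩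
  | smul c p _ hp =>
    obtain ⟨m, ξ, x, rfl⟩ := hp
    refine ⟨m, fun i => (√(c : ℝ) : ℂ) • ξ i, fun i => (√(c : ℝ) : ℂ) • x i, ?_⟩
    simp_rw [tensorGap_smul, ← Finset.smul_sum, Real.sq_sqrt c.2]
    rfl

theorem exists_dominating_functional {φ : A →ₐ[ℂ] H →L[ℂ] H} {M : ℝ}
    (hφ : BoundedOnPartialIsometries φ M) :
    ∃ f : (H → H → A) →ₗ[ℝ] ℝ,
      (∀ ξ, f (tensorGram (Finsupp.single ξ (1 : A)) (Finsupp.single ξ 1)) ≤ M * ‖ξ‖ ^ 2) ∧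
      ∀ x, ‖tensorAct φ x‖ ^ 2 ≤ f (tensorGram x x) := by
  set s := PointedCone.hull ℝ (Set.range fun q : H × (H →₀ A) => tensorGap φ M q.1 q.2)
  set W : Submodule ℝ (H → H → A) := Submodule.span ℝ (Set.range fun x => tensorGram x x)
  have hmem (ξ : H) (x : H →₀ A) : tensorGap φ M ξ x ∈ s :=
    PointedCone.subset_hull ⟨(ξ, x), rfl⟩
  have hgram (x : H →₀ A) : tensorGram x x ∈ W := Submodule.subset_span ⟨x, rfl⟩
  have hzero : tensorGram (0 : H →₀ A) 0 = 0 := by ext; simp [tensorGram]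
  have hzero' : tensorGram (Finsupp.single (0 : H) (1 : A)) (Finsupp.single 0 1) = 0 := by
    ext; simp [tensorGram]
  let P : PointedCone ℝ (H → H → A) := s.map (LinearMap.fst ℝ _ ℝ)
  have hP (ξ : H) (x : H →₀ A) :
      tensorGram (Finsupp.single ξ (1 : A)) (Finsupp.single ξ 1) - tensorGram x x ∈ P :=
    PointedCone.mem_map.mpr ⟨_, hmem ξ x, rfl⟩
  have hneg (x : H →₀ A) : -tensorGram x x ∈ P := by
    simpa [hzero'] using hP 0 x
  have hpos (x : H →₀ A) : tensorGram x x ∈ P := by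
    induction x using Finsupp.induction_linear with
    | zero => simp [hzero]
    | add x y hx hy =>
      rw [eq_sub_of_add_eq (tensorGram_add_self x y), sub_eq_add_neg]
      exact P.add_mem (P.add_mem (P.smul_mem zero_le_two hx) (P.smul_mem zero_le_two hy))
        (hneg _)
    | single ξ a =>
      obtain ⟨b, hb⟩ := exists_tensorGram_add_eq ξ a
      rw [eq_sub_of_add_eq hb]
      exact hP _ _
  have hWP (w : H → H → A) (hw : w ∈ W) : w ∈ P ∧ -w ∈ P := by
    induction hw using Submodule.span_induction with
    | mem w h => obtain ⟨x, rfl⟩ := h; exact ⟨hpos x, hneg x⟩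
    | zero => simp
    | add v w _ _ hv hw =>
      rw [neg_add]
      exact ⟨P.add_mem hv.1 hw.1, P.add_mem hv.2 hw.2⟩
    | smul c w _ hw =>
      rcases le_total 0 c with hc | hc
      · rw [← smul_neg]
        exact ⟨P.smul_mem hc hw.1, P.smul_mem hc hw.2⟩
      · rw [← neg_smul, ← neg_smul_neg]
        exact ⟨P.smul_mem (neg_nonneg.mpr hc) hw.2, P.smul_mem (neg_nonneg.mpr hc) hw.1⟩
  have hs (t : ℝ) (ht : ((0 : H → H → A), t) ∈ s) : 0 ≤ t := by
    obtain ⟨m, ξ, x, h⟩ := exists_eq_sum_tensorGap ht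
    have h1 := congrArg Prod.fst h
    have h2 := congrArg Prod.snd h
    rw [Prod.fst_sum] at h1
    rw [Prod.snd_sum] at h2
    simp only [tensorGap, Finset.sum_sub_distrib, ← Finset.mul_sum] at h1 h2
    rw [h2, sub_nonneg]
    exact sum_norm_sq_tensorAct_le hφ ξ x (sub_eq_zero.mp h1.symm)
  have hW (w : H → H → A) (hw : w ∈ W) : ∃ t : ℝ, (w, t) ∈ s := by
    obtain ⟨⟨_, t⟩, ht, rfl⟩ := PointedCone.mem_map.mp (hWP w hw).1
    exact ⟨t, ht⟩
  obtain ⟨f, hf⟩ := PointedCone.exists_le_of_mem s hs W hW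
  refine ⟨f, fun ξ => hf _ (hgram _) _ ?_, fun x => ?_⟩
  · simpa [tensorGap, hzero] using hmem ξ 0
  · have := hf (-tensorGram x x) (W.neg_mem (hgram _)) (-‖tensorAct φ x‖ ^ 2) ?_
    · rw [map_neg] at this
      linarith
    · simpa [tensorGap, hzero'] using hmem 0 x

end Separation

section Hilbertization

variable {A : Type*} [CStarAlgebra A] {H : Type*} [NormedAddCommGroup H] [InnerProductSpace ℂ H]

/-- The semi-inner product on `A ⊗ H` defined by a functional on kernels which is nonnegative on
Gram kernels. -/
abbrev tensorCore (f : (H → H → A) →ₗ[ℝ] ℝ) (hf : ∀ x, 0 ≤ f (tensorGram x x)) :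
    PreInnerProductSpace.Core ℂ (H →₀ A) where
  inner x y := (Module.Dual.extendRCLike f (tensorGram x y) +
    star (Module.Dual.extendRCLike f (tensorGram y x) : ℂ)) / 2
  conj_inner_symm x y := by
    simp [add_comm, map_ofNat]
  re_inner_nonneg x := by
    have h : RCLike.re (Module.Dual.extendRCLike f (tensorGram x x) : ℂ) = f (tensorGram x x) :=
      Module.Dual.re_extendRCLike_apply _ _
    simp only [RCLike.re_eq_complex_re] at h
    simp [h, hf]
  add_left x y z := by
    have h1 : tensorGram (x + y) z = tensorGram x z + tensorGram y z := by
      ext; simp [tensorGram, add_mul]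
    have h2 : tensorGram z (x + y) = tensorGram z x + tensorGram z y := by
      ext; simp [tensorGram, mul_add]
    simp only [h1, h2, map_add, star_add]
    ring
  smul_left x y r := by
    have h1 : tensorGram (r • x) y = (starRingEnd ℂ r) • tensorGram x y := by
      ext; simp [tensorGram]
    have h2 : tensorGram y (r • x) = r • tensorGram y x := by
      ext; simp [tensorGram]
    simp only [h1, h2, map_smul, smul_eq_mul]
    simp
    ring

theorem exists_tensorGram_tensorMul_add_eq (a : A) : ∃ b : A, ∀ x : H →₀ A,
    tensorGram (tensorMul a x) (tensorMul a x) + tensorGram (tensorMul b x) (tensorMul b x) =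
      ‖a‖ ^ 2 • tensorGram x x := by
  obtain ⟨b, hb⟩ := CStarAlgebra.exists_star_mul_self_add_eq a
  refine ⟨b, fun x => ?_⟩
  ext h k
  simp only [tensorGram, Pi.add_apply, tensorEval_tensorMul, star_mul, Pi.smul_apply]
  calc _ = star (tensorEval x h) * (star a * a + star b * b) * tensorEval x k := by noncomm_ring
    _ = _ := by rw [hb, mul_smul_comm, mul_one, smul_mul_assoc, Complex.coe_smul]

/-- The space `A ⊗ H` with the seminorm of `tensorCore f hf`. -/
def TensorSpace (f : (H → H → A) →ₗ[ℝ] ℝ) (_ : ∀ x, 0 ≤ f (tensorGram x x)) : Type _ := H →₀ A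

variable (f : (H → H → A) →ₗ[ℝ] ℝ) (hf : ∀ x, 0 ≤ f (tensorGram x x))

instance : AddCommGroup (TensorSpace f hf) := inferInstanceAs (AddCommGroup (H →₀ A))

instance : Module ℂ (TensorSpace f hf) := inferInstanceAs (Module ℂ (H →₀ A))

/-- The identity map onto `TensorSpace f hf`. -/
def toTensorSpace : (H →₀ A) ≃ₗ[ℂ] TensorSpace f hf := LinearEquiv.refl ℂ _

/-- `tensorCore f hf` on the type synonym `TensorSpace f hf`. -/
abbrev tensorSpaceCore : PreInnerProductSpace.Core ℂ (TensorSpace f hf) := tensorCore f hf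

instance : SeminormedAddCommGroup (TensorSpace f hf) :=
  InnerProductSpace.Core.toSeminormedAddCommGroup (c := tensorSpaceCore f hf)

instance : InnerProductSpace ℂ (TensorSpace f hf) :=
  InnerProductSpace.ofCore (tensorSpaceCore f hf)

theorem inner_toTensorSpace (x y : H →₀ A) :
    inner ℂ (toTensorSpace f hf x) (toTensorSpace f hf y) =
      (Module.Dual.extendRCLike f (tensorGram x y) +
        star (Module.Dual.extendRCLike f (tensorGram y x) : ℂ)) / 2 := rfl

theorem norm_sq_toTensorSpace (x : H →₀ A) : ‖toTensorSpace f hf x‖ ^ 2 = f (tensorGram x x) := by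
  have h : RCLike.re (Module.Dual.extendRCLike f (tensorGram x x) : ℂ) = f (tensorGram x x) :=
    Module.Dual.re_extendRCLike_apply _ _
  simp only [RCLike.re_eq_complex_re] at h
  rw [← inner_self_eq_norm_sq (𝕜 := ℂ), inner_toTensorSpace]
  simp [h]

theorem norm_toTensorSpace_tensorMul_le (a : A) (x : H →₀ A) :
    ‖toTensorSpace f hf (tensorMul a x)‖ ≤ ‖a‖ * ‖toTensorSpace f hf x‖ := by
  obtain ⟨b, hb⟩ := exists_tensorGram_tensorMul_add_eq (H := H) a
  refine le_of_sq_le_sq ?_ (by positivity)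
  have := congrArg f (hb x)
  rw [map_add, map_smul, smul_eq_mul] at this
  rw [mul_pow, norm_sq_toTensorSpace, norm_sq_toTensorSpace]
  linarith [hf (tensorMul b x)]

/-- The bounded operator of left multiplication on `TensorSpace f hf`. -/
def tensorSpaceMul (a : A) : TensorSpace f hf →L[ℂ] TensorSpace f hf :=
  LinearMap.mkContinuous
    (toTensorSpace f hf ∘ₗ tensorMul a ∘ₗ (toTensorSpace f hf).symm.toLinearMap) ‖a‖
    (fun x => norm_toTensorSpace_tensorMul_le f hf a ((toTensorSpace f hf).symm x))

theorem tensorSpaceMul_apply (a : A) (x : H →₀ A) :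
    tensorSpaceMul f hf a (toTensorSpace f hf x) = toTensorSpace f hf (tensorMul a x) := rfl

theorem inner_tensorSpaceMul (a : A) (x y : TensorSpace f hf) :
    inner ℂ (tensorSpaceMul f hf (star a) x) y = inner ℂ x (tensorSpaceMul f hf a y) := by
  obtain ⟨x, rfl⟩ := (toTensorSpace f hf).surjective x
  obtain ⟨y, rfl⟩ := (toTensorSpace f hf).surjective y
  rw [tensorSpaceMul_apply, tensorSpaceMul_apply, inner_toTensorSpace, inner_toTensorSpace,
    tensorGram_tensorMul, ← tensorGram_tensorMul (star a), star_star]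

variable [CompleteSpace H]

theorem exists_isUnit_star_conj_of_boundedOnPartialIsometries {φ : A →ₐ[ℂ] H →L[ℂ] H} {M : ℝ}
    (hφ : BoundedOnPartialIsometries φ M) :
    ∃ S : H →L[ℂ] H, IsUnit S ∧
      ∀ a, S * φ (star a) * Ring.inverse S = star (S * φ a * Ring.inverse S) := by
  obtain ⟨f, hf1, hf2⟩ := exists_dominating_functional hφ
  have hf (x : H →₀ A) : 0 ≤ f (tensorGram x x) := (sq_nonneg _).trans (hf2 x)
  have hact (x : TensorSpace f hf) :
      ‖(tensorAct φ ∘ₗ (toTensorSpace f hf).symm.toLinearMap) x‖ ≤ 1 * ‖x‖ := by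
    obtain ⟨x, rfl⟩ := (toTensorSpace f hf).surjective x
    refine le_of_sq_le_sq ?_ (by positivity)
    rw [one_mul, norm_sq_toTensorSpace]
    exact hf2 x
  refine exists_isUnit_star_conj_of_seminormed (fun a => φ a) (tensorSpaceMul f hf)
    (inner_tensorSpaceMul f hf) (LinearMap.mkContinuous _ 1 hact)
    (fun a x => tensorAct_tensorMul φ a ((toTensorSpace f hf).symm x)) (C := √M)
    fun η => ⟨toTensorSpace f hf (Finsupp.single η 1), by simp, ?_⟩
  have := hf1 η
  rw [← norm_sq_toTensorSpace f hf] at this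
  rw [← Real.sqrt_sq (norm_nonneg η), ← Real.sqrt_mul' _ (sq_nonneg _)]
  exact Real.le_sqrt_of_sq_le this

end Hilbertization

section Reduction

variable {A : Type*} [NonUnitalCStarAlgebra A] {H : Type*} [NormedAddCommGroup H]
  [InnerProductSpace ℂ H] [CompleteSpace H]

theorem Unitization.lift_apply_eq {B : Type*} [Ring B] [Algebra ℂ B] (φ : A →ₙₐ[ℂ] B)
    (z : Unitization ℂ A) : Unitization.lift φ z = algebraMap ℂ B z.fst + φ z.snd := rfl

theorem Unitization.starLift_zero_apply {B : Type*} [Ring B] [StarRing B] [Algebra ℂ B]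
    [StarModule ℂ B] (z : Unitization ℂ A) :
    Unitization.starLift (0 : A →⋆ₙₐ[ℂ] B) z = algebraMap ℂ B z.fst := add_zero _

theorem CompletelyBounded.exists_norm_map_lift_le {φ : A →ₙₐ[ℂ] H →L[ℂ] H}
    (h : CompletelyBounded φ) [PartialOrder A] [StarOrderedRing A] :
    ∃ C : ℝ, 0 ≤ C ∧ ∀ (n : ℕ) (U : CStarMatrix (Fin n) (Fin n) (Unitization ℂ A)), ‖U‖ ≤ 1 →
      ‖U.map (Unitization.lift φ)‖ ≤ C := by
  obtain ⟨C, hC⟩ := h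
  refine ⟨1 + |C| * 2, by positivity, fun n U hU => ?_⟩
  let σ : Unitization ℂ A →⋆ₙₐ[ℂ] (H →L[ℂ] H) :=
    (Unitization.starLift (0 : A →⋆ₙₐ[ℂ] (H →L[ℂ] H)) : Unitization ℂ A →⋆ₐ[ℂ] _)
  let τ : Unitization ℂ A →⋆ₙₐ[ℂ] Unitization ℂ A :=
    (Unitization.starLift (0 : A →⋆ₙₐ[ℂ] Unitization ℂ A) : Unitization ℂ A →⋆ₐ[ℂ] _)
  let x : CStarMatrix (Fin n) (Fin n) A := U.map fun z => z.snd
  have hx : ‖x‖ ≤ 2 := by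
    rw [← CStarMatrix.norm_mapₙₐ (Unitization.inrNonUnitalStarAlgHom ℂ A)
      Unitization.inr_injective]
    have : x.map (Unitization.inrNonUnitalStarAlgHom ℂ A) = U - U.map τ := by
      refine CStarMatrix.ext fun i j => ?_
      change ((U i j).snd : Unitization ℂ A) =
        U i j - Unitization.starLift (0 : A →⋆ₙₐ[ℂ] Unitization ℂ A) (U i j)
      rw [Unitization.starLift_zero_apply, Unitization.algebraMap_eq_inl]
      exact (sub_eq_of_eq_add' (Unitization.inl_fst_add_inr_snd_eq _).symm).symm
    rw [this]
    linarith [norm_sub_le U (U.map τ), CStarMatrix.norm_mapₙₐ_le τ U]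
  have hsplit : U.map (Unitization.lift φ) = U.map σ + x.map φ := by
    refine CStarMatrix.ext fun i j => ?_
    change Unitization.lift φ (U i j) =
      Unitization.starLift (0 : A →⋆ₙₐ[ℂ] (H →L[ℂ] H)) (U i j) + φ (U i j).snd
    rw [Unitization.starLift_zero_apply, Unitization.lift_apply_eq]
  rw [hsplit]
  calc _ ≤ ‖U.map σ‖ + ‖x.map φ‖ := norm_add_le _ _
    _ ≤ 1 + |C| * 2 := by
      refine add_le_add ((CStarMatrix.norm_mapₙₐ_le σ U).trans hU) ?_
      have hCx := hC n (CStarMatrix.ofMatrix.symm x)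
      rw [cstarMatrixNorm_eq, cstarMatrixNorm_eq] at hCx
      refine hCx.trans ?_
      exact mul_le_mul (le_abs_self C) hx (norm_nonneg _) (abs_nonneg _)

theorem CStarMatrix.norm_le_one_of_isStarProjection {B ι : Type*} [NonUnitalCStarAlgebra B]
    [PartialOrder B] [StarOrderedRing B] [Fintype ι] {U : CStarMatrix ι ι B}
    (hU : IsStarProjection (star U * U)) : ‖U‖ ≤ 1 := by
  have := hU.norm_le
  rw [CStarRing.norm_star_mul_self] at this
  nlinarith [norm_nonneg U]

/-- The square matrix with block `u` in the upper right corner and zeroes elsewhere. -/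
def Matrix.cornerBlock {B : Type*} [Zero B] {m n : ℕ} (u : Matrix (Fin m) (Fin n) B) :
    Matrix (Fin (m + n)) (Fin (m + n)) B :=
  Matrix.reindex finSumFinEquiv finSumFinEquiv (Matrix.fromBlocks 0 u 0 0)

theorem Matrix.isStarProjection_cornerBlock {B : Type*} [NonUnitalSemiring B] [StarRing B]
    {m n : ℕ} {u : Matrix (Fin m) (Fin n) B} (hu : IsStarProjection (uᴴ * u)) :
    IsStarProjection ((u.cornerBlock)ᴴ * u.cornerBlock) := by
  have : (u.cornerBlock)ᴴ * u.cornerBlock =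
      Matrix.reindex finSumFinEquiv finSumFinEquiv (Matrix.fromBlocks 0 0 0 (uᴴ * u)) := by
    simp only [cornerBlock, Matrix.reindex_apply, Matrix.conjTranspose_submatrix,
      Matrix.submatrix_mul_equiv, Matrix.fromBlocks_conjTranspose, Matrix.fromBlocks_multiply]
    simp
  rw [this]
  constructor
  · rw [IsIdempotentElem, Matrix.reindex_apply, Matrix.submatrix_mul_equiv,
      Matrix.fromBlocks_multiply]
    simp [hu.isIdempotentElem.eq]
  · rw [IsSelfAdjoint, Matrix.star_eq_conjTranspose, Matrix.reindex_apply,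
      Matrix.conjTranspose_submatrix, Matrix.fromBlocks_conjTranspose]
    simp

theorem CompletelyBounded.boundedOnPartialIsometries_lift {φ : A →ₙₐ[ℂ] H →L[ℂ] H}
    (h : CompletelyBounded φ) : ∃ M : ℝ, BoundedOnPartialIsometries (Unitization.lift φ) M := by
  let _ : PartialOrder A := CStarAlgebra.spectralOrder A
  have _ : StarOrderedRing A := CStarAlgebra.spectralOrderedRing A
  obtain ⟨C, hC0, hC⟩ := h.exists_norm_map_lift_le
  refine ⟨C ^ 2, fun m n u hu ζ => ?_⟩
  have hU := hC _ (CStarMatrix.ofMatrix u.cornerBlock)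
    (CStarMatrix.norm_le_one_of_isStarProjection (Matrix.isStarProjection_cornerBlock hu))
  have key := CStarMatrix.sum_norm_sq_le
    ((CStarMatrix.ofMatrix u.cornerBlock).map (Unitization.lift φ)) (Fin.append 0 ζ)
  have hz : ∑ j, ‖Fin.append (0 : Fin m → H) ζ j‖ ^ 2 = ∑ k, ‖ζ k‖ ^ 2 := by
    simp [Fin.sum_univ_add]
  have hle : ∑ l, ‖∑ k, Unitization.lift φ (u l k) (ζ k)‖ ^ 2 ≤
      ∑ i, ‖∑ j, (CStarMatrix.ofMatrix u.cornerBlock).map (Unitization.lift φ) i j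
        (Fin.append (0 : Fin m → H) ζ j)‖ ^ 2 := by
    simp [Fin.sum_univ_add, Matrix.cornerBlock]
  rw [hz] at key
  refine hle.trans (key.trans ?_)
  gcongr

end Reduction

section Similarity

variable {H : Type*} [NormedAddCommGroup H] [InnerProductSpace ℂ H] [CompleteSpace H]

/-- Conjugating every entry of a matrix by fixed operators is bounded independently of its
size. -/
theorem CStarMatrix.norm_map_mul_mul_le {ι : Type*} [Fintype ι] (s t : H →L[ℂ] H)
    (y : CStarMatrix ι ι (H →L[ℂ] H)) : ‖y.map (fun b => s * b * t)‖ ≤ ‖s‖ * ‖y‖ * ‖t‖ := by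
  classical
  let D : (H →L[ℂ] H) →⋆ₙₐ[ℂ] CStarMatrix ι ι (H →L[ℂ] H) :=
    { toFun := fun b => CStarMatrix.ofMatrix (Matrix.diagonal fun _ => b)
      map_smul' := fun c b => by
        ext i j : 2
        by_cases h : i = j <;> simp [h]
      map_zero' := by
        ext i j : 2
        by_cases h : i = j <;> simp [h]
      map_add' := fun a b => by
        ext i j : 2
        by_cases h : i = j <;> simp [h]
      map_mul' := fun a b => (Matrix.diagonal_mul_diagonal (fun _ : ι => a) fun _ => b).symm
      map_star' := fun b => (Matrix.diagonal_conjTranspose fun _ : ι => b).symm }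
  have hD (b : H →L[ℂ] H) : ‖D b‖ ≤ ‖b‖ := NonUnitalStarAlgHom.norm_apply_le D b
  have : y.map (fun b => s * b * t) = D s * y * D t := by
    refine CStarMatrix.ext fun i j => ?_
    have h1 : Matrix.diagonal (fun _ => s) * CStarMatrix.ofMatrix.symm y *
        Matrix.diagonal (fun _ => t) = Matrix.of fun i j => s * y i j * t := by
      ext i j : 2
      rw [Matrix.mul_diagonal, Matrix.diagonal_mul]
      rfl
    exact (congrFun (congrFun h1 i) j).symm
  rw [this]
  calc _ ≤ ‖D s‖ * ‖y‖ * ‖D t‖ := (norm_mul_le _ _).trans (by gcongr; exact norm_mul_le _ _)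
    _ ≤ _ := by gcongr <;> exact hD _

end Similarity

/-- **Haagerup–Hadwin–Wittstock.** A bounded non-degenerate representation `φ` of a C*-algebra
`A` on a Hilbert space `H` is completely bounded if and only if it is similar to a
`*`-representation. -/
theorem cb_iff_similar_starRep
    {A : Type*} [NonUnitalCStarAlgebra A]
    {H : Type*} [NormedAddCommGroup H] [InnerProductSpace ℂ H] [CompleteSpace H]
    (φ : A →L[ℂ] (H →L[ℂ] H))
    (hmul : ∀ a b : A, φ (a * b) = φ a * φ b)
    (hnondeg :
      (Submodule.span ℂ {v : H | ∃ (a : A) (ξ : H), φ a ξ = v}).topologicalClosure = ⊤) :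
    CompletelyBounded (⇑φ) ↔
      ∃ S : H →L[ℂ] H, IsUnit S ∧
        IsStarRep (fun a : A => S * φ a * Ring.inverse S) := by
  constructor
  · intro h
    let ψ : A →ₙₐ[ℂ] H →L[ℂ] H :=
      { toFun := φ
        map_smul' := map_smul φ
        map_zero' := map_zero φ
        map_add' := map_add φ
        map_mul' := hmul }
    obtain ⟨M, hM⟩ := CompletelyBounded.boundedOnPartialIsometries_lift (φ := ψ) h
    obtain ⟨S, hS, hstar⟩ := exists_isUnit_star_conj_of_boundedOnPartialIsometries hM
    have hψ (a : A) : Unitization.lift ψ a = φ a := by simp [ψ]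
    refine ⟨S, hS, fun a b => ?_, fun a => ?_⟩
    · simp only [hmul, mul_assoc, Ring.inverse_mul_cancel_left S _ hS]
    · have := hstar (a : Unitization ℂ A)
      rwa [← Unitization.inr_star, hψ, hψ] at this
  · rintro ⟨S, hS, hSmul, hSstar⟩
    let _ : PartialOrder A := CStarAlgebra.spectralOrder A
    have _ : StarOrderedRing A := CStarAlgebra.spectralOrderedRing A
    let ψ : A →⋆ₙₐ[ℂ] (H →L[ℂ] H) :=
      { toFun := fun a => S * φ a * Ring.inverse S
        map_smul' := fun c a => by simp
        map_zero' := by simp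
        map_add' := fun a b => by simp [mul_add, add_mul]
        map_mul' := hSmul
        map_star' := hSstar }
    refine ⟨‖Ring.inverse S‖ * ‖S‖, fun n x => ?_⟩
    rw [cstarMatrixNorm_eq, cstarMatrixNorm_eq]
    have hx : CStarMatrix.ofMatrix (x.map φ) =
        ((CStarMatrix.ofMatrix x).map ψ).map fun b => Ring.inverse S * b * S := by
      refine CStarMatrix.ext fun i j => ?_
      change φ (x i j) = Ring.inverse S * (S * φ (x i j) * Ring.inverse S) * S
      rw [mul_assoc S, Ring.inverse_mul_cancel_left S _ hS, mul_assoc,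
        Ring.inverse_mul_cancel S hS, mul_one]
    rw [hx]
    refine (CStarMatrix.norm_map_mul_mul_le _ _ _).trans ?_
    rw [mul_right_comm]
    gcongr
    exact CStarMatrix.norm_mapₙₐ_le ψ _
end
end

section
/- Let φ be a bounded representation of a unital C*-algebra A on a complex Hilbert space H which admits a cyclic vector ξ, i.e. the closed linear span of {φ(a)ξ : a ∈ A} equals H. Then there exist an invertible positive operator T ∈ B(H) and a *-representation π of A on H such that ‖T‖·‖T⁻¹‖ ≤ ‖φ‖³ and φ(a) = T⁻¹π(a)T for all a ∈ A. -/
open scoped Matrix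

noncomputable section

lemma IsSelfAdjoint.units_inv {R : Type*} [Ring R] [StarRing R] {s : Rˣ}
    (hs : IsSelfAdjoint (s : R)) :
    IsSelfAdjoint (↑s⁻¹ : R) := by
  have : star s = s := Units.ext hs
  rw [IsSelfAdjoint, ← Units.coe_star, star_inv, this]

lemma star_mul_inv_mul_mul_inv {R : Type*} [Ring R] [StarRing R] {s : Rˣ}
    (hs : IsSelfAdjoint (s : R)) (c : R) :
    star (c * (↑s⁻¹ : R)) * (c * (↑s⁻¹ : R)) = (↑s⁻¹ : R) * (star c * c) * (↑s⁻¹ : R) := by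
  rw [star_mul, hs.units_inv.star_eq]
  noncomm_ring

lemma inv_mul_sq_mul_inv {R : Type*} [Ring R] (s : Rˣ) :
    (↑s⁻¹ : R) * (s : R) ^ 2 * (↑s⁻¹ : R) = 1 := by
  rw [sq, Units.inv_mul_cancel_left, Units.mul_inv]

section ColumnEstimate

variable {A : Type*} [CStarAlgebra A] [PartialOrder A] [StarOrderedRing A]

lemma CStarAlgebra.one_sub_sqrt_one_sub_nonneg {s : A} (hs : 0 ≤ s) (hs1 : s ≤ 1) :
    0 ≤ 1 - CFC.sqrt (1 - s) := by
  have h1 : 0 ≤ 1 - s := sub_nonneg.2 hs1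
  rw [sub_nonneg, ← CStarAlgebra.norm_le_one_iff_of_nonneg _ (CFC.sqrt_nonneg _),
    ← sq_le_one_iff₀ (norm_nonneg _),
    ← IsSelfAdjoint.norm_mul_self (CFC.sqrt_nonneg (1 - s)).isSelfAdjoint,
    CFC.sqrt_mul_sqrt_self (1 - s), CStarAlgebra.norm_le_one_iff_of_nonneg _ h1]
  simpa using hs

lemma CStarAlgebra.one_sub_sqrt_one_sub_le {s : A} {τ : ℝ} (hs : 0 ≤ s)
    (hsτ : s ≤ algebraMap ℝ A τ) (hτ : τ ≤ 1) :
    1 - CFC.sqrt (1 - s) ≤ ((1 + τ) / 2) • s := by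
  have hs1 : s ≤ 1 := hsτ.trans (by simpa using algebraMap_mono A hτ)
  have h1 : 0 ≤ 1 - s := sub_nonneg.2 hs1
  have hspec : ∀ x ∈ spectrum ℝ s, 0 ≤ x ∧ x ≤ τ := fun x hx =>
    ⟨spectrum_nonneg_of_nonneg hs hx, (le_algebraMap_iff_spectrum_le (A := A)).1 hsτ x hx⟩
  have hsqrt : CFC.sqrt (1 - s) = cfc (fun x : ℝ => √(1 - x)) s := by
    rw [CFC.sqrt_eq_real_sqrt (1 - s) h1, cfcₙ_eq_cfc, cfc_comp' (√·) (1 - ·) s,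
      cfc_sub .., cfc_const_one .., cfc_id' ..]
  have hlin : 1 - ((1 + τ) / 2) • s = cfc (fun x : ℝ => 1 - ((1 + τ) / 2) * x) s := by
    rw [cfc_sub .., cfc_const_one .., cfc_const_mul .., cfc_id' ..]
  rw [sub_le_comm, hsqrt, hlin]
  refine cfc_mono fun x hx => Real.le_sqrt_of_sq_le ?_
  obtain ⟨h0, h2⟩ := hspec x hx
  have : (1 + τ) ^ 2 / 4 ≤ 1 := by nlinarith
  nlinarith [mul_nonneg h0 (sub_nonneg.2 h2), mul_nonneg (mul_nonneg h0 h0) (sub_nonneg.2 this)]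

variable {H : Type*} [NormedAddCommGroup H] [InnerProductSpace ℂ H]

open Complex in
lemma norm_sq_add_norm_sq_le_of_unitary_bound (T : A →ₗ[ℂ] H) {K : ℝ}
    (hK : ∀ u ∈ unitary A, ‖T u‖ ≤ K) {a : A} (ha : IsSelfAdjoint a) (ha1 : ‖a‖ ≤ 1) :
    ‖T a‖ ^ 2 + ‖T (CFC.sqrt (1 - a ^ 2))‖ ^ 2 ≤ K ^ 2 := by
  have hw := ha.self_add_I_smul_cfcSqrt_sub_sq_mem_unitary a ha1
  have hw' := Unitary.star_mem hw
  have hs : star (CFC.sqrt (1 - a ^ 2)) = CFC.sqrt (1 - a ^ 2) :=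
    (CFC.sqrt_nonneg (1 - a ^ 2)).isSelfAdjoint
  have e : star (a + I • CFC.sqrt (1 - a ^ 2)) = a - I • CFC.sqrt (1 - a ^ 2) := by
    rw [star_add, star_smul, hs, ha.star_eq, star_def, conj_I, neg_smul, ← sub_eq_add_neg]
  rw [e] at hw'
  have h1 := hK _ hw
  have h2 := hK _ hw'
  have h3 := parallelogram_law_with_norm ℂ (T a) (I • T (CFC.sqrt (1 - a ^ 2)))
  rw [← map_smul, ← map_add, ← map_sub, map_smul, norm_smul, norm_I] at h3
  nlinarith [norm_nonneg (T (a + I • CFC.sqrt (1 - a ^ 2))),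
    norm_nonneg (T (a - I • CFC.sqrt (1 - a ^ 2)))]

lemma norm_map_le_of_unitary_bound (T : A →ₗ[ℂ] H) {K r : ℝ}
    (hK : ∀ u ∈ unitary A, ‖T u‖ ≤ K) {a : A} (ha : IsSelfAdjoint a) (har : ‖a‖ ≤ r) :
    ‖T a‖ ≤ K * r := by
  have hK0 : 0 ≤ K := (norm_nonneg _).trans (hK 1 (one_mem _))
  rcases eq_or_ne a 0 with rfl | h0
  · simpa using mul_nonneg hK0 ((norm_nonneg _).trans har)
  have hpos : 0 < ‖a‖ := norm_pos_iff.2 h0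
  have h := norm_sq_add_norm_sq_le_of_unitary_bound T hK (a := (‖a‖⁻¹ : ℝ) • a)
    ((IsSelfAdjoint.all (‖a‖⁻¹ : ℝ)).smul ha) (by rw [norm_smul]; simp [h0])
  have h2 : ‖T ((‖a‖⁻¹ : ℝ) • a)‖ ≤ K :=
    abs_le_of_sq_le_sq' (by nlinarith [sq_nonneg ‖T (CFC.sqrt (1 - ((‖a‖⁻¹ : ℝ) • a) ^ 2))‖]) hK0 |>.2
  rw [← Complex.coe_smul, map_smul, norm_smul] at h2
  simp only [Complex.norm_real, norm_inv, norm_norm] at h2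
  rw [inv_mul_le_iff₀ hpos] at h2
  nlinarith

lemma sum_norm_sq_le_of_unitary_bound {ι : Type*} [Fintype ι] (T : A →ₗ[ℂ] H) {K τ : ℝ}
    (hK : ∀ u ∈ unitary A, ‖T u‖ ≤ K) (a : ι → A) (ha : ∀ i, IsSelfAdjoint (a i))
    (hτ : ∑ i, a i ^ 2 ≤ algebraMap ℝ A τ) (hτ0 : 0 ≤ τ) (hτ1 : τ ≤ 1) :
    ∑ i, ‖T (a i)‖ ^ 2 ≤
      Fintype.card ι * (K ^ 2 - ‖T 1‖ ^ 2) + K ^ 2 * (τ * (1 + τ)) := by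
  have hK0 : 0 ≤ K := (norm_nonneg _).trans (hK 1 (one_mem _))
  have hsq : ∀ i, 0 ≤ a i ^ 2 := fun i => (ha i).sq_nonneg
  have hle : ∀ i, a i ^ 2 ≤ algebraMap ℝ A τ := fun i =>
    (Finset.single_le_sum (f := fun i => a i ^ 2) (fun i _ => hsq i) (Finset.mem_univ i)).trans hτ
  have hle1 : ∀ i, a i ^ 2 ≤ 1 := fun i =>
    (hle i).trans (by simpa using algebraMap_mono A hτ1)
  have hnorm : ∀ i, ‖a i‖ ≤ 1 := fun i => by
    have := (CStarAlgebra.norm_le_one_iff_of_nonneg _ (hsq i)).2 (hle1 i)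
    rwa [sq, (ha i).norm_mul_self, sq_le_one_iff₀ (norm_nonneg _)] at this
  set d : ι → A := fun i => 1 - CFC.sqrt (1 - a i ^ 2) with hd
  have hd0 : ∀ i, 0 ≤ d i := fun i =>
    CStarAlgebra.one_sub_sqrt_one_sub_nonneg (hsq i) (hle1 i)
  have hdsum0 : 0 ≤ ∑ i, d i := Finset.sum_nonneg fun i _ => hd0 i
  have hdsum : ∑ i, d i ≤ algebraMap ℝ A ((1 + τ) / 2 * τ) := by
    calc ∑ i, d i ≤ ∑ i, ((1 + τ) / 2) • a i ^ 2 := Finset.sum_le_sum fun i _ =>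
          CStarAlgebra.one_sub_sqrt_one_sub_le (hsq i) (hle i) hτ1
      _ = ((1 + τ) / 2) • ∑ i, a i ^ 2 := by rw [Finset.smul_sum]
      _ ≤ ((1 + τ) / 2) • algebraMap ℝ A τ := smul_le_smul_of_nonneg_left hτ (by linarith)
      _ = _ := by rw [map_mul, Algebra.smul_def]
  have hTd : ‖T (∑ i, d i)‖ ≤ K * ((1 + τ) / 2 * τ) :=
    norm_map_le_of_unitary_bound T hK (IsSelfAdjoint.of_nonneg hdsum0)
      ((CStarAlgebra.norm_le_iff_le_algebraMap _ (by positivity) hdsum0).2 hdsum)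
  have hterm : ∀ i, ‖T (a i)‖ ^ 2 ≤
      (K ^ 2 - ‖T 1‖ ^ 2) + 2 * RCLike.re (inner ℂ (T 1) (T (d i))) := fun i => by
    have h1 := norm_sq_add_norm_sq_le_of_unitary_bound T hK (ha i) (hnorm i)
    have h2 : T (CFC.sqrt (1 - a i ^ 2)) = T 1 - T (d i) := by simp [hd]
    rw [h2, norm_sub_sq (𝕜 := ℂ)] at h1
    nlinarith [sq_nonneg ‖T (d i)‖]
  calc ∑ i, ‖T (a i)‖ ^ 2
      ≤ ∑ i, ((K ^ 2 - ‖T 1‖ ^ 2) + 2 * RCLike.re (inner ℂ (T 1) (T (d i)))) :=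
        Finset.sum_le_sum fun i _ => hterm i
    _ = Fintype.card ι * (K ^ 2 - ‖T 1‖ ^ 2) +
          2 * RCLike.re (inner ℂ (T 1) (T (∑ i, d i))) := by
        rw [Finset.sum_add_distrib, ← Finset.mul_sum, map_sum, inner_sum, map_sum]
        simp [mul_sub]
    _ ≤ _ := by
        have h1 := (RCLike.re_le_norm _).trans (norm_inner_le_norm (𝕜 := ℂ) (T 1) (T (∑ i, d i)))
        have h2 := mul_le_mul (hK 1 (one_mem _)) hTd (norm_nonneg _) hK0
        nlinarith

lemma exists_isSelfAdjoint_unit_sq_eq {b : A} {e : ℝ} (he : 0 < e) (hb : algebraMap ℝ A e ≤ b) :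
    ∃ s : Aˣ, 0 ≤ (s : A) ∧ (s : A) ^ 2 = b := by
  have he' : IsStrictlyPositive (algebraMap ℝ A e) :=
    ⟨algebraMap_nonneg A he.le, (IsUnit.mk0 e he.ne').map _⟩
  have hb' : IsStrictlyPositive b := he'.of_le hb
  have hu : IsUnit (CFC.sqrt b) := CFC.isUnit_sqrt_iff_isStrictlyPositive.2 hb'
  refine ⟨hu.unit, CFC.sqrt_nonneg b, ?_⟩
  rw [sq, IsUnit.unit_spec, CFC.sqrt_mul_sqrt_self b hb'.nonneg]

lemma sum_star_mul_self_mul_inv_le_one {ι : Type*} [Fintype ι] {s : Aˣ}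
    (hs : IsSelfAdjoint (s : A)) {c : ι → A} (hc : ∑ i, star (c i) * c i ≤ (s : A) ^ 2) :
    ∑ i, star (c i * (↑s⁻¹ : A)) * (c i * (↑s⁻¹ : A)) ≤ 1 := by
  simp_rw [star_mul_inv_mul_mul_inv hs, ← Finset.sum_mul, ← Finset.mul_sum]
  exact (hs.units_inv.conjugate_le_conjugate hc).trans_eq (inv_mul_sq_mul_inv s)

lemma exists_approx_polar (a : A) {e : ℝ} (he : 0 < e) :
    ∃ v h : A, IsSelfAdjoint h ∧ h ^ 2 = star a * a + algebraMap ℝ A e ∧ a = v * h ∧ ‖v‖ ≤ 1 := by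
  obtain ⟨s, hs0, hs2⟩ := exists_isSelfAdjoint_unit_sq_eq (A := A) he
    (le_add_of_nonneg_left (star_mul_self_nonneg a))
  have hs := hs0.isSelfAdjoint
  refine ⟨a * (↑s⁻¹ : A), s, hs, hs2, by simp, ?_⟩
  have h := sum_star_mul_self_mul_inv_le_one hs (c := fun _ : Unit => a)
    (by simpa [hs2] using algebraMap_nonneg A he.le)
  rw [Fintype.sum_unique, ← CStarAlgebra.norm_le_one_iff_of_nonneg _ (star_mul_self_nonneg _),
    CStarRing.norm_star_mul_self] at h
  nlinarith [norm_nonneg (a * (↑s⁻¹ : A))]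

omit [PartialOrder A] [StarOrderedRing A] in
lemma norm_apply_mul_le_norm_apply_unitary_mul (φ : A →ₗ[ℂ] (H →L[ℂ] H)) {c : ℝ}
    (hmul : ∀ a b, φ (a * b) = φ a * φ b) (hc : ∀ a, ‖φ a‖ ≤ c * ‖a‖) (hc0 : 0 ≤ c) (ζ : H)
    {u v : A} (hu : u ∈ unitary A) (h : A) (hv : ‖v‖ ≤ 1) :
    ‖φ (v * h) ζ‖ ≤ c * ‖φ (u * h) ζ‖ := by
  have e1 : v * h = (v * star u) * (u * h) := by
    rw [mul_assoc, ← mul_assoc (star u), Unitary.star_mul_self_of_mem hu, one_mul]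
  have e2 : ‖v * star u‖ ≤ 1 :=
    (CStarRing.norm_mul_mem_unitary v (Unitary.star_mem hu)).trans_le hv
  rw [e1, hmul, mul_apply_eq_comp]
  refine (ContinuousLinearMap.le_opNorm _ _).trans ?_
  gcongr
  exact (hc _).trans (mul_le_of_le_one_right hc0 e2)

open Filter Topology in
lemma sum_norm_sq_apply_le {ι : Type*} [Fintype ι] (φ : A →ₗ[ℂ] (H →L[ℂ] H)) {c K : ℝ}
    (hmul : ∀ a b, φ (a * b) = φ a * φ b) (hc : ∀ a, ‖φ a‖ ≤ c * ‖a‖) (hc0 : 0 ≤ c) (ζ : H)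
    (hK : ∀ u ∈ unitary A, ‖φ u ζ‖ ≤ K) (a : ι → A) (ha : ∑ i, star (a i) * a i ≤ 1) :
    ∑ i, ‖φ (a i) ζ‖ ^ 2 ≤ c ^ 2 * K ^ 2 := by
  have hK0 : 0 ≤ K := (norm_nonneg _).trans (hK 1 (one_mem _))
  set Q : ℝ := ⨆ u : unitary A, ‖φ u ζ‖ ^ 2 with hQ
  have hbdd : BddAbove (Set.range fun u : unitary A => ‖φ u ζ‖ ^ 2) :=
    ⟨K ^ 2, by rintro _ ⟨u, rfl⟩; exact pow_le_pow_left₀ (norm_nonneg _) (hK u u.2) 2⟩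
  have hQK : Q ≤ K ^ 2 := ciSup_le fun u => pow_le_pow_left₀ (norm_nonneg _) (hK u u.2) 2
  have hQ0 : 0 ≤ Q := (sq_nonneg _).trans (le_ciSup hbdd 1)
  have hQu : ∀ u ∈ unitary A, ‖φ u ζ‖ ≤ √Q := fun u hu =>
    Real.le_sqrt_of_sq_le (le_ciSup hbdd ⟨u, hu⟩)
  set n : ℝ := (Fintype.card ι : ℝ) with hn
  have hn0 : 0 ≤ n := Nat.cast_nonneg _
  have key : ∀ t : ℝ, 0 < t → t ≤ 1 / 2 →
      ∑ i, ‖φ (a i) ζ‖ ^ 2 ≤ c ^ 2 * (n * t + Q * ((1 + t) * (1 + t * (1 + t)))) := by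
    intro t ht ht1
    obtain ⟨u, hu⟩ : ∃ u : unitary A, Q - t ^ 2 < ‖φ u ζ‖ ^ 2 :=
      exists_lt_of_lt_ciSup (by rw [← hQ]; nlinarith)
    choose v h hsa hsq hvh hv using fun i =>
      exists_approx_polar (a i) (e := t / (n + 1)) (by positivity)
    let T : A →ₗ[ℂ] H :=
      (LinearMap.applyₗ ζ).comp ((ContinuousLinearMap.coeLM ℂ).comp
        (φ.comp (LinearMap.mulLeft ℂ (u : A))))
    have hT : ∀ x, T x = φ (u * x) ζ := fun x => rfl
    have hst : (√t) ^ 2 = t := Real.sq_sqrt ht.le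
    have hmain := sum_norm_sq_le_of_unitary_bound T (K := √Q) (τ := t * (1 + t))
      (fun w hw => hQu _ (mul_mem u.2 hw)) (fun i => √t • h i)
      (fun i => (IsSelfAdjoint.all (√t)).smul (hsa i))
      (by
        simp_rw [smul_pow, hst, ← Finset.smul_sum, hsq, Finset.sum_add_distrib]
        rw [map_mul, ← Algebra.smul_def]
        refine smul_le_smul_of_nonneg_left ?_ ht.le
        rw [map_add, map_one]
        refine add_le_add ha ?_
        rw [Finset.sum_const, Finset.card_univ, ← map_nsmul]
        refine algebraMap_mono A ?_
        rw [nsmul_eq_mul, ← hn, mul_div_assoc', div_le_iff₀ (by positivity)]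
        nlinarith)
      (by positivity) (by nlinarith)
    have hT1 : ‖T 1‖ ^ 2 = ‖φ u ζ‖ ^ 2 := by rw [hT, mul_one]
    have hs : ∀ i, ‖T (√t • h i)‖ ^ 2 = t * ‖φ (u * h i) ζ‖ ^ 2 := fun i => by
      rw [← Complex.coe_smul, map_smul, norm_smul, mul_pow, hT]
      simp [hst]
    simp_rw [hs, ← Finset.mul_sum, hT1, Real.sq_sqrt hQ0] at hmain
    have hsum : ∑ i, ‖φ (u * h i) ζ‖ ^ 2 ≤ n * t + Q * ((1 + t) * (1 + t * (1 + t))) := by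
      refine le_of_mul_le_mul_left (hmain.trans ?_) ht
      have h1 : n * (Q - ‖φ u ζ‖ ^ 2) ≤ n * t ^ 2 :=
        mul_le_mul_of_nonneg_left (by linarith) hn0
      linarith
    have hterm : ∀ i, ‖φ (a i) ζ‖ ^ 2 ≤ c ^ 2 * ‖φ (u * h i) ζ‖ ^ 2 := fun i => by
      have e3 := norm_apply_mul_le_norm_apply_unitary_mul φ hmul hc hc0 ζ u.2 (h i) (hv i)
      rw [← hvh i] at e3
      rw [← mul_pow]
      exact pow_le_pow_left₀ (norm_nonneg _) e3 2
    calc _ ≤ ∑ i, c ^ 2 * ‖φ (u * h i) ζ‖ ^ 2 := Finset.sum_le_sum fun i _ => hterm i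
      _ ≤ _ := by rw [← Finset.mul_sum]; gcongr
  have hlim : Tendsto (fun t : ℝ => c ^ 2 * (n * t + Q * ((1 + t) * (1 + t * (1 + t)))))
      (𝓝[>] 0) (𝓝 (c ^ 2 * (n * 0 + Q * ((1 + 0) * (1 + 0 * (1 + 0)))))) :=
    (Continuous.tendsto (by fun_prop) 0).mono_left nhdsWithin_le_nhds
  have hle : ∑ i, ‖φ (a i) ζ‖ ^ 2 ≤ c ^ 2 * (n * 0 + Q * ((1 + 0) * (1 + 0 * (1 + 0)))) := by
    refine ge_of_tendsto hlim ?_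
    filter_upwards [Ioc_mem_nhdsGT (show (0 : ℝ) < 1 / 2 by norm_num)] with t ht
    exact key t ht.1 ht.2
  calc _ ≤ _ := hle
    _ = c ^ 2 * Q := by ring
    _ ≤ _ := by gcongr

variable [CompleteSpace H]

lemma norm_sq_sum_apply_le {ι : Type*} [Fintype ι] (φ : A →ₗ[ℂ] (H →L[ℂ] H)) {c : ℝ}
    (hmul : ∀ a b, φ (a * b) = φ a * φ b) (hc : ∀ a, ‖φ a‖ ≤ c * ‖a‖) (hc0 : 0 ≤ c)
    (b : ι → A) (hb : ∑ i, b i * star (b i) ≤ 1) (h : ι → H) :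
    ‖∑ i, φ (b i) (h i)‖ ^ 2 ≤ c ^ 4 * ∑ i, ‖h i‖ ^ 2 := by
  let ψ : A →ₗ[ℂ] (H →L[ℂ] H) :=
    { toFun := fun a => star (φ (star a))
      map_add' := fun x y => by simp
      map_smul' := fun z x => by simp }
  have hψ : ∀ a, ψ a = star (φ (star a)) := fun a => rfl
  set k := ∑ i, φ (b i) (h i) with hk
  have hψc : ∀ a, ‖ψ a‖ ≤ c * ‖a‖ := fun a => by
    rw [hψ, norm_star, ← norm_star a]
    exact hc _
  have hcol := sum_norm_sq_apply_le ψ (K := c * ‖k‖) (fun x y => by simp [hψ, hmul]) hψc hc0 k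
    (fun u hu => (ContinuousLinearMap.le_opNorm _ _).trans (by
      gcongr
      refine (hψc u).trans (mul_le_of_le_one_right hc0 ?_)
      nontriviality A
      exact (CStarRing.norm_of_mem_unitary hu).le)) (fun i => star (b i)) (by simpa using hb)
  have h1 : ‖k‖ ^ 2 ≤ ∑ i, ‖ψ (star (b i)) k‖ * ‖h i‖ := by
    calc ‖k‖ ^ 2 = RCLike.re (inner ℂ k k) := (inner_self_eq_norm_sq (𝕜 := ℂ) k).symm
      _ = ∑ i, RCLike.re (inner ℂ (ψ (star (b i)) k) (h i)) := by
        conv_lhs => rw [hk, inner_sum, map_sum, ← hk]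
        refine Finset.sum_congr rfl fun i _ => ?_
        rw [hψ, star_star, ContinuousLinearMap.star_eq_adjoint,
          ContinuousLinearMap.adjoint_inner_left]
      _ ≤ _ := Finset.sum_le_sum fun i _ => (RCLike.re_le_norm _).trans (norm_inner_le_norm _ _)
  have h2 := Finset.sum_mul_sq_le_sq_mul_sq Finset.univ (fun i => ‖ψ (star (b i)) k‖)
    (fun i => ‖h i‖)
  have hS : 0 ≤ ∑ i, ‖h i‖ ^ 2 := Finset.sum_nonneg fun i _ => sq_nonneg _
  rcases eq_or_ne ‖k‖ 0 with h0 | h0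
  · rw [h0, zero_pow two_ne_zero]
    positivity
  have hpos : 0 < ‖k‖ ^ 2 := by positivity
  refine le_of_mul_le_mul_left ?_ hpos
  calc ‖k‖ ^ 2 * ‖k‖ ^ 2 = (‖k‖ ^ 2) ^ 2 := by ring
    _ ≤ _ := pow_le_pow_left₀ (sq_nonneg _) h1 2
    _ ≤ _ := h2
    _ ≤ (c ^ 2 * (c * ‖k‖) ^ 2) * ∑ i, ‖h i‖ ^ 2 := by gcongr
    _ = _ := by ring

lemma sum_norm_sq_apply_le_of_sum_eq_sq {ι κ : Type*} [Fintype ι] [Fintype κ]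
    (φ : A →ₗ[ℂ] (H →L[ℂ] H)) {C : ℝ}
    (hmul : ∀ a b, φ (a * b) = φ a * φ b) (hC : ∀ a, ‖φ a‖ ≤ C * ‖a‖) (hC0 : 0 ≤ C) (ξ : H)
    (b : ι → A) (c : κ → A) {s : Aˣ} (hs : IsSelfAdjoint (s : A))
    (hb : ∑ i, star (b i) * b i = (s : A) ^ 2) (hc : ∑ i, star (c i) * c i ≤ (s : A) ^ 2) :
    ∑ i, ‖φ (c i) ξ‖ ^ 2 ≤ C ^ 6 * ∑ i, ‖φ (b i) ξ‖ ^ 2 := by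
  have hS : 0 ≤ ∑ i, ‖φ (b i) ξ‖ ^ 2 := Finset.sum_nonneg fun i _ => sq_nonneg _
  set K := √(C ^ 4 * ∑ i, ‖φ (b i) ξ‖ ^ 2) with hKdef
  have hK2 : K ^ 2 = C ^ 4 * ∑ i, ‖φ (b i) ξ‖ ^ 2 := Real.sq_sqrt (by positivity)
  have happ : ∀ x : A, φ (x * (↑s⁻¹ : A)) (φ s ξ) = φ x ξ := fun x => by
    rw [← mul_apply_eq_comp, ← hmul, mul_assoc, Units.inv_mul, mul_one]
  have hu1 : ∑ i, star (b i * (↑s⁻¹ : A)) * (b i * (↑s⁻¹ : A)) = 1 := by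
    simp_rw [star_mul_inv_mul_mul_inv hs, ← Finset.sum_mul, ← Finset.mul_sum, hb,
      inv_mul_sq_mul_inv]
  have hK : ∀ u ∈ unitary A, ‖φ u (φ s ξ)‖ ≤ K := fun u hu => by
    refine Real.le_sqrt_of_sq_le ?_
    have hrow := norm_sq_sum_apply_le φ hmul hC hC0
      (fun i => u * star (b i * (↑s⁻¹ : A)))
      (by
        have hassoc : ∀ x : A, u * star x * star (u * star x) = u * (star x * x) * star u :=
          fun x => by
            rw [star_mul, star_star]
            noncomm_ring
        simp_rw [hassoc, ← Finset.sum_mul, ← Finset.mul_sum, hu1, mul_one]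
        exact (Unitary.mul_star_self_of_mem hu).le)
      (fun i => φ (b i) ξ)
    rwa [← show φ u (φ s ξ) = ∑ i, φ (u * star (b i * (↑s⁻¹ : A))) (φ (b i) ξ) from ?_] at hrow
    calc φ u (φ s ξ) = φ (u * ∑ i, star (b i * (↑s⁻¹ : A)) * (b i * (↑s⁻¹ : A))) (φ s ξ) := by
          rw [hu1, mul_one]
      _ = _ := by
          rw [Finset.mul_sum, map_sum, sum_apply]
          refine Finset.sum_congr rfl fun i _ => ?_
          rw [← happ (b i), ← mul_assoc, hmul (u * _), mul_apply_eq_comp]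
  have hcol := sum_norm_sq_apply_le φ hmul hC hC0 (φ s ξ) hK (fun i => c i * (↑s⁻¹ : A))
    (sum_star_mul_self_mul_inv_le_one hs hc)
  simp_rw [happ] at hcol
  refine hcol.trans_eq ?_
  rw [hK2]
  ring

open Filter Topology in
lemma sum_norm_sq_apply_le_of_sum_le {ι κ : Type*} [Fintype ι] [Fintype κ]
    (φ : A →ₗ[ℂ] (H →L[ℂ] H)) {C : ℝ}
    (hmul : ∀ a b, φ (a * b) = φ a * φ b) (hC : ∀ a, ‖φ a‖ ≤ C * ‖a‖) (hC0 : 0 ≤ C) (ξ : H)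
    (b : ι → A) (c : κ → A) (h : ∑ i, star (c i) * c i ≤ ∑ i, star (b i) * b i) :
    ∑ i, ‖φ (c i) ξ‖ ^ 2 ≤ C ^ 6 * ∑ i, ‖φ (b i) ξ‖ ^ 2 := by
  have key : ∀ t : ℝ, 0 < t →
      ∑ i, ‖φ (c i) ξ‖ ^ 2 ≤ C ^ 6 * (t * ‖φ 1 ξ‖ ^ 2 + ∑ i, ‖φ (b i) ξ‖ ^ 2) := by
    intro t ht
    let b' : Option ι → A := fun o => o.elim (√t • 1) b
    have hb' : ∑ i, star (b' i) * b' i = algebraMap ℝ A t + ∑ i, star (b i) * b i := by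
      simp [Fintype.sum_option, b', smul_smul, Real.mul_self_sqrt ht.le,
        Algebra.algebraMap_eq_smul_one]
    obtain ⟨s, hs0, hs2⟩ := exists_isSelfAdjoint_unit_sq_eq (A := A) ht
      (b := ∑ i, star (b' i) * b' i)
      (by
        rw [hb']
        exact le_add_of_nonneg_right (Finset.sum_nonneg fun i _ => star_mul_self_nonneg _))
    have := sum_norm_sq_apply_le_of_sum_eq_sq φ hmul hC hC0 ξ b' c hs0.isSelfAdjoint hs2.symm
      (by
        rw [hs2, hb']
        exact h.trans (le_add_of_nonneg_left (algebraMap_nonneg A ht.le)))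
    refine this.trans_eq ?_
    rw [Fintype.sum_option]
    simp only [b', Option.elim]
    rw [← Complex.coe_smul, map_smul, smul_apply, norm_smul, mul_pow]
    simp [Real.sq_sqrt ht.le]
  have hlim : Tendsto (fun t : ℝ => C ^ 6 * (t * ‖φ 1 ξ‖ ^ 2 + ∑ i, ‖φ (b i) ξ‖ ^ 2))
      (𝓝[>] 0) (𝓝 (C ^ 6 * (0 * ‖φ 1 ξ‖ ^ 2 + ∑ i, ‖φ (b i) ξ‖ ^ 2))) :=
    (Continuous.tendsto (by fun_prop) 0).mono_left nhdsWithin_le_nhds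
  have := ge_of_tendsto hlim (eventually_mem_nhdsWithin.mono fun t ht => key t ht)
  simpa using this

end ColumnEstimate

lemma Multiset.sum_map_eq_sum_coe {α M : Type*} [DecidableEq α] [AddCommMonoid M]
    (m : Multiset α) (f : α → M) : (m.map f).sum = ∑ x : m, f x := by
  rw [Finset.sum, Multiset.map_univ]

section Domination

variable {A : Type*} [CStarAlgebra A] [PartialOrder A] [StarOrderedRing A]

lemma exists_linearMap_of_sum_map_le (p : A → ℝ) {K : ℝ}
    (hp : ∀ (r : ℝ) (a : A), p (r • a) = r ^ 2 * p a)
    (h : ∀ l k : Multiset A, (k.map fun a => star a * a).sum ≤ (l.map fun a => star a * a).sum →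
      (k.map p).sum ≤ K * (l.map p).sum) :
    ∃ F : selfAdjoint A →ₗ[ℝ] ℝ, ∀ (b : A) (x : selfAdjoint A), (x : A) = star b * b →
      p b ≤ F x ∧ F x ≤ K * p b := by
  let s : PointedCone ℝ (selfAdjoint A × ℝ) :=
    { carrier := {y | ∃ l k : Multiset A,
        (y.1 : A) + (l.map fun a => star a * a).sum = (k.map fun a => star a * a).sum ∧
        y.2 = K * (l.map p).sum - (k.map p).sum}
      zero_mem' := ⟨0, 0, by simp⟩
      add_mem' := by
        rintro y z ⟨l, k, h1, h2⟩ ⟨l', k', h3, h4⟩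
        refine ⟨l + l', k + k', ?_, ?_⟩
        · simp only [Multiset.map_add, Multiset.sum_add, Prod.fst_add, AddSubgroup.coe_add]
          rw [← h1, ← h3]
          abel
        · simp only [Multiset.map_add, Multiset.sum_add, Prod.snd_add]
          rw [h2, h4]
          ring
      smul_mem' := by
        rintro ⟨r, hr⟩ y ⟨l, k, h1, h2⟩
        have hq : ∀ a : A, star (√r • a) * (√r • a) = r • (star a * a) := fun a => by
          rw [star_smul, smul_mul_smul_comm, star_trivial, Real.mul_self_sqrt hr]
        have hsum : ∀ m : Multiset A, (m.map fun a => r • (star a * a)).sum =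
            r • (m.map fun a => star a * a).sum := fun m => by
          rw [Multiset.smul_sum, Multiset.map_map]
          rfl
        refine ⟨l.map (√r • ·), k.map (√r • ·), ?_, ?_⟩
        · simp only [Multiset.map_map, Function.comp_def, hq, hsum]
          rw [← h1, smul_add]
          rfl
        · simp only [Multiset.map_map, Function.comp_def, hp, Real.sq_sqrt hr,
            Multiset.sum_map_mul_left]
          change r * y.2 = _
          rw [h2]
          ring }
  let f : (selfAdjoint A × ℝ) →ₗ.[ℝ] ℝ :=
    { domain := Submodule.prod ⊥ ⊤
      toFun := (LinearMap.snd ℝ (selfAdjoint A) ℝ).comp (Submodule.subtype _) }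
  obtain ⟨g, hg, hgs⟩ := riesz_extension s f
    (by
      rintro ⟨⟨x, t⟩, hx⟩ ⟨l, k, h1, h2⟩
      have hx0 : x = 0 := hx.1
      simp only [hx0, ZeroMemClass.coe_zero, zero_add] at h1 h2
      change 0 ≤ t
      rw [h2, sub_nonneg]
      exact h l k h1.ge)
    (by
      rintro ⟨x, t⟩
      let l : Multiset A := {CFC.sqrt (x : A)⁻}
      let k : Multiset A := {CFC.sqrt (x : A)⁺}
      refine ⟨⟨(0, K * (l.map p).sum - (k.map p).sum - t), by simp [f]⟩, l, k, ?_, by simp⟩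
      have hs : ∀ a : A, star (CFC.sqrt a) = CFC.sqrt a := fun a =>
        (CFC.sqrt_nonneg a).isSelfAdjoint
      simp only [Prod.mk_add_mk, zero_add, l, k, Multiset.map_singleton, Multiset.sum_singleton,
        hs]
      rw [CFC.sqrt_mul_sqrt_self _ (CFC.negPart_nonneg _),
        CFC.sqrt_mul_sqrt_self _ (CFC.posPart_nonneg _), ← eq_sub_iff_add_eq,
        CFC.posPart_sub_negPart (x : A) x.2])
  have hg1 : ∀ t : ℝ, g (0, t) = t := fun t => hg ⟨(0, t), by simp [f]⟩
  have hgd : ∀ x t, g (x, t) = g (x, 0) + t := fun x t => by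
    rw [← hg1 t, ← map_add, hg1]
    simp
  refine ⟨g.comp (LinearMap.inl ℝ _ _), fun b x hx => ⟨?_, ?_⟩⟩
  · have := hgs (x, -p b) ⟨0, {b}, by simp [hx]⟩
    rw [hgd] at this
    simpa using this
  · have := hgs (-x, K * p b) ⟨{b}, 0, by simp [hx]⟩
    rw [hgd, show ((-x, 0) : selfAdjoint A × ℝ) = -(x, 0) by simp, map_neg] at this
    simpa using this

variable {H : Type*} [NormedAddCommGroup H] [InnerProductSpace ℂ H] [CompleteSpace H]

lemma exists_linearMap_dominating (φ : A →ₗ[ℂ] (H →L[ℂ] H)) {C : ℝ}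
    (hmul : ∀ a b, φ (a * b) = φ a * φ b) (hC : ∀ a, ‖φ a‖ ≤ C * ‖a‖) (hC0 : 0 ≤ C) (ξ : H) :
    ∃ F : selfAdjoint A →ₗ[ℝ] ℝ, ∀ (b : A) (x : selfAdjoint A), (x : A) = star b * b →
      ‖φ b ξ‖ ^ 2 ≤ F x ∧ F x ≤ C ^ 6 * ‖φ b ξ‖ ^ 2 := by
  classical
  refine exists_linearMap_of_sum_map_le (fun a => ‖φ a ξ‖ ^ 2) (fun r a => ?_) fun l k hlk => ?_
  · rw [← Complex.coe_smul, map_smul, smul_apply, norm_smul, mul_pow]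
    simp
  · simp_rw [Multiset.sum_map_eq_sum_coe] at hlk ⊢
    exact sum_norm_sq_apply_le_of_sum_le φ hmul hC hC0 ξ _ _ hlk

open ComplexOrder ComplexStarModule in
lemma exists_positiveLinearMap_dominating (φ : A →ₗ[ℂ] (H →L[ℂ] H)) {C : ℝ}
    (hmul : ∀ a b, φ (a * b) = φ a * φ b) (hC : ∀ a, ‖φ a‖ ≤ C * ‖a‖) (hC0 : 0 ≤ C) (ξ : H) :
    ∃ F : A →ₚ[ℂ] ℂ, ∀ b : A,
      ‖φ b ξ‖ ^ 2 ≤ (F (star b * b)).re ∧ (F (star b * b)).re ≤ C ^ 6 * ‖φ b ξ‖ ^ 2 := by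
  obtain ⟨F, hF⟩ := exists_linearMap_dominating φ hmul hC hC0 ξ
  let G : A →ₗ[ℝ] ℂ :=
    Complex.ofRealLI.toLinearMap ∘ₗ F ∘ₗ realPart +
    (Complex.I : ℂ) • Complex.ofRealLI.toLinearMap ∘ₗ F ∘ₗ imaginaryPart
  have hG : ∀ a, G a = (F (ℜ a) : ℂ) + Complex.I * F (ℑ a) := fun a => rfl
  let Gc : A →ₗ[ℂ] ℂ :=
    { toFun := G
      map_add' := map_add G
      map_smul' := fun z a => by
        simp only [hG, realPart_smul, imaginaryPart_smul, map_sub, map_add, map_smul,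
          RingHom.id_apply]
        exact Complex.ext (by simp) (by simp) }
  have hGs : ∀ x : selfAdjoint A, G x = F x := fun x => by
    rw [hG]
    simp
  refine ⟨PositiveLinearMap.mk₀ Gc fun a ha => ?_, fun b => ?_⟩
  · have h1 := hF (CFC.sqrt a) ⟨a, ha.isSelfAdjoint⟩
      (by rw [(CFC.sqrt_nonneg a).isSelfAdjoint.star_eq, CFC.sqrt_mul_sqrt_self a ha])
    change 0 ≤ G (⟨a, ha.isSelfAdjoint⟩ : selfAdjoint A)
    rw [hGs]
    exact_mod_cast (sq_nonneg _).trans h1.1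
  · have h1 := hF b ⟨star b * b, .star_mul_self b⟩ rfl
    change _ ≤ (G (⟨star b * b, .star_mul_self b⟩ : selfAdjoint A)).re ∧
      (G (⟨star b * b, .star_mul_self b⟩ : selfAdjoint A)).re ≤ _
    rwa [hGs, Complex.ofReal_re]

end Domination

section Similarity

variable {A : Type*} [CStarAlgebra A]
  {H : Type*} [NormedAddCommGroup H] [InnerProductSpace ℂ H] [CompleteSpace H]
  {L : Type*} [NormedAddCommGroup L] [InnerProductSpace ℂ L] [CompleteSpace L]

lemma ContinuousLinearMap.exists_unit_sq_eq_adjoint_comp_self (V : H →L[ℂ] L) {M : ℝ}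
    (hV : ∀ h, ‖h‖ ≤ ‖V h‖) (hM : ∀ h, ‖V h‖ ≤ M * ‖h‖) (hM0 : 0 ≤ M) :
    ∃ S : (H →L[ℂ] H)ˣ, 0 ≤ (S : H →L[ℂ] H) ∧ (S : H →L[ℂ] H) ^ 2 = adjoint V ∘L V ∧
      ‖(S : H →L[ℂ] H)‖ ≤ M ∧ ‖(↑S⁻¹ : H →L[ℂ] H)‖ ≤ 1 := by
  have hle : algebraMap ℝ (H →L[ℂ] H) 1 ≤ adjoint V ∘L V := by
    rw [map_one, ContinuousLinearMap.le_def]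
    refine ⟨((isPositive_adjoint_comp_self V).isSymmetric.sub .id), fun h => ?_⟩
    have h1 : RCLike.re (inner ℂ ((adjoint V) (V h)) h) = ‖V h‖ ^ 2 := by
      rw [adjoint_inner_left, inner_self_eq_norm_sq]
    have h2 : RCLike.re (inner ℂ h h) = ‖h‖ ^ 2 := inner_self_eq_norm_sq h
    rw [reApplyInnerSelf_apply, sub_apply, inner_sub_left, map_sub, comp_apply, one_apply_eq_self,
      h1, h2, sub_nonneg]
    exact pow_le_pow_left₀ (norm_nonneg _) (hV h) 2
  obtain ⟨S, hS0, hS2⟩ := exists_isSelfAdjoint_unit_sq_eq one_pos hle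
  have hnorm : ∀ h, ‖(S : H →L[ℂ] H) h‖ = ‖V h‖ := fun h => by
    rw [← sq_eq_sq₀ (norm_nonneg _) (norm_nonneg _), ← inner_self_eq_norm_sq (𝕜 := ℂ),
      ← inner_self_eq_norm_sq (𝕜 := ℂ) (V h), ← adjoint_inner_right, ← adjoint_inner_right,
      hS0.isSelfAdjoint.adjoint_eq, ← comp_apply, ← comp_apply, ← hS2, sq]
    rfl
  refine ⟨S, hS0, hS2, opNorm_le_bound _ hM0 fun h => (hnorm h).trans_le (hM h),
    opNorm_le_bound _ zero_le_one fun h => ?_⟩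
  rw [one_mul]
  refine (hV _).trans ?_
  rw [← hnorm, ← mul_apply_eq_comp, Units.mul_inv, one_apply_eq_self]

lemma exists_similarity_of_intertwining (φ : A →L[ℂ] (H →L[ℂ] H))
    (hmul : ∀ a b, φ (a * b) = φ a * φ b) (ρ : A →⋆ₙₐ[ℂ] (L →L[ℂ] L)) (V : H →L[ℂ] L)
    (hρ : ∀ a, V ∘L φ a = ρ a ∘L V) {M : ℝ}
    (hV : ∀ h, ‖h‖ ≤ ‖V h‖) (hM : ∀ h, ‖V h‖ ≤ M * ‖h‖) (hM0 : 0 ≤ M) :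
    ∃ (T : H →L[ℂ] H) (π : A →L[ℂ] (H →L[ℂ] H)),
      0 ≤ T ∧ IsUnit T ∧ IsStarRep (⇑π) ∧ ‖T‖ * ‖Ring.inverse T‖ ≤ M ∧
      ∀ a : A, φ a = Ring.inverse T * π a * T := by
  obtain ⟨S, hS0, hS2, hSM, hS1⟩ := V.exists_unit_sq_eq_adjoint_comp_self hV hM hM0
  have hGφ : ∀ a, (S : H →L[ℂ] H) ^ 2 * φ (star a) = star (φ a) * (S : H →L[ℂ] H) ^ 2 :=
    fun a => by
      have h1 : ContinuousLinearMap.adjoint V ∘L ρ (star a) =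
          ContinuousLinearMap.adjoint (φ a) ∘L ContinuousLinearMap.adjoint V := by
        rw [← ContinuousLinearMap.adjoint_comp, hρ, ContinuousLinearMap.adjoint_comp, map_star]
        rfl
      rw [hS2]
      change (ContinuousLinearMap.adjoint V ∘L V) ∘L φ (star a) =
        ContinuousLinearMap.adjoint (φ a) ∘L (ContinuousLinearMap.adjoint V ∘L V)
      rw [ContinuousLinearMap.comp_assoc, hρ, ← ContinuousLinearMap.comp_assoc, h1,
        ContinuousLinearMap.comp_assoc]
  let π : A →L[ℂ] (H →L[ℂ] H) :=
    (ContinuousLinearMap.mulLeftRight ℂ (H →L[ℂ] H) S (↑S⁻¹ : H →L[ℂ] H)).comp φ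
  have hπ : ∀ a, π a = S * φ a * (↑S⁻¹ : H →L[ℂ] H) := fun a => rfl
  have hSa : star (S : H →L[ℂ] H) = S := hS0.isSelfAdjoint
  have hSi : star (↑S⁻¹ : H →L[ℂ] H) = (↑S⁻¹ : H →L[ℂ] H) := hS0.isSelfAdjoint.units_inv
  refine ⟨S, π, hS0, S.isUnit, ⟨fun a b => ?_, fun a => ?_⟩, ?_, fun a => ?_⟩
  · simp only [hπ, hmul, mul_assoc, Units.inv_mul_cancel_left]
  · rw [hπ, hπ, star_mul, star_mul, hSa, hSi, Units.mul_inv_eq_iff_eq_mul,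
      ← Units.mul_right_inj S, ← mul_assoc, ← sq, hGφ, sq]
    simp only [mul_assoc, Units.mul_inv_cancel_left]
  · rw [Ring.inverse_unit]
    calc _ ≤ M * 1 := by gcongr
      _ = M := mul_one M
  · rw [Ring.inverse_unit, hπ]
    simp only [mul_assoc, Units.inv_mul_cancel_left, Units.inv_mul, mul_one]

variable [PartialOrder A] [StarOrderedRing A]

omit [CompleteSpace H] in
open ComplexOrder in
lemma exists_gns_intertwining (φ : A →L[ℂ] (H →L[ℂ] H))
    (hmul : ∀ a b, φ (a * b) = φ a * φ b) (ξ : H) (hξ : DenseRange fun a => φ a ξ)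
    (F : A →ₚ[ℂ] ℂ) {M : ℝ} (hM0 : 0 ≤ M)
    (hF : ∀ b : A, ‖φ b ξ‖ ^ 2 ≤ (F (star b * b)).re ∧
      (F (star b * b)).re ≤ M ^ 2 * ‖φ b ξ‖ ^ 2) :
    ∃ V : H →L[ℂ] F.GNS, (∀ a, V ∘L φ a = F.gnsNonUnitalStarAlgHom a ∘L V) ∧
      (∀ h, ‖h‖ ≤ ‖V h‖) ∧ ∀ h, ‖V h‖ ≤ M * ‖h‖ := by
  let e : A →ₗ[ℂ] H := (LinearMap.applyₗ ξ).comp ((ContinuousLinearMap.coeLM ℂ).comp φ.toLinearMap)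
  let f : A →ₗ[ℂ] F.GNS :=
    UniformSpace.Completion.toComplₗᵢ.toLinearMap ∘ₗ F.toPreGNS.toLinearMap
  have he : ∀ a, e a = φ a ξ := fun a => rfl
  have hf : ∀ a, f a = (F.toPreGNS a : F.GNS) := fun a => rfl
  have hnorm : ∀ a, ‖f a‖ = √(F (star a * a)).re := fun a => by
    rw [hf, UniformSpace.Completion.norm_coe]
    rfl
  have hle : ∀ a, ‖f a‖ ≤ M * ‖e a‖ := fun a => by
    rw [hnorm]
    exact Real.sqrt_le_iff.2 ⟨by positivity, (hF a).2.trans_eq (mul_pow _ _ _).symm⟩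
  have hge : ∀ a, ‖e a‖ ≤ ‖f a‖ := fun a => by
    rw [hnorm]
    exact Real.le_sqrt_of_sq_le (hF a).1
  have hV : ∀ a, f.extendOfNorm e (φ a ξ) = f a := fun a =>
    LinearMap.extendOfNorm_eq hξ ⟨M, hle⟩ a
  refine ⟨f.extendOfNorm e, fun a => ?_, fun h => ?_,
    LinearMap.norm_extendOfNorm_apply_le hξ M hle⟩
  · refine ContinuousLinearMap.coeFn_injective (hξ.equalizer (by fun_prop) (by fun_prop) ?_)
    funext b
    simp only [Function.comp_apply, ContinuousLinearMap.comp_apply, hV]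
    rw [← mul_apply_eq_comp, ← hmul, hV, hf, hf,
      PositiveLinearMap.gnsNonUnitalStarAlgHom_apply_coe]
    rfl
  · refine hξ.induction_on (p := fun h => ‖h‖ ≤ ‖f.extendOfNorm e h‖) h
      (isClosed_le (by fun_prop) (by fun_prop)) fun a => ?_
    rw [hV]
    exact hge a

end Similarity

/-- **Haagerup.** A bounded representation of a unital C*-algebra on a Hilbert space with a
cyclic vector is similar to a `*`-representation, via a positive invertible similarity `T`
with `‖T‖ ‖T⁻¹‖ ≤ ‖φ‖³`. -/
theorem cyclic_rep_similar_starRep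
    {A : Type*} [CStarAlgebra A]
    {H : Type*} [NormedAddCommGroup H] [InnerProductSpace ℂ H] [CompleteSpace H]
    (φ : A →L[ℂ] (H →L[ℂ] H))
    (hmul : ∀ a b : A, φ (a * b) = φ a * φ b)
    (ξ : H)
    (hcyc : (Submodule.span ℂ (Set.range fun a : A => φ a ξ)).topologicalClosure = ⊤) :
    ∃ (T : H →L[ℂ] H) (π : A →L[ℂ] (H →L[ℂ] H)),
      0 ≤ T ∧ IsUnit T ∧ IsStarRep (⇑π) ∧
      ‖T‖ * ‖Ring.inverse T‖ ≤ ‖φ‖ ^ 3 ∧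
      ∀ a : A, φ a = Ring.inverse T * π a * T := by
  let := CStarAlgebra.spectralOrder A
  have := CStarAlgebra.spectralOrderedRing A
  have hdense : DenseRange fun a => φ a ξ := by
    let e : A →ₗ[ℂ] H :=
      (LinearMap.applyₗ ξ).comp ((ContinuousLinearMap.coeLM ℂ).comp φ.toLinearMap)
    have hspan : Submodule.span ℂ (Set.range fun a : A => φ a ξ) = LinearMap.range e :=
      Submodule.span_eq (LinearMap.range e)
    rw [hspan, ← Submodule.dense_iff_topologicalClosure_eq_top] at hcyc
    exact hcyc
  obtain ⟨F, hF⟩ := exists_positiveLinearMap_dominating φ.toLinearMap hmul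
    (fun a => φ.le_opNorm a) (norm_nonneg φ) ξ
  obtain ⟨V, hVφ, hV, hM⟩ := exists_gns_intertwining φ hmul ξ hdense F (M := ‖φ‖ ^ 3)
    (by positivity) (fun b => ⟨(hF b).1, (hF b).2.trans_eq (by rw [← pow_mul]; rfl)⟩)
  exact exists_similarity_of_intertwining φ hmul _ V hVφ hV hM (by positivity)
end
end

section
/- Let A be a C*-algebra, M a von Neumann algebra on a complex Hilbert space H, and φ : A → M a completely bounded representation. Then the following are equivalent: (1) there exists an invertible operator h ∈ M such that a ↦ hφ(a)h⁻¹ is a *-representation; (2) there exists a positive invertible operator S ∈ M such that a ↦ Sφ(a)S⁻¹ is a *-representation; (3) there exists a positive invertible operator T ∈ M such that Tφ(x) = φ(x*)*T for every x ∈ A. -/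
open scoped Matrix

noncomputable section

/-- The positive square root of an element of a von Neumann algebra lies in the algebra. -/
theorem VonNeumannAlgebra.sqrt_mem {H : Type*} [NormedAddCommGroup H] [InnerProductSpace ℂ H]
    [CompleteSpace H] (M : VonNeumannAlgebra H) {T : H →L[ℂ] H} (hT : T ∈ M) :
    CFC.sqrt T ∈ M := by
  rw [← VonNeumannAlgebra.commutant_commutant M, VonNeumannAlgebra.mem_commutant_iff]
  intro g hg
  have hgT : Commute T g := (VonNeumannAlgebra.mem_commutant_iff.1 hg) T hT
  exact (hgT.cfcₙ_nnreal NNReal.sqrt).symm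

/-- Conjugation by an invertible `h` turns a multiplicative map into a multiplicative map. -/
theorem conj_inverse_map_mul {A B : Type*} [Mul A] [MonoidWithZero B] {φ : A → B}
    (hmul : ∀ a b, φ (a * b) = φ a * φ b) {h : B} (hh : IsUnit h) (a b : A) :
    h * φ (a * b) * Ring.inverse h = h * φ a * Ring.inverse h * (h * φ b * Ring.inverse h) := by
  have e := Ring.inverse_mul_cancel h hh
  rw [hmul, show h * φ a * Ring.inverse h * (h * φ b * Ring.inverse h)
    = h * φ a * (Ring.inverse h * h) * φ b * Ring.inverse h by simp only [mul_assoc], e, mul_one]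
  simp only [mul_assoc]

/-- The conjugate of `φ` by an invertible `h` preserves adjoints at `x` if and only if
`h* h` intertwines `φ x*` with `(φ x)*`. -/
theorem conj_inverse_star_iff {B : Type*} [MonoidWithZero B] [StarMul B] {h : B}
    (hh : IsUnit h) (p q : B) :
    h * p * Ring.inverse h = star (h * q * Ring.inverse h) ↔
      star h * h * p = star q * (star h * h) := by
  obtain ⟨u, rfl⟩ := hh
  rw [Ring.inverse_unit, star_mul, star_mul, Units.mul_inv_eq_iff_eq_mul,
    ← (star u).mul_right_inj, Units.coe_star]
  have e : star (u : B) * star ((u⁻¹ : Bˣ) : B) = 1 := by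
    rw [← star_mul, Units.inv_mul, star_one]
  rw [show star (u : B) * (star ((u⁻¹ : Bˣ) : B) * (star q * star (u : B)) * u)
    = star (u : B) * star ((u⁻¹ : Bˣ) : B) * (star q * (star (u : B) * u)) by
      simp only [mul_assoc], e, one_mul, mul_assoc]

/-- For a completely bounded representation `φ` of a C*-algebra into a von Neumann algebra `M`,
similarity to a `*`-representation by an invertible element of `M`, by a positive invertible
element of `M`, and the intertwining condition `Tφ(x) = φ(x*)*T` for a positive invertible
`T ∈ M`, are all equivalent. -/
theorem similarity_in_vonNeumannAlgebra_tfae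
    {A : Type*} [NonUnitalCStarAlgebra A]
    {H : Type*} [NormedAddCommGroup H] [InnerProductSpace ℂ H] [CompleteSpace H]
    (M : VonNeumannAlgebra H)
    (φ : A →L[ℂ] (H →L[ℂ] H))
    (hmem : ∀ a : A, φ a ∈ M)
    (hmul : ∀ a b : A, φ (a * b) = φ a * φ b)
    (hcb : CompletelyBounded (⇑φ)) :
    List.TFAE
      [∃ h : H →L[ℂ] H, h ∈ M ∧ IsUnit h ∧
          IsStarRep (fun a : A => h * φ a * Ring.inverse h),
       ∃ S : H →L[ℂ] H, S ∈ M ∧ 0 ≤ S ∧ IsUnit S ∧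
          IsStarRep (fun a : A => S * φ a * Ring.inverse S),
       ∃ T : H →L[ℂ] H, T ∈ M ∧ 0 ≤ T ∧ IsUnit T ∧
          ∀ x : A, T * φ x = star (φ (star x)) * T] := by
  tfae_have 2 → 1 := fun ⟨S, hS, _, hu, hr⟩ => ⟨S, hS, hu, hr⟩
  tfae_have 1 → 3 := by
    rintro ⟨h, hM, hu, hr⟩
    refine ⟨star h * h, mul_mem (star_mem hM) hM, star_mul_self_nonneg h, hu.star.mul hu,
      fun x => (conj_inverse_star_iff hu _ _).1 ?_⟩
    simpa using hr.2 (star x)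
  tfae_have 3 → 2 := by
    rintro ⟨T, hM, h0, hu, hT⟩
    have hs : CFC.sqrt T * CFC.sqrt T = T := CFC.sqrt_mul_sqrt_self T h0
    have hS : IsUnit (CFC.sqrt T) := (CFC.isUnit_sqrt_iff T h0).2 hu
    have hn : 0 ≤ CFC.sqrt T := CFC.sqrt_nonneg T
    refine ⟨CFC.sqrt T, M.sqrt_mem hM, hn, hS, conj_inverse_map_mul hmul hS,
      fun x => (conj_inverse_star_iff hS _ _).2 ?_⟩
    rw [(IsSelfAdjoint.of_nonneg hn).star_eq, hs]
    simpa using hT (star x)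
  tfae_finish
end
end

section
/- Let A be a C*-algebra, M a von Neumann algebra on a complex Hilbert space H, and φ : A → M a representation. If there exists a positive invertible operator T ∈ M such that Tφ(x) = φ(x*)*T for every x ∈ A, then S = T^{1/2} is a positive invertible element of M and a ↦ Sφ(a)S⁻¹ is a *-representation of A. -/
open scoped Matrix

noncomputable section

/-- If `T ∈ M` is positive invertible and `Tφ(x) = φ(x*)*T` for all `x`, then `S = T^{1/2}` is a
positive invertible element of `M` and `a ↦ Sφ(a)S⁻¹` is a `*`-representation. -/
theorem intertwiner_gives_similarity_by_sqrt
    {A : Type*} [NonUnitalCStarAlgebra A]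
    {H : Type*} [NormedAddCommGroup H] [InnerProductSpace ℂ H] [CompleteSpace H]
    (M : VonNeumannAlgebra H)
    (φ : A →L[ℂ] (H →L[ℂ] H))
    (hmem : ∀ a : A, φ a ∈ M)
    (hmul : ∀ a b : A, φ (a * b) = φ a * φ b)
    (T : H →L[ℂ] H) (hTM : T ∈ M) (hTpos : 0 ≤ T) (hTu : IsUnit T)
    (hint : ∀ x : A, T * φ x = star (φ (star x)) * T) :
    CFC.sqrt T ∈ M ∧ 0 ≤ CFC.sqrt T ∧ IsUnit (CFC.sqrt T) ∧
      IsStarRep (fun a : A => CFC.sqrt T * φ a * Ring.inverse (CFC.sqrt T)) := by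
  have hSS : CFC.sqrt T * CFC.sqrt T = T := CFC.sqrt_mul_sqrt_self T
  have hS0 : 0 ≤ CFC.sqrt T := CFC.sqrt_nonneg T
  have hSM : CFC.sqrt T ∈ M := by
    rw [← M.commutant_commutant, VonNeumannAlgebra.mem_commutant_iff]
    intro g hg
    have hgT : Commute T g := (VonNeumannAlgebra.mem_commutant_iff.mp hg T hTM)
    exact (hgT.cfcₙ_nnreal NNReal.sqrt).symm.eq
  have hSu : IsUnit (CFC.sqrt T) :=
    ((Commute.refl (CFC.sqrt T)).isUnit_mul_iff.mp (hSS.symm ▸ hTu)).1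
  refine ⟨hSM, hS0, hSu, ?_, ?_⟩
  · intro a b
    simp only [hmul, mul_assoc, Ring.inverse_mul_cancel_left _ _ hSu]
  · intro a
    have hS : star (CFC.sqrt T) = CFC.sqrt T := (IsSelfAdjoint.of_nonneg hS0).star_eq
    have h := hint (star a)
    rw [star_star, ← hSS] at h
    calc CFC.sqrt T * φ (star a) * Ring.inverse (CFC.sqrt T)
        = Ring.inverse (CFC.sqrt T) * (CFC.sqrt T * CFC.sqrt T * φ (star a)) *
            Ring.inverse (CFC.sqrt T) := by
          simp only [mul_assoc, Ring.inverse_mul_cancel_left _ _ hSu]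
      _ = Ring.inverse (CFC.sqrt T) * star (φ a) * CFC.sqrt T := by
          rw [h]
          simp only [mul_assoc, Ring.mul_inverse_cancel _ hSu, mul_one]
      _ = star (CFC.sqrt T * φ a * Ring.inverse (CFC.sqrt T)) := by
          simp only [star_mul, ← Ring.inverse_star, hS, mul_assoc]
end
end

section
/- Let A be a C*-algebra, M an injective von Neumann algebra on a complex Hilbert space H, and φ : A → M a completely bounded representation. Then there exists a positive invertible operator S ∈ M such that a ↦ Sφ(a)S⁻¹ is a *-representation of A. -/
open scoped Matrix

noncomputable section

section MatrixInequalities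

variable {H : Type*} [NormedAddCommGroup H] [InnerProductSpace ℂ H] [CompleteSpace H]
variable {ι : Type*} [Fintype ι]

lemma ofReal_norm_sq_eq_inner {H : Type*} [NormedAddCommGroup H] [InnerProductSpace ℂ H] (v : H) : ((‖v‖ ^ 2 : ℝ) : ℂ) = inner ℂ v v := by
  rw [Complex.ofReal_pow]
  exact (inner_self_eq_norm_sq_to_K (𝕜 := ℂ) v).symm

lemma sum_norm_sq_matrix_apply (X : Matrix ι ι (H →L[ℂ] H)) (b : ι → H) :
    ((∑ r, ‖∑ t, X r t (b t)‖ ^ 2 : ℝ) : ℂ)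
      = ∑ t, ∑ u, inner ℂ (b t) ((Xᴴ * X) t u (b u)) := by
  have h1 : ∀ r, ((‖∑ t, X r t (b t)‖ ^ 2 : ℝ) : ℂ)
      = ∑ t, ∑ u, inner ℂ (b t) ((star (X r t) * X r u) (b u)) := by
    intro r
    rw [ofReal_norm_sq_eq_inner, sum_inner]
    refine Finset.sum_congr rfl fun t _ => ?_
    rw [inner_sum]
    refine Finset.sum_congr rfl fun u _ => ?_
    rw [mul_apply_eq_comp, ContinuousLinearMap.star_eq_adjoint,
      ContinuousLinearMap.adjoint_inner_right]
  rw [Complex.ofReal_sum, Finset.sum_congr rfl fun r _ => h1 r, Finset.sum_comm]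
  refine Finset.sum_congr rfl fun t _ => ?_
  rw [Finset.sum_comm]
  refine Finset.sum_congr rfl fun u _ => ?_
  rw [Matrix.mul_apply, sum_apply, inner_sum]
  rfl

variable [DecidableEq ι]

lemma sum_norm_sq_le_of_add_eq_smul_one {X Z : Matrix ι ι (H →L[ℂ] H)} {c : ℝ}
    (h : Xᴴ * X + Zᴴ * Z = (c : ℂ) • (1 : Matrix ι ι (H →L[ℂ] H))) (b : ι → H) :
    ∑ r, ‖∑ t, X r t (b t)‖ ^ 2 ≤ c * ∑ t, ‖b t‖ ^ 2 := by
  have key : ((∑ r, ‖∑ t, X r t (b t)‖ ^ 2 + ∑ r, ‖∑ t, Z r t (b t)‖ ^ 2 : ℝ) : ℂ)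
      = ((c * ∑ t, ‖b t‖ ^ 2 : ℝ) : ℂ) := by
    rw [Complex.ofReal_add, sum_norm_sq_matrix_apply, sum_norm_sq_matrix_apply,
      ← Finset.sum_add_distrib, Complex.ofReal_mul, Complex.ofReal_sum, Finset.mul_sum]
    refine Finset.sum_congr rfl fun t _ => ?_
    rw [← Finset.sum_add_distrib]
    have : ∀ u, inner ℂ (b t) ((Xᴴ * X) t u (b u)) + inner ℂ (b t) ((Zᴴ * Z) t u (b u))
        = if t = u then (c : ℂ) * ((‖b t‖ ^ 2 : ℝ) : ℂ) else 0 := by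
      intro u
      rw [← inner_add_right, ← add_apply, ← Matrix.add_apply, h,
        Matrix.smul_apply, Matrix.one_apply]
      split_ifs with htu
      · subst htu
        rw [smul_apply, one_apply_eq_self, inner_smul_right,
          ofReal_norm_sq_eq_inner]
      · simp
    rw [Finset.sum_congr rfl fun u _ => this u]
    simp
  have key' := Complex.ofReal_injective key
  have : 0 ≤ ∑ r, ‖∑ t, Z r t (b t)‖ ^ 2 := by positivity
  linarith

lemma norm_le_one_of_star_mul_self_add {D : Type*} [CStarAlgebra D] {x z : D}
    (h : star x * x + star z * z = 1) : ‖x‖ ≤ 1 := by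
  let := CStarAlgebra.spectralOrder D
  have := CStarAlgebra.spectralOrderedRing D
  have h1 : star x * x ≤ 1 := by
    rw [← h]; exact le_add_of_nonneg_right (star_mul_self_nonneg z)
  have h2 : ‖star x * x‖ ≤ 1 :=
    (CStarAlgebra.norm_le_one_iff_of_nonneg _ (star_mul_self_nonneg x)).mpr h1
  rw [CStarRing.norm_star_mul_self] at h2
  nlinarith [norm_nonneg x]

lemma exists_star_mul_self_add {D : Type*} [CStarAlgebra D] (x : D) :
    ∃ z : D, star x * x + star z * z = ((‖x‖ ^ 2 : ℝ) : ℂ) • (1 : D) := by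
  let := CStarAlgebra.spectralOrder D
  have := CStarAlgebra.spectralOrderedRing D
  have h1 : star x * x ≤ algebraMap ℝ D ‖star x * x‖ :=
    IsSelfAdjoint.le_algebraMap_norm_self
  obtain ⟨z, hz⟩ := CStarAlgebra.nonneg_iff_eq_star_mul_self.mp (sub_nonneg.mpr h1)
  refine ⟨z, ?_⟩
  rw [← hz, add_sub_cancel, CStarRing.norm_star_mul_self, Algebra.algebraMap_eq_smul_one, sq,
    Complex.coe_smul]

lemma cstarMatrixNorm_eq_norm {A : Type*} [NonUnitalCStarAlgebra A]
    [PartialOrder (Unitization ℂ A)] [StarOrderedRing (Unitization ℂ A)] {n : ℕ}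
    (x : Matrix (Fin n) (Fin n) A) :
    cstarMatrixNorm x
      = ‖CStarMatrix.ofMatrix (x.map (Unitization.inr : A → Unitization ℂ A))‖ := by
  set X := CStarMatrix.ofMatrix (x.map (Unitization.inr : A → Unitization ℂ A)) with hX
  have h : (spectralRadius ℂ (star X * X)).toReal = ‖star X * X‖ :=
    (IsSelfAdjoint.star_mul_self X).toReal_spectralRadius_complex_eq_norm
  rw [CStarRing.norm_star_mul_self] at h
  unfold cstarMatrixNorm
  refine (congrArg Real.sqrt h).trans ?_
  rw [Real.sqrt_mul_self (norm_nonneg _)]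

end MatrixInequalities

section KeyInequality

variable {H : Type*} [NormedAddCommGroup H] [InnerProductSpace ℂ H] [CompleteSpace H]

lemma sum_norm_sq_scalar_matrix_le {ι : Type*} [Fintype ι] [DecidableEq ι] {L N : Matrix ι ι ℂ}
    (h : Lᴴ * L + Nᴴ * N = 1) (b : ι → H) :
    ∑ r, ‖∑ t, L r t • b t‖ ^ 2 ≤ ∑ t, ‖b t‖ ^ 2 := by
  have hmap : ∀ M : Matrix ι ι ℂ, (M.map (algebraMap ℂ (H →L[ℂ] H)))ᴴ
      * M.map (algebraMap ℂ (H →L[ℂ] H)) = (Mᴴ * M).map (algebraMap ℂ (H →L[ℂ] H)) := by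
    intro M
    rw [Matrix.map_mul, Matrix.conjTranspose_map]
    intro x
    exact algebraMap_star_comm x
  have := sum_norm_sq_le_of_add_eq_smul_one (c := 1) (X := L.map (algebraMap ℂ (H →L[ℂ] H)))
    (Z := N.map (algebraMap ℂ (H →L[ℂ] H))) (by
      rw [hmap, hmap, ← Matrix.map_add _ (map_add _), h, Matrix.map_one _ (map_zero _) (map_one _)]
      simp) b
  simpa [Algebra.algebraMap_eq_smul_one] using this

lemma sum_norm_sq_le_cstarMatrixNorm {n : ℕ} (X : Matrix (Fin n) (Fin n) (H →L[ℂ] H))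
    (b : Fin n → H) :
    ∑ r, ‖∑ t, X r t (b t)‖ ^ 2 ≤ cstarMatrixNorm X ^ 2 * ∑ t, ‖b t‖ ^ 2 := by
  let := CStarAlgebra.spectralOrder (Unitization ℂ (H →L[ℂ] H))
  have := CStarAlgebra.spectralOrderedRing (Unitization ℂ (H →L[ℂ] H))
  rw [cstarMatrixNorm_eq_norm]
  set W : Matrix (Fin n) (Fin n) (Unitization ℂ (H →L[ℂ] H)) := X.map Unitization.inr with hW
  obtain ⟨z, hz⟩ := exists_star_mul_self_add (CStarMatrix.ofMatrix W)
  set Z : Matrix (Fin n) (Fin n) (Unitization ℂ (H →L[ℂ] H)) := CStarMatrix.ofMatrix.symm z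
  have hz' : Wᴴ * W + Zᴴ * Z
      = ((‖CStarMatrix.ofMatrix W‖ ^ 2 : ℝ) : ℂ) • (1 : Matrix (Fin n) (Fin n) _) := hz
  let p : Unitization ℂ (H →L[ℂ] H) →⋆ₐ[ℂ] (H →L[ℂ] H) :=
    Unitization.starLift (NonUnitalStarAlgHom.id ℂ (H →L[ℂ] H))
  have hmap : ∀ M : Matrix (Fin n) (Fin n) (Unitization ℂ (H →L[ℂ] H)),
      (M.map p)ᴴ * M.map p = (Mᴴ * M).map p := by
    intro M
    rw [Matrix.map_mul, Matrix.conjTranspose_map]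
    intro x
    exact map_star p x
  have hp : ∀ a : H →L[ℂ] H, p (Unitization.inr a) = a := fun a =>
    DFunLike.congr_fun
      (Unitization.starLift.symm_apply_apply (NonUnitalStarAlgHom.id ℂ (H →L[ℂ] H))) a
  have hX : W.map p = X := by
    refine Matrix.ext fun i j => ?_
    exact hp (X i j)
  have hXZ : Xᴴ * X + (Z.map p)ᴴ * Z.map p
      = ((‖CStarMatrix.ofMatrix W‖ ^ 2 : ℝ) : ℂ) • (1 : Matrix (Fin n) (Fin n) _) := by
    conv_lhs => rw [← hX]
    rw [hmap, hmap, ← Matrix.map_add _ (map_add p), hz', Matrix.map_smul _ _ (map_smul p _),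
      Matrix.map_one _ (map_zero p) (map_one p)]
  exact sum_norm_sq_le_of_add_eq_smul_one hXZ b

variable {A : Type*} [NonUnitalCStarAlgebra A]

lemma fst_conjTranspose_mul {ι : Type*} [Fintype ι] (M : Matrix ι ι (Unitization ℂ A)) :
    (M.map (Unitization.fstHom ℂ A))ᴴ * M.map (Unitization.fstHom ℂ A) = (Mᴴ * M).map (Unitization.fstHom ℂ A) := by
  ext i j
  simp only [Matrix.mul_apply, Matrix.map_apply, Matrix.conjTranspose_apply, map_sum, map_mul,
    Unitization.fstHom_apply, Unitization.fst_star]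

lemma inl_conjTranspose_mul {ι : Type*} [Fintype ι] (M : Matrix ι ι ℂ) :
    (M.map (algebraMap ℂ (Unitization ℂ A)))ᴴ * M.map (algebraMap ℂ (Unitization ℂ A))
      = (Mᴴ * M).map (algebraMap ℂ (Unitization ℂ A)) := by
  rw [Matrix.map_mul, Matrix.conjTranspose_map]
  intro x
  exact algebraMap_star_comm x

lemma sum_norm_sq_extension_le {φ : A → (H →L[ℂ] H)}
    {Φ : Unitization ℂ A →ₐ[ℂ] (H →L[ℂ] H)} (hΦ : ∀ a : A, Φ a = φ a) {C : ℝ} (hC : 0 ≤ C)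
    (hcb : ∀ (n : ℕ) (x : Matrix (Fin n) (Fin n) A),
      cstarMatrixNorm (x.map φ) ≤ C * cstarMatrixNorm x)
    {n : ℕ} {Y Z : Matrix (Fin n) (Fin n) (Unitization ℂ A)} (h : Yᴴ * Y + Zᴴ * Z = 1)
    (b : Fin n → H) :
    ∑ r, ‖∑ t, Φ (Y r t) (b t)‖ ^ 2 ≤ 2 * (1 + (C * 2) ^ 2) * ∑ t, ‖b t‖ ^ 2 := by
  let := CStarAlgebra.spectralOrder (Unitization ℂ A)
  have := CStarAlgebra.spectralOrderedRing (Unitization ℂ A)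
  have hs : (Y.map (Unitization.fstHom ℂ A))ᴴ * Y.map (Unitization.fstHom ℂ A)
      + (Z.map (Unitization.fstHom ℂ A))ᴴ * Z.map (Unitization.fstHom ℂ A) = 1 := by
    rw [fst_conjTranspose_mul, fst_conjTranspose_mul, ← Matrix.map_add _ (map_add _), h,
      Matrix.map_one _ (map_zero _) (map_one _)]
  have hs' : ((Y.map (Unitization.fstHom ℂ A)).map (algebraMap ℂ (Unitization ℂ A)))ᴴ
      * ((Y.map (Unitization.fstHom ℂ A)).map (algebraMap ℂ (Unitization ℂ A)))
      + ((Z.map (Unitization.fstHom ℂ A)).map (algebraMap ℂ (Unitization ℂ A)))ᴴ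
      * ((Z.map (Unitization.fstHom ℂ A)).map (algebraMap ℂ (Unitization ℂ A))) = 1 := by
    rw [inl_conjTranspose_mul, inl_conjTranspose_mul, ← Matrix.map_add _ (map_add _), hs,
      Matrix.map_one _ (map_zero _) (map_one _)]
  have hY : ‖CStarMatrix.ofMatrix Y‖ ≤ 1 :=
    norm_le_one_of_star_mul_self_add (z := CStarMatrix.ofMatrix Z) h
  have hL : ‖CStarMatrix.ofMatrix
      ((Y.map (Unitization.fstHom ℂ A)).map (algebraMap ℂ (Unitization ℂ A)))‖ ≤ 1 :=
    norm_le_one_of_star_mul_self_add (z := CStarMatrix.ofMatrix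
      ((Z.map (Unitization.fstHom ℂ A)).map (algebraMap ℂ (Unitization ℂ A)))) hs'
  have hsnd : (Y.map fun x => x.snd).map (Unitization.inr : A → Unitization ℂ A)
      = Y - (Y.map (Unitization.fstHom ℂ A)).map (algebraMap ℂ (Unitization ℂ A)) := by
    refine Matrix.ext fun i j => ?_
    rw [Matrix.sub_apply, eq_sub_iff_add_eq']
    exact Unitization.inl_fst_add_inr_snd_eq (Y i j)
  have hN : cstarMatrixNorm (Y.map fun x => x.snd) ≤ 2 := by
    rw [cstarMatrixNorm_eq_norm, hsnd, ← CStarMatrix.of_sub_of]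
    exact (norm_sub_le _ _).trans (by linarith)
  have hN' : cstarMatrixNorm ((Y.map fun x => x.snd).map φ) ≤ C * 2 :=
    (hcb n _).trans (mul_le_mul_of_nonneg_left hN hC)
  have hN0 : 0 ≤ cstarMatrixNorm ((Y.map fun x => x.snd).map φ) := Real.sqrt_nonneg _
  have hb : 0 ≤ ∑ t, ‖b t‖ ^ 2 := by positivity
  have h1 := sum_norm_sq_scalar_matrix_le hs b
  have h2 := (sum_norm_sq_le_cstarMatrixNorm ((Y.map fun x => x.snd).map φ) b).trans
    (mul_le_mul_of_nonneg_right (pow_le_pow_left₀ hN0 hN' 2) hb)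
  have hsplit : ∀ r, ‖∑ t, Φ (Y r t) (b t)‖ ^ 2
      ≤ 2 * (‖∑ t, (Y.map (Unitization.fstHom ℂ A)) r t • b t‖ ^ 2
        + ‖∑ t, ((Y.map fun x => x.snd).map φ) r t (b t)‖ ^ 2) := by
    intro r
    have : ∑ t, Φ (Y r t) (b t) = ∑ t, (Y.map (Unitization.fstHom ℂ A)) r t • b t
        + ∑ t, ((Y.map fun x => x.snd).map φ) r t (b t) := by
      rw [← Finset.sum_add_distrib]
      refine Finset.sum_congr rfl fun t _ => ?_
      conv_lhs => rw [← Unitization.inl_fst_add_inr_snd_eq (Y r t)]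
      rw [map_add, hΦ, add_apply]
      congr 1
      rw [← Unitization.algebraMap_eq_inl, AlgHom.commutes, Algebra.algebraMap_eq_smul_one]
      rfl
    rw [this]
    have h3 := norm_add_le (∑ t, (Y.map (Unitization.fstHom ℂ A)) r t • b t)
      (∑ t, ((Y.map fun x => x.snd).map φ) r t (b t))
    have h4 := norm_nonneg (∑ t, (Y.map (Unitization.fstHom ℂ A)) r t • b t
        + ∑ t, ((Y.map fun x => x.snd).map φ) r t (b t))
    exact (pow_le_pow_left₀ h4 h3 2).trans (add_sq_le)
  calc _ ≤ ∑ r, 2 * (‖∑ t, (Y.map (Unitization.fstHom ℂ A)) r t • b t‖ ^ 2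
        + ‖∑ t, ((Y.map fun x => x.snd).map φ) r t (b t)‖ ^ 2) :=
        Finset.sum_le_sum fun r _ => hsplit r
    _ = 2 * (∑ r, ‖∑ t, (Y.map (Unitization.fstHom ℂ A)) r t • b t‖ ^ 2
        + ∑ r, ‖∑ t, ((Y.map fun x => x.snd).map φ) r t (b t)‖ ^ 2) := by
        rw [← Finset.mul_sum, Finset.sum_add_distrib]
    _ ≤ _ := by linarith

end KeyInequality

section GramInequality

variable {H : Type*} [NormedAddCommGroup H] [InnerProductSpace ℂ H] [CompleteSpace H]
variable {B : Type*} [CStarAlgebra B]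

lemma algebraMap_conjTranspose_mul {ι : Type*} [Fintype ι] (M : Matrix ι ι ℂ) :
    (M.map (algebraMap ℂ B))ᴴ * M.map (algebraMap ℂ B) = (Mᴴ * M).map (algebraMap ℂ B) := by
  rw [Matrix.map_mul, Matrix.conjTranspose_map]
  intro x
  exact algebraMap_star_comm x

lemma sum_norm_sq_scalar_matrix {ι : Type*} [Fintype ι] (R : Matrix ι ι ℂ) (b : ι → H) :
    ((∑ r, ‖∑ t, R r t • b t‖ ^ 2 : ℝ) : ℂ) = ∑ t, ∑ u, (Rᴴ * R) t u * inner ℂ (b t) (b u) := by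
  have h := sum_norm_sq_matrix_apply (R.map (algebraMap ℂ (H →L[ℂ] H))) b
  rw [algebraMap_conjTranspose_mul] at h
  simpa [Algebra.algebraMap_eq_smul_one, inner_smul_right] using h

open scoped ComplexOrder MatrixOrder in
lemma exists_isUnit_conjTranspose_mul_self_add {ι : Type*} [Fintype ι] [DecidableEq ι]
    (L : Matrix ι ι ℂ) {ε : ℝ} (hε : 0 < ε) :
    ∃ R : Matrix ι ι ℂ, IsUnit R ∧ Lᴴ * L + (ε : ℂ) • (1 : Matrix ι ι ℂ) = Rᴴ * R := by
  have hpd : (Lᴴ * L + (ε : ℂ) • (1 : Matrix ι ι ℂ)).PosDef := by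
    refine Matrix.PosDef.posSemidef_add (Matrix.posSemidef_conjTranspose_mul_self _) ?_
    exact Matrix.PosDef.one.smul (by exact_mod_cast hε)
  obtain ⟨R, hR⟩ := CStarAlgebra.nonneg_iff_eq_star_mul_self.mp hpd.posSemidef.nonneg
  refine ⟨R, ?_, hR⟩
  have hdet := hpd.isUnit
  rw [hR] at hdet
  exact isUnit_of_mul_isUnit_right hdet

lemma sum_norm_sq_le_gram_fin {χ : B →⋆ₐ[ℂ] ℂ} {Φ : B →ₐ[ℂ] (H →L[ℂ] H)} {K : ℝ} (hK : 0 ≤ K)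
    (hΦ : ∀ (n : ℕ) (Y Z : Matrix (Fin n) (Fin n) B), Yᴴ * Y + Zᴴ * Z = 1 → ∀ b : Fin n → H,
      ∑ r, ‖∑ t, Φ (Y r t) (b t)‖ ^ 2 ≤ K * ∑ t, ‖b t‖ ^ 2)
    {n : ℕ} {Y : Matrix (Fin n) (Fin n) B} {T : Matrix (Fin n) (Fin n) ℂ}
    (hY : Yᴴ * Y = T.map (algebraMap ℂ B)) (b : Fin n → H) :
    ∑ r, ‖∑ t, Φ (Y r t) (b t)‖ ^ 2 ≤ K * (∑ t, ∑ u, T t u * inner ℂ (b t) (b u)).re := by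
  have hT : T = (Y.map χ)ᴴ * Y.map χ := by
    have : (Yᴴ * Y).map χ = (T.map (algebraMap ℂ B)).map χ := by rw [hY]
    rw [Matrix.map_mul, Matrix.conjTranspose_map _ (fun x => map_star χ x)] at this
    rw [this]
    exact Matrix.ext fun i j => (AlgHomClass.commutes χ (T i j)).symm
  have main : ∀ ε : ℝ, 0 < ε → ∑ r, ‖∑ t, Φ (Y r t) (b t)‖ ^ 2
      ≤ K * ((∑ t, ∑ u, T t u * inner ℂ (b t) (b u)).re + ε * ∑ t, ‖b t‖ ^ 2) := by
    intro ε hε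
    obtain ⟨R, hRu, hR⟩ := exists_isUnit_conjTranspose_mul_self_add (Y.map χ) hε
    rw [← hT] at hR
    have hdet : IsUnit R.det := (Matrix.isUnit_iff_isUnit_det R).mp hRu
    set Y' := Y * (R⁻¹).map (algebraMap ℂ B) with hY'
    set Z' := ((Real.sqrt ε : ℂ) • R⁻¹).map (algebraMap ℂ B) with hZ'
    have hmap1 : ((R⁻¹).map (algebraMap ℂ B))ᴴ = ((R⁻¹)ᴴ).map (algebraMap ℂ B) := by
      rw [Matrix.conjTranspose_map]; intro x; exact algebraMap_star_comm x
    have hsum : Y'ᴴ * Y' + Z'ᴴ * Z' = 1 := by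
      have e1 : Y'ᴴ * Y' = ((R⁻¹)ᴴ * T * R⁻¹).map (algebraMap ℂ B) := by
        rw [hY', Matrix.conjTranspose_mul, Matrix.mul_assoc, ← Matrix.mul_assoc Yᴴ, hY, hmap1,
          ← Matrix.map_mul, ← Matrix.map_mul, Matrix.mul_assoc]
      have e2 : Z'ᴴ * Z' = ((R⁻¹)ᴴ * ((ε : ℂ) • 1) * R⁻¹).map (algebraMap ℂ B) := by
        rw [hZ', algebraMap_conjTranspose_mul]
        congr 1
        rw [Matrix.conjTranspose_smul, Matrix.smul_mul, Matrix.mul_smul, smul_smul, Matrix.mul_smul,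
          Matrix.mul_one, Matrix.smul_mul]
        congr 1
        rw [RCLike.star_def, Complex.conj_ofReal, ← Complex.ofReal_mul, Real.mul_self_sqrt hε.le]
      rw [e1, e2, ← Matrix.map_add _ (map_add _), ← Matrix.add_mul, ← Matrix.mul_add, hR,
        ← Matrix.mul_assoc, Matrix.mul_assoc _ R, Matrix.mul_nonsing_inv _ hdet, Matrix.mul_one,
        ← Matrix.conjTranspose_mul, Matrix.mul_nonsing_inv _ hdet, Matrix.conjTranspose_one,
        Matrix.map_one _ (map_zero _) (map_one _)]
    have hYR : Y = Y' * R.map (algebraMap ℂ B) := by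
      rw [hY', Matrix.mul_assoc, ← Matrix.map_mul, Matrix.nonsing_inv_mul _ hdet,
        Matrix.map_one _ (map_zero _) (map_one _), Matrix.mul_one]
    have happ : ∀ r, ∑ t, Φ (Y r t) (b t) = ∑ t, Φ (Y' r t) (∑ u, R t u • b u) := by
      intro r
      have : ∀ u, Φ (Y r u) (b u) = ∑ t, Φ (Y' r t) (R t u • b u) := by
        intro u
        conv_lhs => rw [hYR, Matrix.mul_apply, map_sum, sum_apply]
        refine Finset.sum_congr rfl fun t _ => ?_
        rw [Matrix.map_apply, map_mul, AlgHom.commutes, Algebra.algebraMap_eq_smul_one]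
        simp
      rw [Finset.sum_congr rfl fun u _ => this u, Finset.sum_comm]
      refine Finset.sum_congr rfl fun t _ => ?_
      rw [map_sum]
    have hb := hΦ n Y' Z' hsum fun t => ∑ u, R t u • b u
    rw [Finset.sum_congr rfl fun r _ => by rw [happ r]]
    refine hb.trans (mul_le_mul_of_nonneg_left (le_of_eq ?_) hK)
    have e := sum_norm_sq_scalar_matrix R b
    rw [← hR] at e
    have e3 : ∑ t, ∑ u, (T + (ε : ℂ) • (1 : Matrix (Fin n) (Fin n) ℂ)) t u * inner ℂ (b t) (b u)
        = ∑ t, ∑ u, T t u * inner ℂ (b t) (b u) + ((ε * ∑ t, ‖b t‖ ^ 2 : ℝ) : ℂ) := by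
      rw [Complex.ofReal_mul, Complex.ofReal_sum, Finset.mul_sum, ← Finset.sum_add_distrib]
      refine Finset.sum_congr rfl fun t _ => ?_
      simp only [Matrix.add_apply, Matrix.smul_apply, Matrix.one_apply, add_mul,
        Finset.sum_add_distrib]
      rw [ofReal_norm_sq_eq_inner]
      simp
    rw [e3] at e
    have := congrArg Complex.re e
    rwa [Complex.add_re, Complex.ofReal_re, Complex.ofReal_re] at this
  refine le_of_forall_pos_le_add fun δ hδ => ?_
  set β := ∑ t, ‖b t‖ ^ 2 with hβ
  have hβ0 : 0 ≤ β := by positivity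
  have hKβ : 0 ≤ K * β := mul_nonneg hK hβ0
  have h := main (δ / (K * β + 1)) (by positivity)
  rw [mul_add] at h
  have h2 : K * (δ / (K * β + 1) * β) ≤ δ := by
    have : K * (δ / (K * β + 1) * β) = δ * (K * β / (K * β + 1)) := by ring
    rw [this]
    have h3 : K * β / (K * β + 1) ≤ 1 := (div_le_one (by positivity)).mpr (by linarith)
    nlinarith
  linarith

lemma sum_norm_sq_le_gram {χ : B →⋆ₐ[ℂ] ℂ} {Φ : B →ₐ[ℂ] (H →L[ℂ] H)} {K : ℝ} (hK : 0 ≤ K)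
    (hΦ : ∀ (n : ℕ) (Y Z : Matrix (Fin n) (Fin n) B), Yᴴ * Y + Zᴴ * Z = 1 → ∀ b : Fin n → H,
      ∑ r, ‖∑ t, Φ (Y r t) (b t)‖ ^ 2 ≤ K * ∑ t, ‖b t‖ ^ 2)
    {ι : Type*} [Fintype ι] {Y : Matrix ι ι B} {T : Matrix ι ι ℂ}
    (hY : Yᴴ * Y = T.map (algebraMap ℂ B)) (b : ι → H) :
    ∑ r, ‖∑ t, Φ (Y r t) (b t)‖ ^ 2 ≤ K * (∑ t, ∑ u, T t u * inner ℂ (b t) (b u)).re := by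
  let e := (Fintype.equivFin ι).symm
  have h := sum_norm_sq_le_gram_fin (χ := χ) hK hΦ (Y := Y.submatrix e e) (T := T.submatrix e e)
    (by
      rw [Matrix.conjTranspose_submatrix, Matrix.submatrix_mul_equiv, hY]
      rfl) (b ∘ e)
  simp only [Matrix.submatrix_apply, Function.comp_apply] at h
  rw [Equiv.sum_comp e (fun t => ∑ u, T t (e u) * inner ℂ (b t) (b (e u))),
    Equiv.sum_comp e (fun r => ‖∑ t, Φ (Y r (e t)) (b (e t))‖ ^ 2)] at h
  simp only [fun r => Equiv.sum_comp e (fun t => Φ (Y r t) (b t)),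
    fun t => Equiv.sum_comp e (fun u => T t u * inner ℂ (b t) (b u))] at h
  exact h

end GramInequality

section Extension

variable {H : Type*} [NormedAddCommGroup H] [InnerProductSpace ℂ H] [CompleteSpace H]
variable {B : Type*} [CStarAlgebra B]

/-- The matrix `(h, k) ↦ (x h)* (y k)` attached to two finitely supported columns over `B`. -/
def columnProd {S : Type*} (x y : S →₀ B) : S × S →₀ B :=
  Finsupp.onFinset (x.support ×ˢ y.support) (fun p => star (x p.1) * y p.2) (by
    intro p hp
    rw [Finset.mem_product, Finsupp.mem_support_iff, Finsupp.mem_support_iff]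
    constructor <;> intro h <;> simp [h] at hp)

lemma columnProd_apply {S : Type*} (x y : S →₀ B) (p : S × S) :
    columnProd x y p = star (x p.1) * y p.2 := rfl

/-- The map `∑ aₕ ⊗ h ↦ ∑ Φ(aₕ) h` on finitely supported columns indexed by vectors. -/
def columnEval (Φ : B →ₐ[ℂ] (H →L[ℂ] H)) : (H →₀ B) →ₗ[ℂ] H :=
  Finsupp.lsum ℂ fun h =>
    (ContinuousLinearMap.apply ℂ H h).toLinearMap.comp Φ.toLinearMap

lemma columnEval_eq_sum (Φ : B →ₐ[ℂ] (H →L[ℂ] H)) {x : H →₀ B} {F : Finset H}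
    (hF : x.support ⊆ F) : columnEval Φ x = ∑ h : F, Φ (x h) (h : H) := by
  have : columnEval Φ x = x.sum fun h a => Φ a h := rfl
  rw [this, Finsupp.sum_of_support_subset _ hF _ (by simp), ← Finset.sum_coe_sort]

lemma columnEval_single (Φ : B →ₐ[ℂ] (H →L[ℂ] H)) (h : H) (a : B) :
    columnEval Φ (Finsupp.single h a) = Φ a h := by
  have : columnEval Φ (Finsupp.single h a) = (Finsupp.single h a).sum fun h a => Φ a h := rfl
  rw [this, Finsupp.sum_single_index (by simp)]

lemma columnEval_mapRange (Φ : B →ₐ[ℂ] (H →L[ℂ] H)) (u : B) (x : H →₀ B) :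
    columnEval Φ (x.mapRange (fun a => u * a) (mul_zero u)) = Φ u (columnEval Φ x) := by
  rw [columnEval_eq_sum Φ (Finsupp.support_mapRange), columnEval_eq_sum Φ subset_rfl, map_sum]
  simp

/-- The functional `G ↦ Re ∑ χ(G(h,k)) ⟪h, k⟫` on finitely supported matrices over `B`. -/
def gramTrace (χ : B →⋆ₐ[ℂ] ℂ) : (H × H →₀ B) →ₗ[ℝ] ℝ :=
  Finsupp.lsum ℝ fun p =>
    { toFun := fun a => (χ a * inner ℂ p.1 p.2).re
      map_add' := fun a b => by rw [map_add, add_mul, Complex.add_re]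
      map_smul' := fun c a => by
        rw [← Complex.coe_smul, map_smul, smul_eq_mul, mul_assoc, Complex.re_ofReal_mul]
        rfl }

lemma gramTrace_eq_sum (χ : B →⋆ₐ[ℂ] ℂ) {G : H × H →₀ B} {F : Finset H}
    (hF : G.support ⊆ F ×ˢ F) :
    gramTrace χ G = (∑ h : F, ∑ k : F, χ (G (h, k)) * inner ℂ (h : H) (k : H)).re := by
  have : gramTrace χ G = G.sum fun p a => (χ a * inner ℂ p.1 p.2).re := rfl
  rw [this, Finsupp.sum_of_support_subset _ hF _ (by simp), Finset.sum_product]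
  simp only [Complex.re_sum]
  rw [← Finset.sum_coe_sort]
  refine Finset.sum_congr rfl fun h _ => ?_
  rw [← Finset.sum_coe_sort]

lemma gramTrace_single (χ : B →⋆ₐ[ℂ] ℂ) (h : H) :
    gramTrace χ (Finsupp.single (h, h) 1) = ‖h‖ ^ 2 := by
  have : gramTrace χ (Finsupp.single (h, h) 1)
    = (Finsupp.single (h, h) (1 : B)).sum fun p a => (χ a * inner ℂ p.1 p.2).re := rfl
  rw [this, Finsupp.sum_single_index (by simp), map_one, one_mul, ← ofReal_norm_sq_eq_inner,
    Complex.ofReal_re]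

/-- Pairs `(G, t)` with `G + G* = ∑ xᵣ* xᵣ` and `t ≥ -∑ ‖Φ · xᵣ‖²`. -/
def columnCone (Φ : B →ₐ[ℂ] (H →L[ℂ] H)) : PointedCone ℝ ((H × H →₀ B) × ℝ) where
  carrier := {q | ∃ (n : ℕ) (x : Fin n → H →₀ B),
    (∀ h k, q.1 (h, k) + star (q.1 (k, h)) = ∑ r, star (x r h) * x r k) ∧
    0 ≤ q.2 + ∑ r, ‖columnEval Φ (x r)‖ ^ 2}
  add_mem' := by
    rintro p q ⟨n, x, hx, hx'⟩ ⟨m, y, hy, hy'⟩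
    refine ⟨n + m, Fin.append x y, fun h k => ?_, ?_⟩
    · simp only [Fin.sum_univ_add, Fin.append_left, Fin.append_right, ← hx, ← hy, Prod.fst_add,
        Finsupp.add_apply, star_add]
      abel
    · simp only [Fin.sum_univ_add, Fin.append_left, Fin.append_right, Prod.snd_add]
      linarith
  zero_mem' := ⟨0, Fin.elim0, by simp, by simp⟩
  smul_mem' := by
    rintro ⟨c, hc⟩ p ⟨n, x, hx, hx'⟩
    refine ⟨n, fun r => (Real.sqrt c : ℂ) • x r, fun h k => ?_, ?_⟩
    · have e : ∀ r, star (((Real.sqrt c : ℂ) • x r) h) * ((Real.sqrt c : ℂ) • x r) k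
          = c • (star (x r h) * x r k) := by
        intro r
        rw [Finsupp.smul_apply, Finsupp.smul_apply, star_smul, smul_mul_smul_comm, RCLike.star_def,
          Complex.conj_ofReal, ← Complex.ofReal_mul, Real.mul_self_sqrt hc, Complex.coe_smul]
      rw [Finset.sum_congr rfl fun r _ => e r, ← Finset.smul_sum, ← hx, smul_add]
      congr 1
      change star (c • p.1 (k, h)) = _
      rw [star_smul]; rfl
    · have e : ∀ r, ‖columnEval Φ ((Real.sqrt c : ℂ) • x r)‖ ^ 2
          = c * ‖columnEval Φ (x r)‖ ^ 2 := by
        intro r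
        rw [map_smul, norm_smul, mul_pow, Complex.norm_real, Real.norm_eq_abs, sq_abs,
          Real.sq_sqrt hc]
      rw [Finset.sum_congr rfl fun r _ => e r, ← Finset.mul_sum]
      change 0 ≤ c * p.2 + _
      rw [← mul_add]
      exact mul_nonneg hc hx'

/-- Pairs `(G, t)` where the matrix `G` has scalar entries. -/
def scalarSubspace (S B : Type*) [CStarAlgebra B] : Submodule ℝ ((S × S →₀ B) × ℝ) where
  carrier := {q | ∀ p, ∃ c : ℂ, q.1 p = algebraMap ℂ B c}
  add_mem' := by
    intro q q' h h' p
    obtain ⟨c, hc⟩ := h p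
    obtain ⟨c', hc'⟩ := h' p
    exact ⟨c + c', by rw [map_add, ← hc, ← hc']; rfl⟩
  zero_mem' := fun p => ⟨0, by simp⟩
  smul_mem' := by
    intro t q h p
    obtain ⟨c, hc⟩ := h p
    refine ⟨t * c, ?_⟩
    change t • q.1 p = _
    rw [hc, ← Complex.coe_smul, Algebra.algebraMap_eq_smul_one, Algebra.algebraMap_eq_smul_one,
      smul_smul]

lemma exists_scalar_add_eq_sum (G : H × H →₀ B) :
    ∃ T : H × H →₀ B, (∀ p, ∃ c : ℂ, T p = algebraMap ℂ B c) ∧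
      ∃ (n : ℕ) (x : Fin n → H →₀ B), ∀ h k, (T + G) (h, k) + star ((T + G) (k, h))
        = ∑ r, star (x r h) * x r k := by
  classical
  induction G using Finsupp.induction_linear with
  | zero => exact ⟨0, fun p => ⟨0, by simp⟩, 0, Fin.elim0, by simp⟩
  | add G G' hG hG' =>
    obtain ⟨T, hT, n, x, hx⟩ := hG
    obtain ⟨T', hT', m, y, hy⟩ := hG'
    refine ⟨T + T', fun p => ?_, n + m, Fin.append x y, fun h k => ?_⟩
    · obtain ⟨c, hc⟩ := hT p
      obtain ⟨c', hc'⟩ := hT' p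
      exact ⟨c + c', by rw [map_add, ← hc, ← hc']; rfl⟩
    · simp only [Fin.sum_univ_add, Fin.append_left, Fin.append_right, ← hx, ← hy,
        Finsupp.add_apply, star_add]
      abel
  | single p a =>
    obtain ⟨h₀, k₀⟩ := p
    obtain ⟨z, hz⟩ := exists_star_mul_self_add a
    refine ⟨Finsupp.single (h₀, h₀) (algebraMap ℂ B (1 / 2))
      + Finsupp.single (k₀, k₀) (algebraMap ℂ B (((‖a‖ ^ 2 : ℝ) : ℂ) / 2)), fun p => ?_, 2,
      ![Finsupp.single h₀ 1 + Finsupp.single k₀ a, Finsupp.single k₀ z], fun h k => ?_⟩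
    · refine ⟨(if (h₀, h₀) = p then 1 / 2 else 0)
        + (if (k₀, k₀) = p then ((‖a‖ ^ 2 : ℝ) : ℂ) / 2 else 0), ?_⟩
      rw [Finsupp.add_apply, Finsupp.single_apply, Finsupp.single_apply, map_add]
      split_ifs <;> simp
    · have h1 : algebraMap ℂ B (1 / 2) + algebraMap ℂ B (1 / 2) = 1 := by
        rw [← map_add]; norm_num
      have h1s : star (algebraMap ℂ B (1 / 2)) = algebraMap ℂ B (1 / 2) := by
        rw [← algebraMap_star_comm]; simp
      have h2 : algebraMap ℂ B (((‖a‖ ^ 2 : ℝ) : ℂ) / 2)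
          + algebraMap ℂ B (((‖a‖ ^ 2 : ℝ) : ℂ) / 2) = star a * a + star z * z := by
        rw [← map_add, hz, Algebra.algebraMap_eq_smul_one, add_halves]
      have h2s : star (algebraMap ℂ B (((‖a‖ ^ 2 : ℝ) : ℂ) / 2))
          = algebraMap ℂ B (((‖a‖ ^ 2 : ℝ) : ℂ) / 2) := by
        rw [← algebraMap_star_comm]
        congr 1
        rw [RCLike.star_def, map_div₀, Complex.conj_ofReal, map_ofNat]
      generalize algebraMap ℂ B (1 / 2) = α at *
      generalize algebraMap ℂ B (((‖a‖ ^ 2 : ℝ) : ℂ) / 2) = β at *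
      simp only [Fin.sum_univ_two, Matrix.cons_val_zero, Matrix.cons_val_one, Finsupp.add_apply,
        Finsupp.single_apply, Prod.mk.injEq, star_add]
      have h2' : star z * z = β + β - star a * a := by rw [h2]; abel
      have hP : ∀ s t : H, (s = t) = True ∨ (s = t) = False := fun s t => by
        by_cases e : s = t <;> simp [e]
      rcases hP h₀ h with e1 | e1 <;> rcases hP h₀ k with e2 | e2 <;>
        rcases hP k₀ h with e3 | e3 <;> rcases hP k₀ k with e4 | e4 <;>
        simp only [e1, e2, e3, e4, and_self, and_true, and_false, if_true,
          if_false, star_zero, star_one, add_zero, zero_add, mul_zero, zero_mul, mul_one, one_mul,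
          h1s, h2s, mul_add, add_mul] <;>
        (try simp only [h2', ← h1]) <;> abel

end Extension

section Majorant

variable {H : Type*} [NormedAddCommGroup H] [InnerProductSpace ℂ H] [CompleteSpace H]
variable {B : Type*} [CStarAlgebra B]

lemma gramTrace_nonneg_of_mem_columnCone {χ : B →⋆ₐ[ℂ] ℂ} {Φ : B →ₐ[ℂ] (H →L[ℂ] H)} {K : ℝ}
    (hK : 0 ≤ K)
    (hΦ : ∀ (n : ℕ) (Y Z : Matrix (Fin n) (Fin n) B), Yᴴ * Y + Zᴴ * Z = 1 → ∀ b : Fin n → H,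
      ∑ r, ‖∑ t, Φ (Y r t) (b t)‖ ^ 2 ≤ K * ∑ t, ‖b t‖ ^ 2)
    {q : (H × H →₀ B) × ℝ} (hq : q ∈ columnCone Φ) (hs : q ∈ scalarSubspace H B) :
    0 ≤ 2 * K * gramTrace χ q.1 + q.2 := by
  classical
  obtain ⟨G, t⟩ := q
  obtain ⟨n, x, hx, ht⟩ := hq
  choose c hc using hs
  simp only at hx ht hc ⊢
  have hχ : ∀ p, G p = algebraMap ℂ B (χ (G p)) := by
    intro p
    rw [hc p, AlgHomClass.commutes χ (c p)]; rfl
  let F : Finset H := (G.support.image Prod.fst ∪ G.support.image Prod.snd) ∪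
    Finset.univ.biUnion fun r => (x r).support
  have hG : G.support ⊆ F ×ˢ F := by
    intro p hp
    rw [Finset.mem_product]
    exact ⟨Finset.mem_union_left _ (Finset.mem_union_left _ (Finset.mem_image_of_mem _ hp)),
      Finset.mem_union_left _ (Finset.mem_union_right _ (Finset.mem_image_of_mem _ hp))⟩
  have hxF : ∀ r, (x r).support ⊆ F := fun r =>
    (Finset.subset_biUnion_of_mem (fun r => (x r).support) (Finset.mem_univ r)).trans
      Finset.subset_union_right
  let X : Matrix (Fin n) F B := Matrix.of fun r h => x r h
  let T : Matrix F F ℂ := Matrix.of fun h k =>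
    χ (G ((h : H), (k : H))) + star (χ (G ((k : H), (h : H))))
  have hXT : Xᴴ * X = T.map (algebraMap ℂ B) := by
    refine Matrix.ext fun h k => ?_
    rw [Matrix.mul_apply, Matrix.map_apply]
    change ∑ r, star (x r h) * x r k = algebraMap ℂ B (_ + _)
    rw [← hx, map_add, algebraMap_star_comm, ← hχ, ← hχ]
  have hY : (Matrix.fromBlocks (0 : Matrix (Fin n) (Fin n) B) X 0 (0 : Matrix F F B))ᴴ *
      Matrix.fromBlocks (0 : Matrix (Fin n) (Fin n) B) X 0 (0 : Matrix F F B)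
      = (Matrix.fromBlocks (0 : Matrix (Fin n) (Fin n) ℂ) 0 0 T).map (algebraMap ℂ B) := by
    rw [Matrix.fromBlocks_conjTranspose, Matrix.fromBlocks_multiply, Matrix.fromBlocks_map, ← hXT]
    simp
  have key := sum_norm_sq_le_gram (χ := χ) hK hΦ hY (Sum.elim (fun _ => 0) fun h : F => (h : H))
  simp only [Fintype.sum_sum_type, Matrix.fromBlocks_apply₁₁, Matrix.fromBlocks_apply₁₂,
    Matrix.fromBlocks_apply₂₁, Matrix.fromBlocks_apply₂₂, Sum.elim_inl, Sum.elim_inr,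
    Matrix.zero_apply, map_zero, zero_mul, Finset.sum_const_zero, zero_add, add_zero,
    zero_apply, norm_zero, ne_eq, OfNat.ofNat_ne_zero, not_false_eq_true, zero_pow] at key
  have hl : ∀ r, ∑ h : F, Φ (X r h) (h : H) = columnEval Φ (x r) := fun r =>
    (columnEval_eq_sum Φ (hxF r)).symm
  simp only [hl] at key
  have hr : (∑ h : F, ∑ k : F, T h k * inner ℂ (h : H) (k : H)).re = 2 * gramTrace χ G := by
    have e : ∑ h : F, ∑ k : F, T h k * inner ℂ (h : H) (k : H)
        = ∑ h : F, ∑ k : F, χ (G ((h : H), (k : H))) * inner ℂ (h : H) (k : H)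
          + star (∑ h : F, ∑ k : F, χ (G ((h : H), (k : H))) * inner ℂ (h : H) (k : H)) := by
      rw [star_sum]
      simp only [star_sum, star_mul']
      rw [Finset.sum_comm (f := fun (h k : F) => star (χ (G ((h : H), (k : H)))) * _),
        ← Finset.sum_add_distrib]
      refine Finset.sum_congr rfl fun h _ => ?_
      rw [← Finset.sum_add_distrib]
      refine Finset.sum_congr rfl fun k _ => ?_
      rw [RCLike.star_def, inner_conj_symm, ← add_mul]
      rfl
    rw [e, Complex.add_re, gramTrace_eq_sum χ hG, RCLike.star_def, Complex.conj_re, two_mul]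
  rw [hr] at key
  linarith

/-- A real functional on matrices over `B` that dominates `x ↦ ‖Φ · x‖²`. -/
lemma exists_majorant {χ : B →⋆ₐ[ℂ] ℂ} {Φ : B →ₐ[ℂ] (H →L[ℂ] H)} {K : ℝ}
    (hK : 0 ≤ K)
    (hΦ : ∀ (n : ℕ) (Y Z : Matrix (Fin n) (Fin n) B), Yᴴ * Y + Zᴴ * Z = 1 → ∀ b : Fin n → H,
      ∑ r, ‖∑ t, Φ (Y r t) (b t)‖ ^ 2 ≤ K * ∑ t, ‖b t‖ ^ 2) :
    ∃ s : (H × H →₀ B) →ₗ[ℝ] ℝ,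
      (∀ G, (∀ h k, G (h, k) + star (G (k, h)) = 0) → s G = 0) ∧
      (∀ x : H →₀ B, ‖columnEval Φ x‖ ^ 2 ≤ s (columnProd x x)) ∧
      ∀ h : H, s (Finsupp.single (h, h) 1) = 2 * K * ‖h‖ ^ 2 := by
  let f : ((H × H →₀ B) × ℝ) →ₗ.[ℝ] ℝ := ⟨scalarSubspace H B,
    ((2 * K) • ((gramTrace χ).comp (LinearMap.fst ℝ _ _)) + LinearMap.snd ℝ _ _).comp
      (scalarSubspace H B).subtype⟩
  have hf : ∀ q : f.domain, f q = 2 * K * gramTrace χ (q : (H × H →₀ B) × ℝ).1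
    + (q : (H × H →₀ B) × ℝ).2 := fun q => rfl
  obtain ⟨g, hg, hg'⟩ := riesz_extension (columnCone Φ) f
    (fun q hq => by
      rw [hf]
      exact gramTrace_nonneg_of_mem_columnCone hK hΦ hq q.2)
    (fun q => by
      obtain ⟨T, hT, n, x, hx⟩ := exists_scalar_add_eq_sum q.1
      refine ⟨⟨(T, -q.2), hT⟩, n, x, hx, ?_⟩
      change 0 ≤ -q.2 + q.2 + _
      rw [neg_add_cancel, zero_add]
      positivity)
  have hg1 : ∀ t, g (0, t) = t := by
    intro t
    have := hg ⟨(0, t), fun p => ⟨0, by simp⟩⟩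
    rw [hf] at this
    simpa using this
  have hsplit : ∀ G t, g (G, t) = g (G, 0) + t := by
    intro G t
    rw [← hg1 t, ← map_add, hg1]
    simp
  refine ⟨g.comp (LinearMap.inl ℝ _ _), fun G hG => ?_, fun x => ?_, fun h => ?_⟩
  · rw [LinearMap.comp_apply, LinearMap.inl_apply]
    have h1 : 0 ≤ g (G, 0) := hg' _ ⟨0, Fin.elim0, by simpa using hG, by simp⟩
    have h2 : 0 ≤ g (-G, 0) := hg' _ ⟨0, Fin.elim0, by
      intro h k
      change -G (h, k) + star (-G (k, h)) = _
      rw [star_neg, ← neg_add, hG]; simp, by simp⟩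
    have h3 : g (-G, 0) = - g (G, 0) := by rw [← map_neg]; simp
    linarith
  · have h1 : 0 ≤ g (columnProd x x, -(2 * ‖columnEval Φ x‖ ^ 2)) := by
      refine hg' _ ⟨2, fun _ => x, fun h k => ?_, ?_⟩
      · simp [columnProd_apply, two_smul]
      · simp
    rw [hsplit] at h1
    rw [LinearMap.comp_apply, LinearMap.inl_apply]
    nlinarith [sq_nonneg ‖columnEval Φ x‖]
  · classical
    have := hg ⟨(Finsupp.single (h, h) 1, 0), fun p =>
      ⟨if (h, h) = p then 1 else 0, by
        change Finsupp.single (h, h) (1 : B) p = _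
        rw [Finsupp.single_apply]; split_ifs <;> simp⟩⟩
    rw [hf] at this
    rw [LinearMap.comp_apply, LinearMap.inl_apply]
    simpa [gramTrace_single] using this

end Majorant

section Hilbert

variable {H : Type*} [NormedAddCommGroup H] [InnerProductSpace ℂ H] [CompleteSpace H]

open ContinuousLinearMap in
/-- A pre-Hilbert space mapping boundedly onto `H`, openly, yields an invertible positive
operator on `H` that is decreased under conjugation by operators lifting to contractions. -/
lemma exists_nonneg_isUnit_conj_le {E : Type*} [SeminormedAddCommGroup E] [InnerProductSpace ℂ E]
    (ev : E →ₗ[ℂ] H) (hev : ∀ x, ‖ev x‖ ^ 2 ≤ ‖x‖ ^ 2) {K : ℝ} (hK : 0 < K)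
    (hsurj : ∀ h, ∃ x, ev x = h ∧ ‖x‖ ^ 2 ≤ K * ‖h‖ ^ 2) :
    ∃ Q : H →L[ℂ] H, 0 ≤ Q ∧ IsUnit Q ∧
      ∀ (W : H →L[ℂ] H) (w : E → E), (∀ x, ‖w x‖ ≤ ‖x‖) → (∀ x, ev (w x) = W (ev x)) →
        W * Q * star W ≤ Q := by
  let evc : E →L[ℂ] H := ev.mkContinuous 1 fun x => by
    rw [one_mul]; exact (sq_le_sq₀ (norm_nonneg _) (norm_nonneg _)).mp (hev x)
  let i : E →L[ℂ] UniformSpace.Completion E := UniformSpace.Completion.toComplL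
  let V : UniformSpace.Completion E →L[ℂ] H := evc.extend i
  have hV : ∀ x : E, V (x : UniformSpace.Completion E) = ev x := fun x =>
    extend_eq evc (e := i) (UniformSpace.Completion.denseRange_coe)
      (UniformSpace.Completion.isUniformInducing_coe E) x
  have hQ : ∀ k, RCLike.re (inner ℂ ((V ∘L adjoint V) k) k) = ‖adjoint V k‖ ^ 2 := by
    intro k
    rw [comp_apply, ← adjoint_inner_right, inner_self_eq_norm_sq_to_K]
    norm_cast
  have hpos : (0 : H →L[ℂ] H) ≤ V ∘L adjoint V := by
    rw [nonneg_iff_isPositive]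
    exact isPositive_self_comp_adjoint V
  have hlow : algebraMap ℝ (H →L[ℂ] H) K⁻¹ ≤ V ∘L adjoint V := by
    rw [le_def, isPositive_def']
    refine ⟨(IsSelfAdjoint.of_nonneg hpos).sub (IsSelfAdjoint.algebraMap _ (.all _)), fun k => ?_⟩
    obtain ⟨x, hxk, hx⟩ := hsurj k
    have e1 : RCLike.re (inner ℂ (algebraMap ℝ (H →L[ℂ] H) K⁻¹ k) k) = K⁻¹ * ‖k‖ ^ 2 := by
      rw [Algebra.algebraMap_eq_smul_one, smul_apply, one_apply_eq_self, ← Complex.coe_smul,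
        inner_smul_left, inner_self_eq_norm_sq_to_K, Complex.conj_ofReal]
      exact (Complex.re_ofReal_mul _ _).trans (by norm_cast)
    have e2 : ‖k‖ ^ 2 ≤ ‖adjoint V k‖ * ‖x‖ := by
      have h1 : inner ℂ (adjoint V k) (x : UniformSpace.Completion E) = (‖k‖ : ℂ) ^ 2 := by
        rw [adjoint_inner_left, hV, hxk, inner_self_eq_norm_sq_to_K]; rfl
      have h2 := norm_inner_le_norm (𝕜 := ℂ) (adjoint V k) (x : UniformSpace.Completion E)
      rw [h1, UniformSpace.Completion.norm_coe, norm_pow, Complex.norm_real, norm_norm] at h2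
      exact h2
    have e3 : K⁻¹ * ‖k‖ ^ 2 ≤ ‖adjoint V k‖ ^ 2 := by
      rw [inv_mul_le_iff₀ hK]
      rcases eq_or_ne k 0 with rfl | hk
      · simp
      have hk' : 0 < ‖k‖ ^ 2 := by positivity
      refine le_of_mul_le_mul_right ?_ hk'
      calc ‖k‖ ^ 2 * ‖k‖ ^ 2 ≤ (‖adjoint V k‖ * ‖x‖) * (‖adjoint V k‖ * ‖x‖) :=
            mul_self_le_mul_self (by positivity) e2
        _ = ‖adjoint V k‖ ^ 2 * ‖x‖ ^ 2 := by ring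
        _ ≤ ‖adjoint V k‖ ^ 2 * (K * ‖k‖ ^ 2) := by gcongr
        _ = _ := by ring
    rw [reApplyInnerSelf, sub_apply, inner_sub_left, map_sub, hQ, e1]
    linarith
  refine ⟨V ∘L adjoint V, hpos, CStarAlgebra.isUnit_of_le _ hlow ?_, fun W w hw hW => ?_⟩
  · exact isStrictlyPositive_algebraMap (inv_pos.mpr hK)
  · have hle : ∀ k, ‖adjoint V (star W k)‖ ≤ ‖adjoint V k‖ := by
      intro k
      have h1 : ∀ z : UniformSpace.Completion E,
          ‖inner ℂ (adjoint V (star W k)) z‖ ≤ ‖adjoint V k‖ * ‖z‖ := by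
        intro z
        induction z using UniformSpace.Completion.induction_on with
        | hp => exact isClosed_le (by fun_prop) (by fun_prop)
        | ih x =>
          have : inner ℂ (adjoint V (star W k)) (x : UniformSpace.Completion E)
              = inner ℂ (adjoint V k) (w x : UniformSpace.Completion E) := by
            rw [adjoint_inner_left, adjoint_inner_left, hV, hV, star_eq_adjoint,
              adjoint_inner_left, hW]
          rw [this]
          refine (norm_inner_le_norm _ _).trans ?_
          rw [UniformSpace.Completion.norm_coe, UniformSpace.Completion.norm_coe]
          exact mul_le_mul_of_nonneg_left (hw x) (norm_nonneg _)
      have h2 := h1 (adjoint V (star W k))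
      rw [inner_self_eq_norm_sq_to_K, norm_pow, RCLike.norm_ofReal, abs_norm, sq] at h2
      rcases (norm_nonneg (adjoint V (star W k))).eq_or_lt with h0 | h0
      · rw [← h0]; positivity
      · exact le_of_mul_le_mul_right h2 h0
    have hsa : IsSelfAdjoint (V ∘L adjoint V) := IsSelfAdjoint.of_nonneg hpos
    rw [le_def, isPositive_def']
    refine ⟨hsa.sub (hsa.conjugate W), fun k => ?_⟩
    have e : RCLike.re (inner ℂ ((W * (V ∘L adjoint V) * star W) k) k)
        = ‖adjoint V (star W k)‖ ^ 2 := by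
      rw [← hQ, mul_apply_eq_comp, mul_apply_eq_comp, star_eq_adjoint, ← adjoint_inner_right]
    rw [reApplyInnerSelf, sub_apply, inner_sub_left, map_sub, hQ, e, sub_nonneg]
    exact pow_le_pow_left₀ (norm_nonneg _) (hle k) 2

end Hilbert

section Similarity

variable {H : Type*} [NormedAddCommGroup H] [InnerProductSpace ℂ H] [CompleteSpace H]
variable {B : Type*} [CStarAlgebra B]

lemma columnProd_add_left {S : Type*} (x y z : S →₀ B) :
    columnProd (x + y) z = columnProd x z + columnProd y z := by
  refine Finsupp.ext fun p => ?_
  simp [columnProd_apply, add_mul]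

lemma columnProd_smul_left {S : Type*} (c : ℂ) (x y : S →₀ B) :
    columnProd (c • x) y = star c • columnProd x y := by
  refine Finsupp.ext fun p => ?_
  simp [columnProd_apply]

lemma columnProd_mapRange {S : Type*} {u : B} (hu : star u * u = 1) (x y : S →₀ B) :
    columnProd (x.mapRange (fun a => u * a) (mul_zero u))
      (y.mapRange (fun a => u * a) (mul_zero u)) = columnProd x y := by
  refine Finsupp.ext fun p => ?_
  simp only [columnProd_apply, Finsupp.mapRange_apply, star_mul]
  rw [mul_assoc, ← mul_assoc (star u), hu, one_mul]

lemma columnProd_single {S : Type*} (h : S) :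
    columnProd (Finsupp.single h (1 : B)) (Finsupp.single h 1) = Finsupp.single (h, h) 1 := by
  classical
  refine Finsupp.ext fun p => ?_
  obtain ⟨a, b⟩ := p
  simp only [columnProd_apply, Finsupp.single_apply, Prod.mk.injEq]
  rcases eq_or_ne h a with rfl | h1 <;> rcases eq_or_ne h b with rfl | h2 <;> simp [*]

/-- The pre-inner product on columns over `B` given by a real functional on matrices. -/
abbrev columnCore {S : Type*} (s : (S × S →₀ B) →ₗ[ℝ] ℝ)
    (hs : ∀ G, (∀ h k, G (h, k) + star (G (k, h)) = 0) → s G = 0)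
    (hpos : ∀ x : S →₀ B, 0 ≤ s (columnProd x x)) : PreInnerProductSpace.Core ℂ (S →₀ B) where
  inner x y := Module.Dual.extendRCLike s (columnProd x y)
  conj_inner_symm x y := by
    have h1 : s (columnProd y x) = s (columnProd x y) := by
      rw [← sub_eq_zero, ← map_sub]
      refine hs _ fun h k => ?_
      simp [columnProd_apply]
    have h2 : s (Complex.I • columnProd y x) = - s (Complex.I • columnProd x y) := by
      rw [← sub_eq_zero, sub_neg_eq_add, ← map_add]
      refine hs _ fun h k => ?_
      simp [columnProd_apply]
    refine RCLike.ext ?_ ?_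
    · rw [RCLike.conj_re, Module.Dual.re_extendRCLike_apply, Module.Dual.re_extendRCLike_apply, h1]
    · rw [RCLike.conj_im, Module.Dual.im_extendRCLike_apply, Module.Dual.im_extendRCLike_apply]
      change - - s (Complex.I • _) = - s (Complex.I • _)
      rw [h2, neg_neg]
  re_inner_nonneg x := by
    rw [Module.Dual.re_extendRCLike_apply]
    exact hpos x
  add_left x y z := by rw [columnProd_add_left, map_add]
  smul_left x y c := by rw [columnProd_smul_left, map_smul]; rfl

lemma exists_nonneg_isUnit_conj_unitary_le {χ : B →⋆ₐ[ℂ] ℂ} {Φ : B →ₐ[ℂ] (H →L[ℂ] H)} {K : ℝ}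
    (hK : 0 < K)
    (hΦ : ∀ (n : ℕ) (Y Z : Matrix (Fin n) (Fin n) B), Yᴴ * Y + Zᴴ * Z = 1 → ∀ b : Fin n → H,
      ∑ r, ‖∑ t, Φ (Y r t) (b t)‖ ^ 2 ≤ K * ∑ t, ‖b t‖ ^ 2) :
    ∃ Q : H →L[ℂ] H, 0 ≤ Q ∧ IsUnit Q ∧
      ∀ u : B, star u * u = 1 → Φ u * Q * star (Φ u) ≤ Q := by
  obtain ⟨s, hs, hdom, hone⟩ := exists_majorant (χ := χ) hK.le hΦ
  let core := columnCore s hs fun x => (sq_nonneg _).trans (hdom x)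
  let i₁ : SeminormedAddCommGroup (H →₀ B) :=
    InnerProductSpace.Core.toSeminormedAddCommGroup (c := core)
  let i₂ : InnerProductSpace ℂ (H →₀ B) := InnerProductSpace.ofCore core
  have hnorm : ∀ x : H →₀ B, ‖x‖ ^ 2 = s (columnProd x x) := by
    intro x
    rw [← inner_self_eq_norm_sq (𝕜 := ℂ)]
    exact Module.Dual.re_extendRCLike_apply s _
  obtain ⟨Q, hQ, hQu, hQle⟩ := exists_nonneg_isUnit_conj_le (columnEval Φ)
    (fun x => by rw [hnorm]; exact hdom x) (K := 2 * K) (by positivity) (fun h =>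
      ⟨Finsupp.single h 1, by rw [columnEval_single, map_one]; rfl, by
        rw [hnorm, columnProd_single, hone]⟩)
  refine ⟨Q, hQ, hQu, fun u hu =>
    hQle (Φ u) (fun x => x.mapRange (fun a => u * a) (mul_zero u)) (fun x => ?_)
      (columnEval_mapRange Φ u)⟩
  rw [← sq_le_sq₀ (norm_nonneg _) (norm_nonneg _), hnorm, hnorm, columnProd_mapRange hu]

/-- A homomorphism satisfying the completely bounded estimate is intertwined with its adjoint by
an invertible positive operator. -/
lemma exists_intertwiner {χ : B →⋆ₐ[ℂ] ℂ} {Φ : B →ₐ[ℂ] (H →L[ℂ] H)} {K : ℝ}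
    (hK : 0 < K)
    (hΦ : ∀ (n : ℕ) (Y Z : Matrix (Fin n) (Fin n) B), Yᴴ * Y + Zᴴ * Z = 1 → ∀ b : Fin n → H,
      ∑ r, ‖∑ t, Φ (Y r t) (b t)‖ ^ 2 ≤ K * ∑ t, ‖b t‖ ^ 2) :
    ∃ Q : H →L[ℂ] H, 0 ≤ Q ∧ IsUnit Q ∧ ∀ a : B, Φ a * Q = Q * star (Φ (star a)) := by
  obtain ⟨Q, hQ, hQu, hle⟩ := exists_nonneg_isUnit_conj_unitary_le (χ := χ) hK hΦ
  refine ⟨Q, hQ, hQu, fun a => ?_⟩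
  have ha : a ∈ Submodule.span ℂ (unitary B : Set B) := by
    rw [CStarAlgebra.span_unitary]; trivial
  induction ha using Submodule.span_induction with
  | mem u hu =>
    have h1 : Φ u * Φ (star u) = 1 := by rw [← map_mul, hu.2, map_one]
    have h2 : Φ u * Q * star (Φ u) = Q := by
      refine le_antisymm (hle u hu.1) ?_
      have h3 := star_right_conjugate_le_conjugate
        (hle (star u) (by rw [star_star]; exact hu.2)) (Φ u)
      have h4 : Φ u * (Φ (star u) * Q * star (Φ (star u))) * star (Φ u)
          = (Φ u * Φ (star u)) * Q * star (Φ u * Φ (star u)) := by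
        rw [star_mul]; simp only [mul_assoc]
      rwa [h4, h1, star_one, mul_one, one_mul] at h3
    have h5 : Φ (star u) * Φ u = 1 := by rw [← map_mul, hu.1, map_one]
    calc Φ u * Q = Φ u * Q * star (Φ (star u) * Φ u) := by rw [h5, star_one, mul_one]
      _ = Φ u * Q * star (Φ u) * star (Φ (star u)) := by rw [star_mul, mul_assoc (Φ u * Q)]
      _ = Q * star (Φ (star u)) := by rw [h2]
  | zero => simp
  | add x y _ _ hx hy => rw [map_add, add_mul, hx, hy, star_add, map_add, star_add, mul_add]
  | smul c x _ hx => rw [map_smul, smul_mul_assoc, hx, star_smul, map_smul, star_smul, star_star,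
      mul_smul_comm]

end Similarity

section Conclusion

variable {H : Type*} [NormedAddCommGroup H] [InnerProductSpace ℂ H] [CompleteSpace H]

lemma VonNeumannAlgebra.sqrt_mem_s5 (M : VonNeumannAlgebra H) {a : H →L[ℂ] H} (ha : a ∈ M) :
    CFC.sqrt a ∈ M := by
  rw [← M.commutant_commutant, VonNeumannAlgebra.mem_commutant_iff]
  intro g hg
  rw [VonNeumannAlgebra.mem_commutant_iff] at hg
  exact (Commute.cfcₙ_nnreal (hg a ha) _).symm

lemma exists_intertwiner_of_completelyBounded {A : Type*} [NonUnitalCStarAlgebra A]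
    (φ : A →L[ℂ] (H →L[ℂ] H)) (hmul : ∀ a b : A, φ (a * b) = φ a * φ b)
    (hcb : CompletelyBounded (⇑φ)) :
    ∃ Q : H →L[ℂ] H, 0 ≤ Q ∧ IsUnit Q ∧ ∀ a : A, φ a * Q = Q * star (φ (star a)) := by
  obtain ⟨C, hC⟩ := hcb
  let ψ : A →ₙₐ[ℂ] (H →L[ℂ] H) :=
    { toFun := φ
      map_smul' := fun c a => map_smul φ c a
      map_zero' := map_zero φ
      map_add' := map_add φ
      map_mul' := hmul }
  have hψ : ∀ a : A, Unitization.lift (R := ℂ) ψ (a : Unitization ℂ A) = φ a := fun a => by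
    rw [← Unitization.lift_symm_apply_apply, Equiv.symm_apply_apply]; rfl
  have hC' : ∀ (n : ℕ) (x : Matrix (Fin n) (Fin n) A),
      cstarMatrixNorm (x.map φ) ≤ max C 0 * cstarMatrixNorm x := fun n x =>
    (hC n x).trans (mul_le_mul_of_nonneg_right (le_max_left _ _) (Real.sqrt_nonneg _))
  let χ : Unitization ℂ A →⋆ₐ[ℂ] ℂ := Unitization.starLift 0
  obtain ⟨Q, hQ, hQu, h⟩ := exists_intertwiner (χ := χ) (Φ := Unitization.lift ψ)
    (K := 2 * (1 + (max C 0 * 2) ^ 2)) (by positivity)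
    (fun n Y Z h b => sum_norm_sq_extension_le hψ (le_max_right _ _) hC' h b)
  refine ⟨Q, hQ, hQu, fun a => ?_⟩
  rw [← hψ, ← hψ, h, Unitization.inr_star]

end Conclusion

/-- Every completely bounded representation of a C*-algebra into an *injective* von Neumann
algebra `M` (i.e. one admitting a conditional expectation `E : B(H) → M`) is similar, by a
positive invertible element of `M`, to a `*`-representation. -/
theorem cb_rep_into_injective_vNa_similar_starRep
    {A : Type*} [NonUnitalCStarAlgebra A]
    {H : Type*} [NormedAddCommGroup H] [InnerProductSpace ℂ H] [CompleteSpace H]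
    (M : VonNeumannAlgebra H)
    (hinj : ∃ E : (H →L[ℂ] H) →ₗ[ℂ] (H →L[ℂ] H),
      (∀ x, E x ∈ M) ∧ E 1 = 1 ∧ (∀ x, 0 ≤ x → 0 ≤ E x) ∧
      (∀ m ∈ M, E m = m) ∧
      (∀ m₁ ∈ M, ∀ m₂ ∈ M, ∀ x, E (m₁ * x * m₂) = m₁ * E x * m₂))
    (φ : A →L[ℂ] (H →L[ℂ] H))
    (hmem : ∀ a : A, φ a ∈ M)
    (hmul : ∀ a b : A, φ (a * b) = φ a * φ b)
    (hcb : CompletelyBounded (⇑φ)) :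
    ∃ S : H →L[ℂ] H, S ∈ M ∧ 0 ≤ S ∧ IsUnit S ∧
      IsStarRep (fun a : A => S * φ a * Ring.inverse S) := by
  obtain ⟨E, hEM, hE1, hEpos, -, hEmod⟩ := hinj
  obtain ⟨Q, hQ, ⟨v, rfl⟩, hint⟩ := exists_intertwiner_of_completelyBounded φ hmul hcb
  set P : H →L[ℂ] H := ↑v⁻¹ with hPdef
  have hPint : ∀ a, P * φ a = star (φ (star a)) * P := by
    intro a
    rw [hPdef, Units.inv_mul_eq_iff_eq_mul, ← mul_assoc, Units.eq_mul_inv_iff_mul_eq, hint]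
  have hP : 0 ≤ P := by
    have hsa : star (v : H →L[ℂ] H) = v := (IsSelfAdjoint.of_nonneg hQ).star_eq
    have h := star_left_conjugate_nonneg hQ P
    rwa [mul_assoc, hPdef, Units.mul_inv, mul_one, ← Units.coe_star_inv,
      show star v = v from Units.ext hsa] at h
  have hEu : IsUnit (E P) := by
    nontriviality (H →L[ℂ] H)
    obtain ⟨r, hr, hrP⟩ := (CFC.exists_pos_algebraMap_le_iff (IsSelfAdjoint.of_nonneg hP)).2
      fun x hx => (v⁻¹.isUnit.isStrictlyPositive hP).spectrum_pos hx
    have hEr : algebraMap ℝ (H →L[ℂ] H) r ≤ E P := by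
      have h := hEpos _ (sub_nonneg.mpr hrP)
      rwa [map_sub, Algebra.algebraMap_eq_smul_one, ← Complex.coe_smul, map_smul, hE1,
        Complex.coe_smul, ← Algebra.algebraMap_eq_smul_one, sub_nonneg] at h
    exact CStarAlgebra.isUnit_of_le _ hEr (isStrictlyPositive_algebraMap hr)
  have hEint : ∀ a, E P * φ a = star (φ (star a)) * E P := by
    intro a
    have h1 := hEmod 1 (one_mem M) (φ a) (hmem a) P
    have h2 := hEmod _ (star_mem (hmem (star a))) 1 (one_mem M) P
    rw [one_mul, one_mul] at h1
    rw [mul_one, mul_one] at h2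
    rw [← h1, ← h2, hPint]
  have hSS : CFC.sqrt (E P) * CFC.sqrt (E P) = E P := CFC.sqrt_mul_sqrt_self _ (hEpos P hP)
  have hS0 : 0 ≤ CFC.sqrt (E P) := CFC.sqrt_nonneg _
  have hSM : CFC.sqrt (E P) ∈ M := M.sqrt_mem_s5 (hEM P)
  have hSu : IsUnit (CFC.sqrt (E P)) := by
    rw [← hSS] at hEu
    exact ((Commute.refl _).isUnit_mul_iff.mp hEu).1
  refine ⟨CFC.sqrt (E P), hSM, hS0, hSu, ?_⟩
  obtain ⟨w, hw⟩ := hSu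
  rw [← hw] at hSS hS0 ⊢
  have hsw : star (w : H →L[ℂ] H) = w := (IsSelfAdjoint.of_nonneg hS0).star_eq
  have hswi : star ((w⁻¹ : (H →L[ℂ] H)ˣ) : H →L[ℂ] H) = ↑w⁻¹ := by
    rw [← Units.coe_star_inv, show star w = w from Units.ext hsw]
  refine ⟨fun a b => ?_, fun a => ?_⟩
  · simp only [Ring.inverse_unit, hmul, mul_assoc, Units.inv_mul_cancel_left]
  · have h := hEint (star a)
    rw [star_star, ← hSS, mul_assoc] at h
    simp only [Ring.inverse_unit, star_mul, hsw, hswi]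
    rw [Units.mul_inv_eq_iff_eq_mul, mul_assoc, mul_assoc, ← h, Units.inv_mul_cancel_left]
end
end

section
/- Let A be a C*-algebra, M a von Neumann algebra on a complex Hilbert space H, π : A → M a *-representation, and T ∈ M a positive invertible operator. Define φ(a) = T⁻¹π(a)T, and set φ₁(a) = ½(T+T⁻¹)π(a)(T+T⁻¹), φ₂(a) = φ₃(a) = ½(Tπ(a)T + T⁻¹π(a)T⁻¹), and φ₄(a) = ½(T+iT⁻¹)π(a)(T−iT⁻¹). Then φ₁, φ₂, φ₃, φ₄ are completely positive maps from A to M and φ = φ₁ − φ₂ + i(φ₃ − φ₄). -/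
open scoped Matrix

noncomputable section

section

variable {A B : Type*}

theorem CStarAlgebra.exists_star_mul_self_add_eq_s8 [NonUnitalCStarAlgebra B] (u v : B) :
    ∃ w : B, star u * u + star v * v = star w * w := by
  let := CStarAlgebra.spectralOrder B
  have := CStarAlgebra.spectralOrderedRing B
  exact CStarAlgebra.nonneg_iff_eq_star_mul_self.mp
    (add_nonneg (star_mul_self_nonneg u) (star_mul_self_nonneg v))

theorem MatIsPos.add [NonUnitalCStarAlgebra B] {n : ℕ} {x y : Matrix (Fin n) (Fin n) B}
    (hx : MatIsPos x) (hy : MatIsPos y) : MatIsPos (x + y) := by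
  let := CStarAlgebra.spectralOrder B
  have := CStarAlgebra.spectralOrderedRing B
  obtain ⟨u, rfl⟩ := hx
  obtain ⟨v, rfl⟩ := hy
  obtain ⟨w, hw⟩ := CStarAlgebra.exists_star_mul_self_add_eq_s8
    (CStarMatrix.ofMatrix u) (CStarMatrix.ofMatrix v)
  exact ⟨CStarMatrix.ofMatrix.symm w, hw⟩

theorem CompletelyPositive.add [NonUnitalSemiring A] [StarRing A] [NonUnitalCStarAlgebra B]
    {φ ψ : A → B} (hφ : CompletelyPositive φ) (hψ : CompletelyPositive ψ) :
    CompletelyPositive (fun a => φ a + ψ a) :=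
  fun n x hx => (hφ n x hx).add (hψ n x hx)

/-- Conjugating an additive `*`-representation by a fixed element, `a ↦ w π(a) w*`, gives a
completely positive map. -/
theorem completelyPositive_conj [NonUnitalSemiring A] [StarRing A] [Semiring B] [StarRing B]
    (π : A →+ B) (hπ : IsStarRep π) (w : B) :
    CompletelyPositive (fun a => w * π a * star w) := by
  rintro n x ⟨y, rfl⟩
  refine ⟨y.map fun a => π a * star w, ?_⟩
  ext i j
  simp [Matrix.mul_apply, map_sum, hπ.1, hπ.2, Finset.mul_sum, Finset.sum_mul, mul_assoc]

end

theorem inv_two_smul_mul_mul_star {B : Type*} [Ring B] [StarRing B] [Algebra ℂ B]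
    [StarModule ℂ B] (w b : B) :
    (2 : ℂ)⁻¹ • (w * b * star w) =
      (((√2)⁻¹ : ℝ) : ℂ) • w * b * star ((((√2)⁻¹ : ℝ) : ℂ) • w) := by
  have h : (((√2)⁻¹ : ℝ) : ℂ) * (((√2)⁻¹ : ℝ) : ℂ) = (2 : ℂ)⁻¹ := by
    rw [← Complex.ofReal_mul, ← mul_inv, Real.mul_self_sqrt zero_le_two]
    simp
  rw [star_smul, smul_mul_assoc, smul_mul_assoc, mul_smul_comm, smul_smul, Complex.star_def,
    Complex.conj_ofReal, h]

theorem VonNeumannAlgebra.ringInverse_mem {H : Type*} [NormedAddCommGroup H]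
    [InnerProductSpace ℂ H] [CompleteSpace H] (M : VonNeumannAlgebra H) {T : H →L[ℂ] H}
    (hT : T ∈ M) : Ring.inverse T ∈ M := by
  rw [← M.commutant_commutant, VonNeumannAlgebra.mem_commutant_iff]
  intro S hS
  have h : Commute S T := (VonNeumannAlgebra.mem_commutant_iff.mp hS T hT).symm
  by_cases hu : IsUnit T
  · obtain ⟨u, rfl⟩ := hu
    rw [Ring.inverse_unit]
    exact h.units_inv_right
  · simp [Ring.inverse_non_unit T hu]

/-- Decomposition of `φ = T⁻¹π(·)T` into completely positive maps: with
`φ₁ = ½(T+T⁻¹)π(·)(T+T⁻¹)`, `φ₂ = φ₃ = ½(Tπ(·)T + T⁻¹π(·)T⁻¹)` and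
`φ₄ = ½(T+iT⁻¹)π(·)(T−iT⁻¹)`, all four maps are completely positive into `M` and
`φ = φ₁ - φ₂ + i(φ₃ - φ₄)`. -/
theorem conjugated_starRep_decomposition
    {A : Type*} [NonUnitalCStarAlgebra A]
    {H : Type*} [NormedAddCommGroup H] [InnerProductSpace ℂ H] [CompleteSpace H]
    (M : VonNeumannAlgebra H)
    (π : A →L[ℂ] (H →L[ℂ] H))
    (hmem : ∀ a : A, π a ∈ M)
    (hπ : IsStarRep (⇑π))
    (T : H →L[ℂ] H) (hTM : T ∈ M) (hTpos : 0 ≤ T) (hTu : IsUnit T) :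
    ∀ φ φ₁ φ₂ φ₃ φ₄ : A → (H →L[ℂ] H),
      (∀ a, φ a = Ring.inverse T * π a * T) →
      (∀ a, φ₁ a = (2 : ℂ)⁻¹ •
        ((T + Ring.inverse T) * π a * (T + Ring.inverse T))) →
      (∀ a, φ₂ a = (2 : ℂ)⁻¹ •
        (T * π a * T + Ring.inverse T * π a * Ring.inverse T)) →
      (∀ a, φ₃ a = (2 : ℂ)⁻¹ •
        (T * π a * T + Ring.inverse T * π a * Ring.inverse T)) →
      (∀ a, φ₄ a = (2 : ℂ)⁻¹ •
        ((T + Complex.I • Ring.inverse T) * π a * (T - Complex.I • Ring.inverse T))) →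
      (CompletelyPositive φ₁ ∧ ∀ a, φ₁ a ∈ M) ∧
      (CompletelyPositive φ₂ ∧ ∀ a, φ₂ a ∈ M) ∧
      (CompletelyPositive φ₃ ∧ ∀ a, φ₃ a ∈ M) ∧
      (CompletelyPositive φ₄ ∧ ∀ a, φ₄ a ∈ M) ∧
      ∀ a : A, φ a = φ₁ a - φ₂ a + Complex.I • (φ₃ a - φ₄ a) := by
  intro φ φ₁ φ₂ φ₃ φ₄ h h₁ h₂ h₃ h₄
  obtain rfl : φ₃ = φ₂ := funext fun a => (h₃ a).trans (h₂ a).symm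
  set R := Ring.inverse T
  have hRM : R ∈ M := M.ringInverse_mem hTM
  have hT : star T = T := (IsSelfAdjoint.of_nonneg hTpos).star_eq
  have hR : star R = R := by rw [← Ring.inverse_star, hT]
  have smul_mem (c : ℂ) {S : H →L[ℂ] H} (hS : S ∈ M) : c • S ∈ M :=
    M.toStarSubalgebra.smul_mem hS c
  have cp (w : H →L[ℂ] H) : CompletelyPositive fun a => (2 : ℂ)⁻¹ • (w * π a * star w) := by
    simp_rw [inv_two_smul_mul_mul_star w]
    exact completelyPositive_conj (π : A →+ (H →L[ℂ] H)) hπ _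
  have cp₂ : CompletelyPositive φ₃ ∧ ∀ a, φ₃ a ∈ M := by
    refine ⟨?_, fun a => ?_⟩
    · have e : φ₃ = fun a => (2 : ℂ)⁻¹ • (T * π a * star T) + (2 : ℂ)⁻¹ • (R * π a * star R) :=
        funext fun a => by rw [h₂, smul_add, hT, hR]
      exact e ▸ (cp T).add (cp R)
    · rw [h₂]
      exact smul_mem _ (add_mem (mul_mem (mul_mem hTM (hmem a)) hTM)
        (mul_mem (mul_mem hRM (hmem a)) hRM))
  refine ⟨⟨?_, fun a => ?_⟩, cp₂, cp₂, ⟨?_, fun a => ?_⟩, fun a => ?_⟩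
  · convert cp (T + R) using 2 with a
    rw [h₁, star_add, hT, hR]
  · rw [h₁]
    exact smul_mem _ (mul_mem (mul_mem (add_mem hTM hRM) (hmem a)) (add_mem hTM hRM))
  · convert cp (T + Complex.I • R) using 2 with a
    rw [h₄, star_add, star_smul, hT, hR, Complex.star_def, Complex.conj_I, neg_smul,
      sub_eq_add_neg]
  · rw [h₄]
    exact smul_mem _ (mul_mem (mul_mem (add_mem hTM (smul_mem _ hRM)) (hmem a))
      (sub_mem hTM (smul_mem _ hRM)))
  · rw [h, h₁, h₂, h₄]
    simp only [add_mul, mul_add, mul_sub, smul_mul_assoc, mul_smul_comm, smul_sub, smul_add,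
      smul_smul]
    match_scalars <;> ring_nf <;> norm_num [Complex.I_sq, pow_succ, mul_assoc]
end
end
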